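/- For every fixed ε > 0 there is a constant C(ε) such that for all nonzero squarefree integers a₁, a₂, a₃ (of either sign) that are coprime in pairs and all real B ≥ 2, one has n(B; a₁, a₂, a₃) ≤ C(ε) · B^{3/5 − 3/1555 + ε}. -/

import Mathlib

/-- For nonzero squarefree integers `a₁, a₂, a₃` that are coprime in pairs, and real `B`,
`nSet B a₁ a₂ a₃` is the set of sextuples `(x₁, x₂, x₃, y₁, y₂, y₃)` of positive integers
satisfying `a₁x₁²y₁³ + a₂x₂²y₂³ + a₃x₃²y₃³ = 0`, with `a₁y₁, a₂y₂, a₃y₃` squarefree,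
`|aᵢ|xᵢ²yᵢ³ ≤ B` for each `i`, `gcd(x₁y₁, x₂y₂, x₃y₃) = 1` and
`gcd(a₁a₂a₃, x₁x₂x₃y₁y₂y₃) = 1`. -/
def nSet (B : ℝ) (a₁ a₂ a₃ : ℤ) : Set (ℤ × ℤ × ℤ × ℤ × ℤ × ℤ) :=
  {t | ∃ x₁ x₂ x₃ y₁ y₂ y₃ : ℤ, t = (x₁, x₂, x₃, y₁, y₂, y₃) ∧
    0 < x₁ ∧ 0 < x₂ ∧ 0 < x₃ ∧ 0 < y₁ ∧ 0 < y₂ ∧ 0 < y₃ ∧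
    a₁ * x₁ ^ 2 * y₁ ^ 3 + a₂ * x₂ ^ 2 * y₂ ^ 3 + a₃ * x₃ ^ 2 * y₃ ^ 3 = 0 ∧
    Squarefree (a₁ * y₁) ∧ Squarefree (a₂ * y₂) ∧ Squarefree (a₃ * y₃) ∧
    ((|a₁| * x₁ ^ 2 * y₁ ^ 3 : ℤ) : ℝ) ≤ B ∧
    ((|a₂| * x₂ ^ 2 * y₂ ^ 3 : ℤ) : ℝ) ≤ B ∧
    ((|a₃| * x₃ ^ 2 * y₃ ^ 3 : ℤ) : ℝ) ≤ B ∧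
    Int.gcd (x₁ * y₁) (Int.gcd (x₂ * y₂) (x₃ * y₃)) = 1 ∧
    Int.gcd (a₁ * a₂ * a₃) (x₁ * x₂ * x₃ * y₁ * y₂ * y₃) = 1}


lemma M0_aux (ε : ℝ) (hε : 0 < ε) : ∃ C0 : ℝ, 1 ≤ C0 ∧ ∀ v : ℕ, ∀ p : ℕ, 2 ≤ p →
    ((v : ℝ) + 1) ≤ C0 * ((p : ℝ) ^ v) ^ ε := by
  have hl : 0 < Real.log 2 := Real.log_pos (by norm_num)
  refine ⟨1 + 1 / (ε * Real.log 2), by have : 0 < 1 / (ε * Real.log 2) := by positivity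
                                       linarith, ?_⟩
  intro v p hp
  have h2 : (2 : ℝ) ≤ p := by exact_mod_cast hp
  have h1 : ((2 : ℝ) ^ v) ^ ε ≤ ((p : ℝ) ^ v) ^ ε := by
    apply Real.rpow_le_rpow (by positivity) _ hε.le
    gcongr
  have h3 : 1 + ε * Real.log 2 * v ≤ ((2 : ℝ) ^ v) ^ ε := by
    rw [← Real.rpow_natCast, ← Real.rpow_mul (by norm_num), Real.rpow_def_of_pos (by norm_num)]
    have := Real.add_one_le_exp (Real.log 2 * (v * ε))
    nlinarith
  have hc : 0 < 1 / (ε * Real.log 2) := by positivity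
  calc (v : ℝ) + 1 ≤ (1 + 1 / (ε * Real.log 2)) * (1 + ε * Real.log 2 * v) := by
        have : (1 / (ε * Real.log 2)) * (ε * Real.log 2 * v) = v := by field_simp
        have h5 : (0 : ℝ) ≤ ε * Real.log 2 * v := by positivity
        nlinarith
    _ ≤ _ := by
        apply mul_le_mul_of_nonneg_left (h3.trans h1) (by positivity)

/-- Divisor bound. -/
lemma divisor_bound (ε : ℝ) (hε : 0 < ε) : ∃ C : ℝ, 1 ≤ C ∧ ∀ n : ℕ, n ≠ 0 →
    (n.divisors.card : ℝ) ≤ C * (n : ℝ) ^ ε := by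
  obtain ⟨C0, hC0, hb⟩ := M0_aux ε hε
  obtain ⟨N, hN⟩ := exists_nat_gt ((2 : ℝ) ^ (1 / ε))
  refine ⟨C0 ^ N, one_le_pow₀ hC0, ?_⟩
  intro n hn
  rw [Nat.card_divisors hn]
  push_cast
  have key : ∀ p ∈ n.primeFactors, ((n.factorization p : ℝ) + 1) ≤
      (if p < N then C0 else 1) * ((p : ℝ) ^ (n.factorization p)) ^ ε := by
    intro p hp
    have hp2 := (Nat.prime_of_mem_primeFactors hp).two_le
    split_ifs with h
    · exact hb _ _ hp2
    · push Not at h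
      have h1 : (2 : ℝ) ^ (1 / ε) ≤ p := hN.le.trans (by exact_mod_cast h)
      have h2 : (2 : ℝ) ≤ (p : ℝ) ^ ε := by
        have := Real.rpow_le_rpow (by positivity) h1 hε.le
        rwa [← Real.rpow_mul (by norm_num), one_div, inv_mul_cancel₀ hε.ne', Real.rpow_one] at this
      rw [one_mul, ← Real.rpow_natCast, ← Real.rpow_mul (by positivity), mul_comm, Real.rpow_mul (by positivity), Real.rpow_natCast]
      calc ((n.factorization p : ℝ) + 1) ≤ 2 ^ (n.factorization p) := by
            exact_mod_cast Nat.succ_le_of_lt (Nat.lt_two_pow_self)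
        _ ≤ _ := by gcongr
  refine (Finset.prod_le_prod (fun _ _ => by positivity) key).trans ?_
  rw [Finset.prod_mul_distrib]
  have h1 : ∏ p ∈ n.primeFactors, ((p : ℝ) ^ (n.factorization p)) ^ ε = (n : ℝ) ^ ε := by
    rw [Real.finsetProd_rpow _ _ (fun _ _ => by positivity)]
    congr 1
    conv_rhs => rw [← Nat.prod_factorization_pow_eq_self hn]
    rw [Finsupp.prod]; push_cast; rfl
  rw [h1]
  gcongr
  calc ∏ p ∈ n.primeFactors, (if p < N then C0 else 1) 
      = C0 ^ (n.primeFactors.filter (· < N)).card := by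
        rw [← Finset.prod_filter, Finset.prod_const]
    _ ≤ C0 ^ N := by
        apply pow_le_pow_right₀ hC0
        calc _ ≤ (Finset.range N).card := Finset.card_le_card (by
                intro p; simp)
          _ = N := by simp

lemma two_pow_omega_le (n : ℕ) (hn : n ≠ 0) : 2 ^ n.primeFactors.card ≤ n.divisors.card := by
  rw [Nat.card_divisors hn, ← Finset.prod_const]
  apply Finset.prod_le_prod' 
  intro p hp
  have := (Nat.prime_of_mem_primeFactors hp).factorization_pos_of_dvd hn (Nat.dvd_of_mem_primeFactors hp)
  omega

/-- `K ^ ω(n) ≪ n ^ ε`. -/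
lemma omega_bound (K : ℕ) (ε : ℝ) (hε : 0 < ε) : ∃ C : ℝ, 1 ≤ C ∧ ∀ n : ℕ, n ≠ 0 →
    ((K : ℝ) ^ n.primeFactors.card) ≤ C * (n : ℝ) ^ ε := by
  obtain ⟨C, hC, h⟩ := divisor_bound (ε / (K + 1)) (by positivity)
  refine ⟨C ^ (K + 1), one_le_pow₀ hC, ?_⟩
  intro n hn
  have h1 : (K : ℝ) ≤ 2 ^ (K + 1) := by
    exact_mod_cast (Nat.lt_two_pow_self (n := K)).le.trans (Nat.pow_le_pow_right (by norm_num) (by omega))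
  have h2 : (2 : ℝ) ^ n.primeFactors.card ≤ n.divisors.card := by exact_mod_cast two_pow_omega_le n hn
  calc (K : ℝ) ^ n.primeFactors.card ≤ (2 ^ (K + 1)) ^ n.primeFactors.card := by gcongr
    _ = (2 ^ n.primeFactors.card) ^ (K + 1) := by rw [← pow_mul, ← pow_mul, mul_comm]
    _ ≤ (C * (n : ℝ) ^ (ε / (K + 1))) ^ (K + 1) := by gcongr; exact h2.trans (h n hn)
    _ = _ := by
      rw [mul_pow]; congr 1
      rw [← Real.rpow_natCast, ← Real.rpow_mul (by positivity)]
      congr 1; push_cast; field_simp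

/-- Colouring lemma. -/
lemma colour_lemma {α : Type*} [DecidableEq α] {ι γ : Type*} [DecidableEq γ] [DecidableEq ι]
    (K : ℕ) (col : ι → α → γ) (P : Finset ι) (S : Finset α)
    (h : ∀ p ∈ P, ∀ S' ⊆ S, (S'.image (col p)).card ≤ K) :
    ∃ S' ⊆ S, (∀ p ∈ P, ∀ s ∈ S', ∀ t ∈ S', col p s = col p t) ∧ S.card ≤ K ^ P.card * S'.card := by
  induction P using Finset.induction_on with
  | empty => exact ⟨S, subset_rfl, by simp, by simp⟩
  | insert p P hp ih =>
    obtain ⟨S1, hS1, hm, hc⟩ := ih (fun q hq => h q (Finset.mem_insert_of_mem hq))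
    by_cases hne : S1 = ∅
    · refine ⟨∅, by simp, by simp, ?_⟩
      subst hne; simpa using hc
    have hne' := Finset.nonempty_iff_ne_empty.mpr hne
    have hK := h p (Finset.mem_insert_self _ _) S1 hS1
    obtain ⟨c, hcI, hcard⟩ : ∃ c ∈ S1.image (col p), S1.card ≤ K * (S1.filter (fun s => col p s = c)).card := by
      by_contra hcon
      push Not at hcon
      have := Finset.card_eq_sum_card_image (col p) S1
      have h2 : ∑ b ∈ S1.image (col p), K * (S1.filter (fun s => col p s = b)).card < ∑ b ∈ S1.image (col p), S1.card :=
        Finset.sum_lt_sum_of_nonempty (hne'.image _) hcon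
      rw [← Finset.mul_sum, ← this, Finset.sum_const, smul_eq_mul] at h2
      have := Nat.mul_le_mul_right S1.card hK
      omega
    refine ⟨S1.filter (fun s => col p s = c), (Finset.filter_subset _ _).trans hS1, ?_, ?_⟩
    · intro q hq s hs t ht
      rw [Finset.mem_filter] at hs ht
      rcases Finset.mem_insert.mp hq with rfl | hq
      · rw [hs.2, ht.2]
      · exact hm q hq s hs.1 t ht.1
    · rw [Finset.card_insert_of_notMem hp, pow_succ]
      calc S.card ≤ K ^ P.card * S1.card := hc
        _ ≤ K ^ P.card * (K * (S1.filter (fun s => col p s = c)).card) := by gcongr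
        _ = _ := by ring

set_option linter.unusedVariables false

/-- Primitive-vector bracket injection. -/
lemma bracket_count (Y1 Y2 : ℤ) (H M : ℝ) (hM : 0 < M) (S : Finset (ℤ × ℤ))
    (hbox : ∀ y ∈ S, Y1 ≤ y.1 ∧ y.1 < 2 * Y1 ∧ Y2 ≤ y.2 ∧ y.2 < 2 * Y2)
    (hcop : ∀ y ∈ S, IsCoprime y.1 y.2)
    (hdiv : ∀ y ∈ S, ∀ z ∈ S, ∃ k : ℤ, ((y.1 * z.2 - z.1 * y.2 : ℤ) : ℝ) = M * k)
    (hH0 : 0 ≤ H) (hH : ∀ y ∈ S, ∀ z ∈ S, |((y.1 * z.2 - z.1 * y.2 : ℤ) : ℝ)| ≤ H) :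
    (S.card : ℝ) ≤ 2 * H / M + 1 := by
  rcases S.eq_empty_or_nonempty with rfl | ⟨y0, hy0⟩
  · simp; positivity
  choose! k hk using hdiv y0 hy0
  have hcard : S.card ≤ (Finset.Icc (-⌊H / M⌋) ⌊H / M⌋).card := by
    apply Finset.card_le_card_of_injOn k
    · intro y hy
      have h1 := hH y0 hy0 y hy
      rw [hk y hy, abs_mul, abs_of_pos hM] at h1
      have h2 : |(k y : ℝ)| ≤ H / M := by rw [le_div_iff₀ hM]; linarith
      rw [abs_le] at h2
      simp only [Finset.coe_Icc, Set.mem_Icc]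
      constructor
      · rw [neg_le]; apply Int.le_floor.mpr; push_cast; linarith
      · apply Int.le_floor.mpr; linarith
    · intro y hy z hz hyz
      have h1 : ((y0.1 * y.2 - y.1 * y0.2 : ℤ) : ℝ) = ((y0.1 * z.2 - z.1 * y0.2 : ℤ) : ℝ) := by
        rw [hk y hy, hk z hz]; rw [hyz]
      have h2 : y0.1 * y.2 - y.1 * y0.2 = y0.1 * z.2 - z.1 * y0.2 := by exact_mod_cast h1
      have h3 : y0.1 * (y.2 - z.2) = y0.2 * (y.1 - z.1) := by linarith
      have hc := hcop y0 hy0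
      have b0 := hbox y0 hy0
      have b1 := hbox y hy
      have b2 := hbox z hz
      have d1 : y0.1 ∣ y.1 - z.1 := hc.dvd_of_dvd_mul_left ⟨y.2 - z.2, by linarith⟩
      have d2 : y0.2 ∣ y.2 - z.2 := hc.symm.dvd_of_dvd_mul_left ⟨y.1 - z.1, by linarith⟩
      have e1 : y.1 - z.1 = 0 := by
        apply Int.eq_zero_of_abs_lt_dvd d1; rw [abs_lt]; constructor <;> linarith
      have e2 : y.2 - z.2 = 0 := by
        apply Int.eq_zero_of_abs_lt_dvd d2; rw [abs_lt]; constructor <;> linarith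
      exact Prod.ext (by linarith) (by linarith)
  have h0 : 0 ≤ ⌊H / M⌋ := Int.floor_nonneg.mpr (by positivity)
  have : (S.card : ℤ) ≤ 2 * ⌊H / M⌋ + 1 := by
    calc (S.card : ℤ) ≤ ((Finset.Icc (-⌊H / M⌋) ⌊H / M⌋).card : ℤ) := by exact_mod_cast hcard
      _ = _ := by rw [Int.card_Icc, Int.toNat_of_nonneg (by omega)]; ring
  have h4 : (S.card : ℝ) ≤ 2 * (⌊H / M⌋ : ℝ) + 1 := by exact_mod_cast this
  have h5 := Int.floor_le (H / M)
  have : 2 * H / M = 2 * (H / M) := by ring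
  linarith

structure Sol (a x y : Fin 3 → ℤ) : Prop where
  xpos : ∀ i, 0 < x i
  ypos : ∀ i, 0 < y i
  eq : a 0 * x 0 ^ 2 * y 0 ^ 3 + a 1 * x 1 ^ 2 * y 1 ^ 3 + a 2 * x 2 ^ 2 * y 2 ^ 3 = 0
  sqf : ∀ i, Squarefree (y i)
  cop : ∀ i j, i ≠ j → IsCoprime (x i * y i) (x j * y j)
  acop : ∀ i j, IsCoprime (a i) (x j * y j)
  ane : ∀ i, a i ≠ 0

/-- p-adic step for the conic. -/
lemma conic_p {p : ℕ} (hp : p.Prime) (hp2 : p ≠ 2) {A B x z x' z' : ℤ}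
    (h1 : (p : ℤ) ^ 3 ∣ A * x ^ 2 + B * z ^ 2) (h2 : (p : ℤ) ^ 3 ∣ A * x' ^ 2 + B * z' ^ 2)
    (hA : ¬ (p : ℤ) ∣ A) (hx : ¬ (p : ℤ) ∣ x) (hz : ¬ (p : ℤ) ∣ z) (hz' : ¬ (p : ℤ) ∣ z')
    (hb : (p : ℤ) ∣ x * z' - x' * z) : (p : ℤ) ^ 3 ∣ A * x * x' + B * z * z' := by
  have hpi : Prime (p : ℤ) := Nat.prime_iff_prime_int.mp hp
  have h3 : (p : ℤ) ^ 3 ∣ A * ((x * z' + x' * z) * (x * z' - x' * z)) := by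
    have : A * ((x * z' + x' * z) * (x * z' - x' * z)) = z' ^ 2 * (A * x ^ 2 + B * z ^ 2) - z ^ 2 * (A * x' ^ 2 + B * z' ^ 2) := by ring
    rw [this]; exact dvd_sub (h1.mul_left _) (h2.mul_left _)
  have hcop : ∀ c : ℤ, ¬ (p : ℤ) ∣ c → IsCoprime ((p : ℤ) ^ 3) c := fun c hc =>
    ((Prime.coprime_iff_not_dvd hpi).mpr hc).pow_left
  have h4 := (hcop A hA).dvd_of_dvd_mul_left h3
  have h5 : ¬ (p : ℤ) ∣ x * z' + x' * z := by
    intro h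
    have : (p : ℤ) ∣ 2 * (x * z') := by
      have := dvd_add h hb
      ring_nf at this ⊢; exact this
    rcases hpi.dvd_or_dvd this with h | h
    · have : (p : ℤ) ∣ ((2 : ℕ) : ℤ) := by exact_mod_cast h
      rw [Int.natCast_dvd_natCast] at this
      exact hp2 ((Nat.prime_dvd_prime_iff_eq hp Nat.prime_two).mp this)
    · rcases hpi.dvd_or_dvd h with h | h
      · exact hx h
      · exact hz' h
  have h6 := (hcop _ h5).dvd_of_dvd_mul_left h4
  have h7 : (p : ℤ) ^ 3 ∣ z * (A * x * x' + B * z * z') := by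
    have : z * (A * x * x' + B * z * z') = z' * (A * x ^ 2 + B * z ^ 2) - A * x * (x * z' - x' * z) := by ring
    rw [this]; exact dvd_sub (h1.mul_left _) (h6.mul_left _)
  exact (hcop z hz).dvd_of_dvd_mul_left h7

set_option maxHeartbeats 1000000 in
/-- Counting points on a conic with large gcd of the polar form. -/
lemma conic_count (c : Fin 3 → ℤ) (i j k : Fin 3) (hl : ∀ l, l = i ∨ l = j ∨ l = k)
    (hi : 0 < c i) (hj : 0 < c j) (hk : c k < 0) (B M : ℝ) (hM : 0 < M) (hB : 0 < B)
    (S : Finset (Fin 3 → ℤ)) (hpos : ∀ x ∈ S, ∀ l, 0 < x l)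
    (heq : ∀ x ∈ S, c i * x i ^ 2 + c j * x j ^ 2 + c k * x k ^ 2 = 0)
    (hbd : ∀ x ∈ S, ((-c k * x k ^ 2 : ℤ) : ℝ) ≤ B)
    (hcop : ∀ x ∈ S, IsCoprime (x i) (x k))
    (hdiv : ∀ x ∈ S, ∀ z ∈ S, ∃ m : ℤ, ((c i * x i * z i + c j * x j * z j + c k * x k * z k : ℤ) : ℝ) = M * m) :
    (S.card : ℝ) ≤ 2 * √(B / M) + 1 := by
  set K := √(B / M) with hK
  have hKpos : 0 < K := Real.sqrt_pos.mpr (by positivity)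
  have hKsq : K ^ 2 = B / M := Real.sq_sqrt (by positivity)
  set α : ℝ := ((c i : ℤ) : ℝ) with hα
  set β : ℝ := ((c j : ℤ) : ℝ) with hβ
  set γ : ℝ := -((c k : ℤ) : ℝ) with hγ
  have hα0 : 0 < α := by rw [hα]; exact_mod_cast hi
  have hβ0 : 0 < β := by rw [hβ]; exact_mod_cast hj
  have hγ0 : 0 < γ := by rw [hγ]; have : (c k : ℝ) < 0 := by exact_mod_cast hk
                         linarith
  let C : (Fin 3 → ℤ) → ℝ := fun x => √(α / γ) * (x i / x k)
  let D : (Fin 3 → ℤ) → ℝ := fun x => √(β / γ) * (x j / x k)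
  have hC0 : ∀ x ∈ S, 0 < C x := fun x hx => by
    have h1 : (0 : ℝ) < x i := by exact_mod_cast hpos x hx i
    have h2 : (0 : ℝ) < x k := by exact_mod_cast hpos x hx k
    positivity
  have hD0 : ∀ x ∈ S, 0 < D x := fun x hx => by
    have h1 : (0 : ℝ) < x j := by exact_mod_cast hpos x hx j
    have h2 : (0 : ℝ) < x k := by exact_mod_cast hpos x hx k
    positivity
  have hCD : ∀ x ∈ S, C x ^ 2 + D x ^ 2 = 1 := fun x hx => by
    have h2 : (0 : ℝ) < x k := by exact_mod_cast hpos x hx k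
    have h := heq x hx
    have h' : α * (x i : ℝ) ^ 2 + β * (x j : ℝ) ^ 2 - γ * (x k : ℝ) ^ 2 = 0 := by
      rw [hα, hβ, hγ]; have : ((c i * x i ^ 2 + c j * x j ^ 2 + c k * x k ^ 2 : ℤ) : ℝ) = 0 := by exact_mod_cast h
      push_cast at this; linarith
    simp only [C, D, mul_pow]
    rw [Real.sq_sqrt (by positivity), Real.sq_sqrt (by positivity)]
    field_simp
    linarith
  have hpol : ∀ x ∈ S, ∀ z ∈ S, ((c i * x i * z i + c j * x j * z j + c k * x k * z k : ℤ) : ℝ) =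
      - (γ * x k * z k) * (1 - (C x * C z + D x * D z)) := fun x hx z hz => by
    have h1 : (0 : ℝ) < x k := by exact_mod_cast hpos x hx k
    have h2 : (0 : ℝ) < z k := by exact_mod_cast hpos z hz k
    have e1 : C x * C z = α / γ * ((x i / x k) * (z i / z k)) := by
      simp only [C]; rw [mul_mul_mul_comm, Real.mul_self_sqrt (by positivity)]
    have e2 : D x * D z = β / γ * ((x j / x k) * (z j / z k)) := by
      simp only [D]; rw [mul_mul_mul_comm, Real.mul_self_sqrt (by positivity)]
    rw [e1, e2]; push_cast
    have e3 : (c k : ℝ) = -γ := by rw [hγ]; ring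
    rw [e3]; field_simp; ring
  let θ : (Fin 3 → ℤ) → ℝ := fun x => Real.arccos (C x)
  have hcos : ∀ x ∈ S, Real.cos (θ x) = C x := fun x hx => by
    apply Real.cos_arccos
    · linarith [hC0 x hx]
    · nlinarith [hCD x hx, hC0 x hx, hD0 x hx]
  have hsin : ∀ x ∈ S, Real.sin (θ x) = D x := fun x hx => by
    simp only [θ]; rw [Real.sin_arccos, show 1 - C x ^ 2 = D x ^ 2 by linarith [hCD x hx]]
    exact Real.sqrt_sq (hD0 x hx).le
  have hθ0 : ∀ x, 0 ≤ θ x := fun x => Real.arccos_nonneg _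
  have hθ1 : ∀ x ∈ S, θ x ≤ 2 := fun x hx => by
    have : θ x ≤ Real.pi / 2 := Real.arccos_le_pi_div_two.mpr (hC0 x hx).le
    linarith [Real.pi_lt_d2]
  have hcard : S.card ≤ (Finset.range (⌊K * 2⌋₊ + 1)).card := by
    apply Finset.card_le_card_of_injOn (fun x => ⌊K * θ x⌋₊)
    · intro x hx
      simp only [Finset.coe_range, Set.mem_Iio, Nat.lt_succ_iff]
      apply Nat.floor_le_floor
      have := hθ1 x hx; gcongr
    · intro x hx z hz hxz
      simp only at hxz
      have hab : |K * θ x - K * θ z| < 1 := by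
        apply Int.abs_sub_lt_one_of_floor_eq_floor
        have h1 := Int.natCast_floor_eq_floor (a := K * θ x) (by have := hθ0 x; positivity)
        have h2 := Int.natCast_floor_eq_floor (a := K * θ z) (by have := hθ0 z; positivity)
        rw [← h1, ← h2, hxz]
      have hab2 : K ^ 2 * (θ x - θ z) ^ 2 < 1 := by
        have := sq_lt_one_iff_abs_lt_one (K * θ x - K * θ z) |>.mpr hab
        calc _ = (K * θ x - K * θ z) ^ 2 := by ring
          _ < 1 := this
      have hcd : C x * C z + D x * D z = Real.cos (θ x - θ z) := by
        rw [Real.cos_sub, hcos x hx, hcos z hz, hsin x hx, hsin z hz]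
      have hcosb := Real.one_sub_sq_div_two_le_cos (x := θ x - θ z)
      obtain ⟨m, hm⟩ := hdiv x hx z hz
      have hp := hpol x hx z hz
      have h1 : (0 : ℝ) < x k := by exact_mod_cast hpos x hx k
      have h2 : (0 : ℝ) < z k := by exact_mod_cast hpos z hz k
      have hgB : γ * x k * z k ≤ B := by
        have b1 := hbd x hx
        have b2 := hbd z hz
        push_cast at b1 b2
        rw [← hγ] at b1 b2
        have : γ * x k * z k ≤ γ * ((x k : ℝ) ^ 2 + (z k : ℝ) ^ 2) / 2 := by
          nlinarith [mul_nonneg hγ0.le (sq_nonneg ((x k : ℝ) - z k))]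
        linarith
      have hm0 : m = 0 := by
        have h3 : |M * (m : ℝ)| < M := by
          rw [← hm, hp, abs_mul, abs_neg, abs_of_pos (by positivity : 0 < γ * x k * z k), hcd,
            abs_of_nonneg (by linarith [Real.cos_le_one (θ x - θ z)])]
          calc γ * x k * z k * (1 - Real.cos (θ x - θ z)) ≤ B * ((θ x - θ z) ^ 2 / 2) := by
                apply mul_le_mul hgB (by linarith) (by linarith [Real.cos_le_one (θ x - θ z)]) hB.le
            _ < M := by
                have : B = K ^ 2 * M := by rw [hKsq]; field_simp
                rw [this]; nlinarith
        rw [abs_mul, abs_of_pos hM] at h3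
        have h4 : |(m : ℝ)| < 1 := by
          by_contra hh; push Not at hh; nlinarith
        have : |m| < 1 := by exact_mod_cast h4
        exact Int.abs_lt_one_iff.mp this
      rw [hm0] at hm
      rw [hm] at hp
      have h5 : C x * C z + D x * D z = 1 := by
        have : γ * x k * z k ≠ 0 := by positivity
        have h6 : (γ * x k * z k) * (1 - (C x * C z + D x * D z)) = 0 := by
          push_cast at hp; linarith
        rcases mul_eq_zero.mp h6 with h | h
        · exact absurd h this
        · linarith
      have h6 : (C x - C z) ^ 2 + (D x - D z) ^ 2 = 0 := by linarith [hCD x hx, hCD z hz]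
      have h7 : C x = C z := by nlinarith [sq_nonneg (C x - C z), sq_nonneg (D x - D z)]
      have h8 : D x = D z := by nlinarith [sq_nonneg (C x - C z), sq_nonneg (D x - D z)]
      have h9 : (x i : ℝ) * z k = z i * x k := by
        have hs : √(α / γ) ≠ 0 := (Real.sqrt_pos.mpr (by positivity)).ne'
        have := mul_left_cancel₀ hs h7
        rwa [div_eq_div_iff h1.ne' h2.ne'] at this
      have h10 : (x j : ℝ) * z k = z j * x k := by
        have hs : √(β / γ) ≠ 0 := (Real.sqrt_pos.mpr (by positivity)).ne'
        have := mul_left_cancel₀ hs h8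
        rwa [div_eq_div_iff h1.ne' h2.ne'] at this
      have h9' : x i * z k = z i * x k := by exact_mod_cast h9
      have h10' : x j * z k = z j * x k := by exact_mod_cast h10
      have d1 : x k ∣ z k := (hcop x hx).symm.dvd_of_dvd_mul_left ⟨z i, by linarith⟩
      have d2 : z k ∣ x k := (hcop z hz).symm.dvd_of_dvd_mul_left ⟨x i, by linarith⟩
      have hk' : x k = z k := Int.dvd_antisymm (hpos x hx k).le (hpos z hz k).le d1 d2
      have hzk := (hpos z hz k).ne'
      rw [hk'] at h9' h10'
      have hi' := mul_right_cancel₀ hzk h9'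
      have hj' := mul_right_cancel₀ hzk h10'
      funext l
      rcases hl l with rfl | rfl | rfl
      · exact hi'
      · exact hj'
      · exact hk'
  rw [Finset.card_range] at hcard
  have : (S.card : ℝ) ≤ (⌊K * 2⌋₊ : ℝ) + 1 := by exact_mod_cast hcard
  have h2 := Nat.floor_le (a := K * 2) (by positivity)
  linarith

set_option linter.unusedVariables false
set_option linter.style.haveILetI false

lemma Sol.ndvd_a {a x y : Fin 3 → ℤ} (h : Sol a x y) {p : ℕ} (hp : p.Prime) {i j : Fin 3}
    (hd : (p : ℤ) ∣ x j * y j) : ¬ (p : ℤ) ∣ a i := fun h' =>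
  (Nat.prime_iff_prime_int.mp hp).not_isUnit ((h.acop i j).isUnit_of_dvd' h' hd)

lemma Sol.ndvd_xy {a x y : Fin 3 → ℤ} (h : Sol a x y) {p : ℕ} (hp : p.Prime) {i j : Fin 3} (hij : i ≠ j)
    (hd : (p : ℤ) ∣ x j * y j) : ¬ (p : ℤ) ∣ x i * y i := fun h' =>
  (Nat.prime_iff_prime_int.mp hp).not_isUnit ((h.cop i j hij).isUnit_of_dvd' h' hd)

/-- Number of colours: square roots. -/
lemma card_image_le_of_pow {α : Type*} [DecidableEq α] {p : ℕ} [Fact p.Prime] (S : Finset α) (f : α → ZMod p)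
    (k : ℕ) (hk : 0 < k)
    (h : ∀ s ∈ S, ∀ t ∈ S, f s ^ k = f t ^ k) : (S.image f).card ≤ k := by
  rcases S.eq_empty_or_nonempty with rfl | ⟨s0, hs0⟩
  · simp
  have hsub : S.image f ⊆ (Polynomial.nthRoots k (f s0 ^ k)).toFinset := by
    intro t ht
    obtain ⟨s, hs, rfl⟩ := Finset.mem_image.mp ht
    rw [Multiset.mem_toFinset, Polynomial.mem_nthRoots hk]
    exact h s hs s0 hs0
  calc _ ≤ _ := Finset.card_le_card hsub
    _ ≤ _ := Multiset.toFinset_card_le _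
    _ ≤ k := Polynomial.card_nthRoots _ _

lemma prod_pow_dvd_of_primes (P : Finset ℕ) (hP : ∀ p ∈ P, p.Prime) (k : ℕ) (N : ℤ)
    (h : ∀ p ∈ P, (p : ℤ) ^ k ∣ N) : ((∏ p ∈ P, p : ℕ) : ℤ) ^ k ∣ N := by
  push_cast
  rw [← Finset.prod_pow]
  apply Finset.prod_dvd_of_coprime _ h
  intro p hp q hq hpq
  apply IsCoprime.pow
  rw [Nat.isCoprime_iff_coprime]
  exact (Nat.coprime_primes (hP p hp) (hP q hq)).mpr hpq

/-- the ratio colour (values in ℕ so that the type does not depend on `p`). -/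
noncomputable def ratio (p : ℕ) (u v : ℤ) : ℕ := ((u : ZMod p) * (v : ZMod p)⁻¹).val

lemma ratio_eq {p : ℕ} (hp : p.Prime) {u v u' v' : ℤ} (hv : ¬ (p : ℤ) ∣ v) (hv' : ¬ (p : ℤ) ∣ v')
    (h : ratio p u v = ratio p u' v') : (p : ℤ) ∣ u * v' - u' * v := by
  have := Fact.mk hp
  have h1 : (u : ZMod p) / v = u' / v' := by
    rw [div_eq_mul_inv, div_eq_mul_inv]; exact ZMod.val_injective p h
  have e1 : (v : ZMod p) ≠ 0 := fun h => hv ((ZMod.intCast_zmod_eq_zero_iff_dvd _ _).mp h)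
  have e2 : (v' : ZMod p) ≠ 0 := fun h => hv' ((ZMod.intCast_zmod_eq_zero_iff_dvd _ _).mp h)
  rw [div_eq_div_iff e1 e2] at h1
  rw [← ZMod.intCast_zmod_eq_zero_iff_dvd]
  push_cast; rw [h1]; ring

lemma ratio_card {α : Type*} [DecidableEq α] {p : ℕ} (hp : p.Prime) (S : Finset α) (u v : α → ℤ)
    (k : ℕ) (hk : 0 < k) (hv : ∀ s ∈ S, ¬ (p : ℤ) ∣ v s)
    (h : ∀ s ∈ S, ∀ t ∈ S, (p : ℤ) ∣ u s ^ k * v t ^ k - u t ^ k * v s ^ k) :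
    (S.image (fun s => ratio p (u s) (v s))).card ≤ k := by
  have := Fact.mk hp
  have e : S.image (fun s => ratio p (u s) (v s)) = (S.image (fun s => (u s : ZMod p) / (v s : ZMod p))).image ZMod.val := by
    rw [Finset.image_image]; simp only [ratio, Function.comp_def, div_eq_mul_inv]
  rw [e]
  refine Finset.card_image_le.trans (card_image_le_of_pow S _ k hk ?_)
  intro s hs t ht
  have e1 : (v s : ZMod p) ≠ 0 := fun h => hv s hs ((ZMod.intCast_zmod_eq_zero_iff_dvd _ _).mp h)
  have e2 : (v t : ZMod p) ≠ 0 := fun h => hv t ht ((ZMod.intCast_zmod_eq_zero_iff_dvd _ _).mp h)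
  rw [div_pow, div_pow, div_eq_div_iff (pow_ne_zero _ e1) (pow_ne_zero _ e2)]
  have := (ZMod.intCast_zmod_eq_zero_iff_dvd _ p).mpr (h s hs t ht)
  push_cast at this
  exact sub_eq_zero.mp this

/-- Case analysis for a prime dividing `y i`. -/
lemma T1_prime {a y : Fin 3 → ℤ} {p : ℕ} (hp : p.Prime) (hp2 : p ≠ 2) (i j k : Fin 3) (hij : j ≠ i) (hik : k ≠ i)
    (S : Finset (Fin 3 → ℤ)) (hS : ∀ x ∈ S, Sol a x y) (hpy : (p : ℤ) ∣ y i)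
    (hsum : ∀ f : Fin 3 → ℤ, f 0 + f 1 + f 2 = f i + f j + f k) :
    (∀ S' ⊆ S, (S'.image (fun x => ratio p (x j) (x k))).card ≤ 2) ∧
    ∀ x ∈ S, ∀ z ∈ S, ratio p (x j) (x k) = ratio p (z j) (z k) → (p : ℤ) ^ 3 ∣
      a 0 * y 0 ^ 3 * x 0 * z 0 + a 1 * y 1 ^ 3 * x 1 * z 1 + a 2 * y 2 ^ 3 * x 2 * z 2 := by
  have hpi : Prime (p : ℤ) := Nat.prime_iff_prime_int.mp hp
  have f0 : ∀ x ∈ S, ∀ l, l ≠ i → ¬ (p : ℤ) ∣ x l * y l := fun x hx l hl =>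
    (hS x hx).ndvd_xy hp hl (hpy.mul_left _)
  have fx : ∀ x ∈ S, ∀ l, l ≠ i → ¬ (p : ℤ) ∣ x l := fun x hx l hl h => f0 x hx l hl (h.mul_right _)
  have fy : ∀ x ∈ S, ∀ l, l ≠ i → ¬ (p : ℤ) ∣ y l := fun x hx l hl h => f0 x hx l hl (h.mul_left _)
  have fa : ∀ x ∈ S, ∀ l, ¬ (p : ℤ) ∣ a l := fun x hx l => (hS x hx).ndvd_a hp (hpy.mul_left (x i))
  have fA : ∀ x ∈ S, ∀ l, l ≠ i → ¬ (p : ℤ) ∣ a l * y l ^ 3 := fun x hx l hl h => by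
    rcases hpi.dvd_or_dvd h with h | h
    · exact fa x hx l h
    · exact fy x hx l hl (hpi.dvd_of_dvd_pow h)
  have fe : ∀ x ∈ S, (p : ℤ) ^ 3 ∣ a j * y j ^ 3 * x j ^ 2 + a k * y k ^ 3 * x k ^ 2 := fun x hx => by
    have h1 := hsum (fun l => a l * x l ^ 2 * y l ^ 3)
    rw [(hS x hx).eq] at h1
    have h2 : (p : ℤ) ^ 3 ∣ y i ^ 3 := pow_dvd_pow_of_dvd hpy 3
    have : a j * y j ^ 3 * x j ^ 2 + a k * y k ^ 3 * x k ^ 2 = - (a i * x i ^ 2 * y i ^ 3) := by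
      linarith
    rw [this, dvd_neg]; exact h2.mul_left _
  constructor
  · intro S' hS'
    apply ratio_card hp S' _ _ 2 (by norm_num) (fun x hx => fx x (hS' hx) k hik)
    intro s hs t ht
    have h1 := fe s (hS' hs)
    have h2 := fe t (hS' ht)
    have h3 : (p : ℤ) ^ 3 ∣ (a j * y j ^ 3) * (s j ^ 2 * t k ^ 2 - t j ^ 2 * s k ^ 2) := by
      have : (a j * y j ^ 3) * (s j ^ 2 * t k ^ 2 - t j ^ 2 * s k ^ 2) =
        t k ^ 2 * (a j * y j ^ 3 * s j ^ 2 + a k * y k ^ 3 * s k ^ 2) - s k ^ 2 * (a j * y j ^ 3 * t j ^ 2 + a k * y k ^ 3 * t k ^ 2) := by ring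
      rw [this]; exact dvd_sub (h1.mul_left _) (h2.mul_left _)
    have h4 : (p : ℤ) ∣ (a j * y j ^ 3) * (s j ^ 2 * t k ^ 2 - t j ^ 2 * s k ^ 2) := (dvd_pow_self _ (by norm_num)).trans h3
    exact (hpi.dvd_or_dvd h4).resolve_left (fA s (hS' hs) j hij)
  · intro x hx z hz hr
    have h1 := ratio_eq hp (fx x hx k hik) (fx z hz k hik) hr
    have h2 := conic_p hp hp2 (fe x hx) (fe z hz) (fA x hx j hij) (fx x hx j hij) (fx x hx k hik) (fx z hz k hik) h1
    have h3 := hsum (fun l => a l * y l ^ 3 * x l * z l)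
    rw [h3]
    have h4 : (p : ℤ) ^ 3 ∣ y i ^ 3 := pow_dvd_pow_of_dvd hpy 3
    have : a i * y i ^ 3 * x i * z i + a j * y j ^ 3 * x j * z j + a k * y k ^ 3 * x k * z k =
      a i * x i * z i * y i ^ 3 + (a j * y j ^ 3 * x j * z j + a k * y k ^ 3 * x k * z k) := by ring
    rw [this]
    exact dvd_add (h4.mul_left _) h2

open Classical in
noncomputable def T1col (y : Fin 3 → ℤ) (p : ℕ) (x : Fin 3 → ℤ) : ℕ :=
  if (p : ℤ) ∣ y 0 then ratio p (x 1) (x 2) else if (p : ℤ) ∣ y 1 then ratio p (x 2) (x 0) else ratio p (x 0) (x 1)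

lemma T1_prime' {a y : Fin 3 → ℤ} {p : ℕ} (hp : p.Prime) (hp2 : p ≠ 2)
    (S : Finset (Fin 3 → ℤ)) (hS : ∀ x ∈ S, Sol a x y) (hpy : (p : ℤ) ∣ y 0 * y 1 * y 2) :
    (∀ S' ⊆ S, (S'.image (T1col y p)).card ≤ 2) ∧
    ∀ x ∈ S, ∀ z ∈ S, T1col y p x = T1col y p z → (p : ℤ) ^ 3 ∣
      a 0 * y 0 ^ 3 * x 0 * z 0 + a 1 * y 1 ^ 3 * x 1 * z 1 + a 2 * y 2 ^ 3 * x 2 * z 2 := by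
  have hpi : Prime (p : ℤ) := Nat.prime_iff_prime_int.mp hp
  by_cases h0 : (p : ℤ) ∣ y 0
  · have : T1col y p = fun x => ratio p (x 1) (x 2) := by funext x; simp [T1col, h0]
    rw [this]
    exact T1_prime hp hp2 0 1 2 (by decide) (by decide) S hS h0 (fun f => by ring)
  by_cases h1 : (p : ℤ) ∣ y 1
  · have : T1col y p = fun x => ratio p (x 2) (x 0) := by funext x; simp [T1col, h0, h1]
    rw [this]
    exact T1_prime hp hp2 1 2 0 (by decide) (by decide) S hS h1 (fun f => by ring)
  have h2 : (p : ℤ) ∣ y 2 := by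
    rcases hpi.dvd_or_dvd hpy with h | h
    · rcases hpi.dvd_or_dvd h with h | h
      · exact absurd h h0
      · exact absurd h h1
    · exact h
  have : T1col y p = fun x => ratio p (x 0) (x 1) := by funext x; simp [T1col, h0, h1]
  rw [this]
  exact T1_prime hp hp2 2 0 1 (by decide) (by decide) S hS h2 (fun f => by ring)

lemma Sol.sqf_prod {a x y : Fin 3 → ℤ} (h : Sol a x y) : Squarefree (y 0 * y 1 * y 2) := by
  have c : ∀ i j, i ≠ j → IsCoprime (y i) (y j) := fun i j hij =>
    ((h.cop i j hij).of_mul_left_right).of_mul_right_right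
  rw [squarefree_mul_iff, squarefree_mul_iff]
  refine ⟨?_, ⟨?_, h.sqf 0, h.sqf 1⟩, h.sqf 2⟩
  · exact (IsCoprime.mul_left (c 0 2 (by decide)) (c 1 2 (by decide))).isRelPrime
  · exact (c 0 1 (by decide)).isRelPrime

/-- T1 for fixed `y`. -/
lemma T1y {a y : Fin 3 → ℤ} (B : ℝ) (hB : 0 < B) (S : Finset (Fin 3 → ℤ)) (hS : ∀ x ∈ S, Sol a x y)
    (hbd : ∀ x ∈ S, ∀ i, ((|a i| * x i ^ 2 * y i ^ 3 : ℤ) : ℝ) ≤ B) :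
    (S.card : ℝ) ≤ 2 ^ (y 0 * y 1 * y 2).natAbs.primeFactors.card *
      (6 * √(B / ((y 0 * y 1 * y 2 : ℤ) : ℝ) ^ 3) + 1) := by
  rcases S.eq_empty_or_nonempty with rfl | ⟨x0, hx0⟩
  · simp; positivity
  have s0 := hS x0 hx0
  set Y := y 0 * y 1 * y 2 with hY
  have hY0 : 0 < Y := mul_pos (mul_pos (s0.ypos 0) (s0.ypos 1)) (s0.ypos 2)
  have hYn : Squarefree Y.natAbs := Int.squarefree_natAbs.mpr s0.sqf_prod
  have hYr : (0 : ℝ) < Y := by exact_mod_cast hY0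
  set P := Y.natAbs.primeFactors.erase 2 with hP
  have hPp : ∀ p ∈ P, p.Prime := fun p hp => Nat.prime_of_mem_primeFactors (Finset.mem_of_mem_erase hp)
  have hPd : ∀ p ∈ P, (p : ℤ) ∣ Y := fun p hp =>
    Int.natCast_dvd.mpr (Nat.dvd_of_mem_primeFactors (Finset.mem_of_mem_erase hp))
  have hP2 : ∀ p ∈ P, p ≠ 2 := fun p hp => Finset.ne_of_mem_erase hp
  obtain ⟨S', hS', hmono, hcard⟩ := colour_lemma 2 (T1col y) P S
    (fun p hp => (T1_prime' (hPp p hp) (hP2 p hp) S hS (hPd p hp)).1)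
  set q : ℕ := ∏ p ∈ P, p with hq
  have hq0 : 0 < q := Finset.prod_pos (fun p hp => (hPp p hp).pos)
  have hYq : Y.natAbs ≤ 2 * q := by
    conv_lhs => rw [← Nat.prod_primeFactors_of_squarefree hYn]
    by_cases h2 : 2 ∈ Y.natAbs.primeFactors
    · rw [← Finset.mul_prod_erase _ _ h2]
    · rw [hq, hP, Finset.erase_eq_of_notMem h2]; omega
  have hYqr : (Y : ℝ) ≤ 2 * q := by
    have : (Y.natAbs : ℤ) ≤ 2 * q := by exact_mod_cast hYq
    rw [Int.natAbs_of_nonneg hY0.le] at this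
    exact_mod_cast this
  have hdv : ∀ x ∈ S', ∀ z ∈ S', (q : ℤ) ^ 3 ∣
      a 0 * y 0 ^ 3 * x 0 * z 0 + a 1 * y 1 ^ 3 * x 1 * z 1 + a 2 * y 2 ^ 3 * x 2 * z 2 := by
    intro x hx z hz
    apply prod_pow_dvd_of_primes P hPp
    intro p hp
    exact (T1_prime' (hPp p hp) (hP2 p hp) S hS (hPd p hp)).2 x (hS' hx) z (hS' hz) (hmono p hp x hx z hz)
  have hMpos : (0 : ℝ) < (q : ℝ) ^ 3 := by positivity
  have main : (S'.card : ℝ) ≤ 2 * √(B / (q : ℝ) ^ 3) + 1 := by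
    -- general sign lemma
    have gen : ∀ (ε : ℤ) (hε : ε = 1 ∨ ε = -1) (i j k : Fin 3) (hl : ∀ l, l = i ∨ l = j ∨ l = k) (hik : i ≠ k)
        (hsum : ∀ f : Fin 3 → ℤ, f i + f j + f k = f 0 + f 1 + f 2), 0 < ε * a i → 0 < ε * a j → ε * a k < 0 →
        (S'.card : ℝ) ≤ 2 * √(B / (q : ℝ) ^ 3) + 1 := by
      intro ε hε i j k hl hik hsum hi hj hk
      have hy3 : ∀ l, 0 < y l ^ 3 := fun l => pow_pos (s0.ypos l) 3
      apply conic_count (fun l => ε * a l * y l ^ 3) i j k hl (mul_pos hi (hy3 i)) (mul_pos hj (hy3 j))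
        (mul_neg_of_neg_of_pos hk (hy3 k)) B _ hMpos hB S' (fun x hx => (hS x (hS' hx)).xpos)
      · intro x hx
        have h1 := hsum (fun l => ε * a l * y l ^ 3 * x l ^ 2)
        rw [h1]
        linear_combination ε * (hS x (hS' hx)).eq
      · intro x hx
        have h1 := hbd x (hS' hx) k
        convert h1 using 2
        have : |a k| = -(ε * a k) := by
          rw [← abs_of_neg hk, abs_mul]
          rcases hε with rfl | rfl <;> simp
        rw [this]; ring
      · intro x hx
        exact (((hS x (hS' hx)).cop i k hik).of_mul_left_left).of_mul_right_left
      · intro x hx z hz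
        obtain ⟨m, hm⟩ := hdv x hx z hz
        refine ⟨ε * m, ?_⟩
        have h1 := hsum (fun l => ε * a l * y l ^ 3 * x l * z l)
        rw [h1]
        have : ε * a 0 * y 0 ^ 3 * x 0 * z 0 + ε * a 1 * y 1 ^ 3 * x 1 * z 1 + ε * a 2 * y 2 ^ 3 * x 2 * z 2
          = (q : ℤ) ^ 3 * (ε * m) := by linear_combination ε * hm
        rw [this]; push_cast; ring
    have A : ∀ l, 0 < x0 l ^ 2 * y l ^ 3 := fun l => mul_pos (pow_pos (s0.xpos l) 2) (pow_pos (s0.ypos l) 3)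
    have e := s0.eq
    have c3 : ∀ i j k : Fin 3, (i,j,k) = (0,1,2) ∨ (i,j,k) = (0,2,1) ∨ (i,j,k) = (1,2,0) → 
        (∀ l, l = i ∨ l = j ∨ l = k) ∧ i ≠ k := by decide
    have A0 := A 0
    have A1 := A 1
    have A2 := A 2
    rcases lt_or_gt_of_ne (s0.ane 0) with h0 | h0 <;> rcases lt_or_gt_of_ne (s0.ane 1) with h1 | h1 <;>
      rcases lt_or_gt_of_ne (s0.ane 2) with h2 | h2
    · nlinarith
    · exact gen (-1) (by simp) 0 1 2 (c3 _ _ _ (by simp)).1 (by decide) (fun f => by ring) (by linarith) (by linarith) (by linarith)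
    · exact gen (-1) (by simp) 0 2 1 (c3 _ _ _ (by simp)).1 (by decide) (fun f => by ring) (by linarith) (by linarith) (by linarith)
    · exact gen 1 (by simp) 1 2 0 (c3 _ _ _ (by simp)).1 (by decide) (fun f => by ring) (by linarith) (by linarith) (by linarith)
    · exact gen (-1) (by simp) 1 2 0 (c3 _ _ _ (by simp)).1 (by decide) (fun f => by ring) (by linarith) (by linarith) (by linarith)
    · exact gen 1 (by simp) 0 2 1 (c3 _ _ _ (by simp)).1 (by decide) (fun f => by ring) (by linarith) (by linarith) (by linarith)
    · exact gen 1 (by simp) 0 1 2 (c3 _ _ _ (by simp)).1 (by decide) (fun f => by ring) (by linarith) (by linarith) (by linarith)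
    · nlinarith
  have hsq : √(B / (q : ℝ) ^ 3) ≤ 3 * √(B / (Y : ℝ) ^ 3) := by
    apply Real.sqrt_le_iff.mpr
    refine ⟨by positivity, ?_⟩
    rw [mul_pow, Real.sq_sqrt (by positivity)]
    rw [div_le_iff₀ hMpos]
    have : (Y : ℝ) ^ 3 ≤ (2 * q) ^ 3 := by gcongr
    rw [mul_pow] at this
    have h3 : B / (Y : ℝ) ^ 3 * (Y : ℝ) ^ 3 = B := by field_simp
    have h4 : 0 ≤ B / (Y : ℝ) ^ 3 := by positivity
    nlinarith [mul_le_mul_of_nonneg_left this h4]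
  have hPc : P.card ≤ Y.natAbs.primeFactors.card := Finset.card_le_card (Finset.erase_subset _ _)
  calc (S.card : ℝ) ≤ 2 ^ P.card * S'.card := by exact_mod_cast hcard
    _ ≤ 2 ^ Y.natAbs.primeFactors.card * (6 * √(B / (Y : ℝ) ^ 3) + 1) := by
      gcongr
      · norm_num
      · linarith

set_option linter.unusedVariables false

abbrev Pt := (Fin 3 → ℤ) × (Fin 3 → ℤ)

structure Box (a X Y : Fin 3 → ℤ) (B : ℝ) (S : Finset Pt) : Prop where
  sol : ∀ P ∈ S, Sol a P.1 P.2
  xlo : ∀ P ∈ S, ∀ i, X i ≤ P.1 i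
  xhi : ∀ P ∈ S, ∀ i, P.1 i < 2 * X i
  ylo : ∀ P ∈ S, ∀ i, Y i ≤ P.2 i
  yhi : ∀ P ∈ S, ∀ i, P.2 i < 2 * Y i
  X1 : ∀ i, 1 ≤ X i
  Y1 : ∀ i, 1 ≤ Y i
  bd : ∀ P ∈ S, ∀ i, ((|a i| * P.1 i ^ 2 * P.2 i ^ 3 : ℤ) : ℝ) ≤ B

lemma Box.mono {a X Y : Fin 3 → ℤ} {B : ℝ} {S S' : Finset Pt} (h : Box a X Y B S) (hs : S' ⊆ S) : Box a X Y B S' :=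
  ⟨fun P hP => h.sol P (hs hP), fun P hP => h.xlo P (hs hP), fun P hP => h.xhi P (hs hP),
   fun P hP => h.ylo P (hs hP), fun P hP => h.yhi P (hs hP), h.X1, h.Y1, fun P hP => h.bd P (hs hP)⟩

lemma fiber_bound {α β : Type*} [DecidableEq α] [DecidableEq β] (S : Finset α) (f : α → β) (T : Finset β) (N : ℝ) (hN : 0 ≤ N)
    (hT : ∀ s ∈ S, f s ∈ T) (h : ∀ b ∈ T, ((S.filter (fun s => f s = b)).card : ℝ) ≤ N) :
    (S.card : ℝ) ≤ N * T.card := by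
  rw [Finset.card_eq_sum_card_fiberwise (f := f) (t := T) (fun s hs => hT s hs)]
  push_cast
  calc _ ≤ ∑ b ∈ T, N := Finset.sum_le_sum h
    _ = _ := by rw [Finset.sum_const, nsmul_eq_mul, mul_comm]

lemma card_Ico_two (Y : ℤ) (hY : 1 ≤ Y) : ((Finset.Ico Y (2 * Y)).card : ℝ) = Y := by
  rw [Int.card_Ico]
  have : ((2 * Y - Y).toNat : ℤ) = Y := by rw [Int.toNat_of_nonneg (by linarith)]; ring
  exact_mod_cast this

lemma Sol.one_le_abs_a {a x y : Fin 3 → ℤ} (h : Sol a x y) (i : Fin 3) : 1 ≤ |a i| := Int.one_le_abs (h.ane i)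

lemma Box.sizeY {a X Y : Fin 3 → ℤ} {B : ℝ} {S : Finset Pt} (h : Box a X Y B S) {P : Pt} (hP : P ∈ S) (i : Fin 3) :
    ((P.2 i : ℤ) : ℝ) ^ 3 ≤ B := by
  refine le_trans ?_ (h.bd P hP i)
  have s := h.sol P hP
  have h1 : 1 ≤ |a i| * P.1 i ^ 2 := by
    have := s.one_le_abs_a i
    have := pow_pos (s.xpos i) 2
    nlinarith
  have h2 := pow_pos (s.ypos i) 3
  exact_mod_cast (le_mul_of_one_le_left h2.le h1)

lemma Box.sizeX {a X Y : Fin 3 → ℤ} {B : ℝ} {S : Finset Pt} (h : Box a X Y B S) {P : Pt} (hP : P ∈ S) (i : Fin 3) :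
    ((P.1 i : ℤ) : ℝ) ^ 2 ≤ B := by
  refine le_trans ?_ (h.bd P hP i)
  have s := h.sol P hP
  have h1 := s.one_le_abs_a i
  have h2 := pow_pos (s.xpos i) 2
  have h3 := pow_pos (s.ypos i) 3
  have : P.1 i ^ 2 ≤ |a i| * P.1 i ^ 2 * P.2 i ^ 3 := by
    have h4 : P.1 i ^ 2 ≤ |a i| * P.1 i ^ 2 := le_mul_of_one_le_left h2.le h1
    have h5 : |a i| * P.1 i ^ 2 ≤ |a i| * P.1 i ^ 2 * P.2 i ^ 3 := le_mul_of_one_le_right (by positivity) h3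
    linarith
  exact_mod_cast this

lemma Box.prodY {a X Y : Fin 3 → ℤ} {B : ℝ} {S : Finset Pt} (h : Box a X Y B S) {P : Pt} (hP : P ∈ S) :
    ((P.2 0 * P.2 1 * P.2 2 : ℤ) : ℝ) ≤ B := by
  have s := h.sol P hP
  have p : ∀ i, (0 : ℝ) < P.2 i := fun i => by exact_mod_cast s.ypos i
  have hB0 : 0 ≤ B := (by have := p 0; positivity : (0:ℝ) ≤ (P.2 0 : ℝ) ^ 3).trans (h.sizeY hP 0)
  have b0 := p 0
  have b1 := p 1
  have b2 := p 2
  have : (((P.2 0 * P.2 1 * P.2 2 : ℤ) : ℝ)) ^ 3 ≤ B ^ 3 := by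
    push_cast
    calc ((P.2 0 : ℝ) * P.2 1 * P.2 2) ^ 3 = (P.2 0 : ℝ) ^ 3 * (P.2 1 : ℝ) ^ 3 * (P.2 2 : ℝ) ^ 3 := by ring
      _ ≤ B * B * B := by
        gcongr
        · exact h.sizeY hP 0
        · exact h.sizeY hP 1
        · exact h.sizeY hP 2
      _ = B ^ 3 := by ring
  exact le_of_pow_le_pow_left₀ (by norm_num) hB0 this

lemma T1 (ε : ℝ) (hε : 0 < ε) : ∃ C : ℝ, 1 ≤ C ∧ ∀ (a X Y : Fin 3 → ℤ) (B : ℝ) (S : Finset Pt), 1 ≤ B → Box a X Y B S →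
    (S.card : ℝ) ≤ C * B ^ ε * ((Y 0 * Y 1 * Y 2 : ℝ) + √B) := by
  obtain ⟨C, hC, hω⟩ := omega_bound 2 ε hε
  refine ⟨6 * C, by linarith, ?_⟩
  intro a X Y B S hB hbox
  have hB0 : (0 : ℝ) < B := by linarith
  have Yp : ∀ i, (0 : ℝ) < Y i := fun i => by have := hbox.Y1 i; exact_mod_cast (by linarith : 0 < Y i)
  have y0 := Yp 0
  have y1 := Yp 1
  have y2 := Yp 2
  set Q : ℝ := Y 0 * Y 1 * Y 2 with hQ
  have hQ0 : 0 < Q := by positivity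
  have hQ1 : 1 ≤ Q := by
    have h : ∀ i, (1 : ℝ) ≤ Y i := fun i => by exact_mod_cast hbox.Y1 i
    have := h 0; have := h 1; have := h 2
    have : 1 ≤ (Y 0 : ℝ) * Y 1 := one_le_mul_of_one_le_of_one_le (h 0) (h 1)
    exact one_le_mul_of_one_le_of_one_le this (h 2)
  have := fiber_bound S (fun P => P.2) (Fintype.piFinset (fun i => Finset.Ico (Y i) (2 * Y i)))
    (C * B ^ ε * (6 * √(B / Q ^ 3) + 1)) (by positivity) ?_ ?_
  · refine this.trans ?_
    rw [Fintype.card_piFinset]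
    push_cast
    rw [Fin.prod_univ_three, card_Ico_two _ (hbox.Y1 0), card_Ico_two _ (hbox.Y1 1), card_Ico_two _ (hbox.Y1 2), ← hQ]
    have h1 : √(B / Q ^ 3) * Q ≤ √B := by
      rw [Real.sqrt_div hB0.le, div_mul_eq_mul_div, div_le_iff₀ (by positivity)]
      gcongr
      apply Real.le_sqrt_of_sq_le
      exact pow_le_pow_right₀ hQ1 (by norm_num)
    have h2 : 0 < C * B ^ ε := by positivity
    have h3 : (6 * √(B / Q ^ 3) + 1) * Q ≤ 6 * (Q + √B) := by nlinarith
    calc C * B ^ ε * (6 * √(B / Q ^ 3) + 1) * Q = C * B ^ ε * ((6 * √(B / Q ^ 3) + 1) * Q) := by ring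
      _ ≤ C * B ^ ε * (6 * (Q + √B)) := by gcongr
      _ = _ := by ring
  · intro P hP
    rw [Fintype.mem_piFinset]
    intro i
    exact Finset.mem_Ico.mpr ⟨hbox.ylo P hP i, hbox.yhi P hP i⟩
  · intro y hy
    rcases (S.filter (fun P => P.2 = y)).eq_empty_or_nonempty with he | ⟨P0, hP0⟩
    · rw [he]; simp; positivity
    have m0 := Finset.mem_filter.mp hP0
    have hc : (S.filter (fun P => P.2 = y)).card = ((S.filter (fun P => P.2 = y)).image Prod.fst).card := by
      rw [Finset.card_image_of_injOn]
      intro P hP P' hP' he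
      have h1 := (Finset.mem_filter.mp hP).2
      have h2 := (Finset.mem_filter.mp hP').2
      exact Prod.ext he (h1.trans h2.symm)
    have hmem : ∀ x ∈ (S.filter (fun P => P.2 = y)).image Prod.fst, (x, y) ∈ S := by
      intro x hx
      obtain ⟨P, hP, rfl⟩ := Finset.mem_image.mp hx
      have h1 := Finset.mem_filter.mp hP
      rw [← h1.2]; exact h1.1
    rw [hc]
    refine (T1y B hB0 _ (fun x hx => hbox.sol _ (hmem x hx)) (fun x hx => hbox.bd _ (hmem x hx))).trans ?_
    have hyS : (P0.1, y) ∈ S := by rw [← m0.2]; exact m0.1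
    have s := hbox.sol _ hyS
    have hY0 : 0 < y 0 * y 1 * y 2 := mul_pos (mul_pos (s.ypos 0) (s.ypos 1)) (s.ypos 2)
    have hn : ((y 0 * y 1 * y 2).natAbs : ℝ) = ((y 0 * y 1 * y 2 : ℤ) : ℝ) := by
      rw [Nat.cast_natAbs, abs_of_pos hY0]
    have hQy : Q ≤ ((y 0 * y 1 * y 2 : ℤ) : ℝ) := by
      have h : ∀ i, (Y i : ℝ) ≤ y i := fun i => by exact_mod_cast hbox.ylo _ hyS i
      have := h 0; have := h 1; have := h 2
      push_cast; rw [hQ]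
      have := (Yp 0).trans_le (h 0)
      have := (Yp 1).trans_le (h 1)
      gcongr
    have hω' := hω (y 0 * y 1 * y 2).natAbs (by omega)
    rw [hn] at hω'
    push_cast at hω'
    gcongr
    · refine hω'.trans ?_
      have := hbox.prodY hyS
      push_cast at this
      have h0 : (0 : ℝ) < y 0 * y 1 * y 2 := by exact_mod_cast hY0
      gcongr

/-- Cube step. -/
lemma cube_p {p : ℕ} (hp : p.Prime) (hp3 : p ≠ 3) {A B x z x' z' : ℤ}
    (h1 : (p : ℤ) ^ 3 ∣ A * x ^ 3 + B * z ^ 3) (h2 : (p : ℤ) ^ 3 ∣ A * x' ^ 3 + B * z' ^ 3)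
    (hA : ¬ (p : ℤ) ∣ A) (hx : ¬ (p : ℤ) ∣ x) (hz' : ¬ (p : ℤ) ∣ z')
    (hb : (p : ℤ) ∣ x * z' - x' * z) : (p : ℤ) ^ 3 ∣ x * z' - x' * z := by
  have hpi : Prime (p : ℤ) := Nat.prime_iff_prime_int.mp hp
  have hcop : ∀ c : ℤ, ¬ (p : ℤ) ∣ c → IsCoprime ((p : ℤ) ^ 3) c := fun c hc =>
    ((Prime.coprime_iff_not_dvd hpi).mpr hc).pow_left
  have h3 : (p : ℤ) ^ 3 ∣ A * (((x * z') ^ 2 + (x * z') * (x' * z) + (x' * z) ^ 2) * (x * z' - x' * z)) := by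
    have : A * (((x * z') ^ 2 + (x * z') * (x' * z) + (x' * z) ^ 2) * (x * z' - x' * z)) =
       z' ^ 3 * (A * x ^ 3 + B * z ^ 3) - z ^ 3 * (A * x' ^ 3 + B * z' ^ 3) := by ring
    rw [this]; exact dvd_sub (h1.mul_left _) (h2.mul_left _)
  have h4 := (hcop A hA).dvd_of_dvd_mul_left h3
  have h5 : ¬ (p : ℤ) ∣ (x * z') ^ 2 + (x * z') * (x' * z) + (x' * z) ^ 2 := by
    intro h
    have : (p : ℤ) ∣ 3 * (x * z') ^ 2 := by
      have : 3 * (x * z') ^ 2 = ((x * z') ^ 2 + (x * z') * (x' * z) + (x' * z) ^ 2) + (x * z' - x' * z) * (2 * (x * z') + x' * z) := by ring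
      rw [this]; exact dvd_add h (hb.mul_right _)
    rcases hpi.dvd_or_dvd this with h | h
    · have : (p : ℤ) ∣ ((3 : ℕ) : ℤ) := by exact_mod_cast h
      rw [Int.natCast_dvd_natCast] at this
      exact hp3 ((Nat.prime_dvd_prime_iff_eq hp Nat.prime_three).mp this)
    · rcases hpi.dvd_or_dvd (hpi.dvd_of_dvd_pow h) with h | h
      · exact hx h
      · exact hz' h
  exact (hcop _ h5).dvd_of_dvd_mul_left h4

/-- the part of `y` prime to 6, for squarefree `y` -/
def q6P (y : ℤ) : Finset ℕ := (y.natAbs.primeFactors.erase 2).erase 3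
def q6 (y : ℤ) : ℕ := ∏ p ∈ q6P y, p

lemma q6P_prime {y : ℤ} {p : ℕ} (hp : p ∈ q6P y) : p.Prime :=
  Nat.prime_of_mem_primeFactors (Finset.mem_of_mem_erase (Finset.mem_of_mem_erase hp))
lemma q6P_dvd {y : ℤ} {p : ℕ} (hp : p ∈ q6P y) : (p : ℤ) ∣ y :=
  Int.natCast_dvd.mpr (Nat.dvd_of_mem_primeFactors (Finset.mem_of_mem_erase (Finset.mem_of_mem_erase hp)))
lemma q6P_ne3 {y : ℤ} {p : ℕ} (hp : p ∈ q6P y) : p ≠ 3 := Finset.ne_of_mem_erase hp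
lemma q6P_ne2 {y : ℤ} {p : ℕ} (hp : p ∈ q6P y) : p ≠ 2 := Finset.ne_of_mem_erase (Finset.mem_of_mem_erase hp)
lemma q6_pos (y : ℤ) : 0 < q6 y := Finset.prod_pos (fun p hp => (q6P_prime hp).pos)
lemma q6P_card (y : ℤ) : (q6P y).card ≤ y.natAbs.primeFactors.card :=
  Finset.card_le_card ((Finset.erase_subset _ _).trans (Finset.erase_subset _ _))
lemma q6_le {y : ℤ} (hy : Squarefree y) : y.natAbs ≤ 6 * q6 y := by
  have hYn : Squarefree y.natAbs := Int.squarefree_natAbs.mpr hy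
  conv_lhs => rw [← Nat.prod_primeFactors_of_squarefree hYn]
  have step : ∀ (P : Finset ℕ) (r : ℕ), 1 ≤ r → ∏ p ∈ P, p ≤ r * ∏ p ∈ P.erase r, p := by
    intro P r hr
    by_cases h2 : r ∈ P
    · rw [← Finset.mul_prod_erase _ _ h2]
    · rw [Finset.erase_eq_of_notMem h2]; exact Nat.le_mul_of_pos_left _ hr
  calc _ ≤ 2 * ∏ p ∈ y.natAbs.primeFactors.erase 2, p := step _ 2 (by norm_num)
    _ ≤ 2 * (3 * q6 y) := by gcongr; exact step _ 3 (by norm_num)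
    _ = _ := by ring
lemma q6_dvd (y : ℤ) : (q6 y : ℤ) ∣ y := by
  have := prod_pow_dvd_of_primes (q6P y) (fun p hp => q6P_prime hp) 1 y (fun p hp => by
    rw [pow_one]; exact q6P_dvd hp)
  rwa [pow_one] at this

/-- For two points on the same `x1,x2,y0`-fibre. -/
lemma Sol.fe0 {a x y : Fin 3 → ℤ} (s : Sol a x y) {p : ℤ} (hp : p ∣ y 0) :
    p ^ 3 ∣ a 1 * x 1 ^ 2 * y 1 ^ 3 + a 2 * x 2 ^ 2 * y 2 ^ 3 := by
  have h2 : p ^ 3 ∣ y 0 ^ 3 := pow_dvd_pow_of_dvd hp 3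
  have : a 1 * x 1 ^ 2 * y 1 ^ 3 + a 2 * x 2 ^ 2 * y 2 ^ 3 = - (a 0 * x 0 ^ 2 * y 0 ^ 3) := by
    linarith [s.eq]
  rw [this, dvd_neg]; exact h2.mul_left _

lemma Sol.unit0 {a x y : Fin 3 → ℤ} (s : Sol a x y) {p : ℕ} (hp : p.Prime) (hd : (p : ℤ) ∣ y 0) (i : Fin 3) (hi : i ≠ 0) :
    ¬ (p : ℤ) ∣ x i ∧ ¬ (p : ℤ) ∣ y i ∧ ¬ (p : ℤ) ∣ a i := by
  have h := s.ndvd_xy hp hi (hd.mul_left (x 0))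
  exact ⟨fun h' => h (h'.mul_right _), fun h' => h (h'.mul_left _), s.ndvd_a hp (hd.mul_left (x 0))⟩

/-- x0 is determined. -/
lemma Sol.x0_unique {a x y x' y' : Fin 3 → ℤ} (s : Sol a x y) (s' : Sol a x' y') (h0 : y 0 = y' 0)
    (h1 : x 1 = x' 1) (h2 : x 2 = x' 2) (h3 : y 1 = y' 1) (h4 : y 2 = y' 2) : x = x' ∧ y = y' := by
  have e := s.eq
  have e' := s'.eq
  rw [← h0, ← h1, ← h2, ← h3, ← h4] at e'
  have : a 0 * y 0 ^ 3 * (x 0 ^ 2 - x' 0 ^ 2) = 0 := by linear_combination e - e'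
  have hne : a 0 * y 0 ^ 3 ≠ 0 := mul_ne_zero (s.ane 0) (pow_pos (s.ypos 0) 3).ne'
  have h5 := (mul_eq_zero.mp this).resolve_left hne
  have h6 : x 0 = x' 0 := by
    have := s.xpos 0; have := s'.xpos 0
    nlinarith
  constructor
  · funext i; fin_cases i
    · exact h6
    · exact h1
    · exact h2
  · funext i; fin_cases i
    · exact h0
    · exact h3
    · exact h4

lemma cube_mono {a X Y : Fin 3 → ℤ} {B : ℝ} {S : Finset Pt} (hbox : Box a X Y B S) (x1 x2 y0 : ℤ)
    (hf : ∀ P ∈ S, P.1 1 = x1 ∧ P.1 2 = x2 ∧ P.2 0 = y0) :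
    ∃ S' ⊆ S, (∀ P ∈ S', ∀ R ∈ S', (q6 y0 : ℤ) ^ 3 ∣ P.2 1 * R.2 2 - R.2 1 * P.2 2) ∧
      S.card ≤ 3 ^ (q6P y0).card * S'.card := by
  have step : ∀ p ∈ q6P y0, ∀ P ∈ S, (p : ℤ) ^ 3 ∣ (a 1 * x1 ^ 2) * P.2 1 ^ 3 + (a 2 * x2 ^ 2) * P.2 2 ^ 3 := by
    intro p hp P hP
    have := hf P hP
    have h := (hbox.sol P hP).fe0 (p := p) (by rw [this.2.2]; exact q6P_dvd hp)
    rwa [this.1, this.2.1] at h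
  have un : ∀ p ∈ q6P y0, ∀ P ∈ S, ∀ i : Fin 3, i ≠ 0 → ¬ (p : ℤ) ∣ P.1 i ∧ ¬ (p : ℤ) ∣ P.2 i ∧ ¬ (p : ℤ) ∣ a i := by
    intro p hp P hP i hi
    exact (hbox.sol P hP).unit0 (q6P_prime hp) (by rw [(hf P hP).2.2]; exact q6P_dvd hp) i hi
  have hA : ∀ p ∈ q6P y0, ∀ P ∈ S, ¬ (p : ℤ) ∣ a 1 * x1 ^ 2 := by
    intro p hp P hP h
    have hpi : Prime (p : ℤ) := Nat.prime_iff_prime_int.mp (q6P_prime hp)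
    have u := un p hp P hP 1 (by decide)
    rcases hpi.dvd_or_dvd h with h | h
    · exact u.2.2 h
    · rw [← (hf P hP).1] at h
      exact u.1 (hpi.dvd_of_dvd_pow h)
  obtain ⟨S', hS', hm, hc⟩ := colour_lemma 3 (fun p (P : Pt) => ratio p (P.2 1) (P.2 2)) (q6P y0) S (by
    intro p hp S' hS'
    have hpi : Prime (p : ℤ) := Nat.prime_iff_prime_int.mp (q6P_prime hp)
    apply ratio_card (q6P_prime hp) S' _ _ 3 (by norm_num) (fun P hP => (un p hp P (hS' hP) 2 (by decide)).2.1)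
    intro P hP R hR
    have h1 := step p hp P (hS' hP)
    have h2 := step p hp R (hS' hR)
    have h3 : (p : ℤ) ∣ (a 1 * x1 ^ 2) * (P.2 1 ^ 3 * R.2 2 ^ 3 - R.2 1 ^ 3 * P.2 2 ^ 3) := by
      refine (dvd_pow_self (p : ℤ) (n := 3) (by norm_num)).trans ?_
      have : (a 1 * x1 ^ 2) * (P.2 1 ^ 3 * R.2 2 ^ 3 - R.2 1 ^ 3 * P.2 2 ^ 3) =
        R.2 2 ^ 3 * ((a 1 * x1 ^ 2) * P.2 1 ^ 3 + (a 2 * x2 ^ 2) * P.2 2 ^ 3) - P.2 2 ^ 3 * ((a 1 * x1 ^ 2) * R.2 1 ^ 3 + (a 2 * x2 ^ 2) * R.2 2 ^ 3) := by ring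
      rw [this]; exact dvd_sub (h1.mul_left _) (h2.mul_left _)
    exact (hpi.dvd_or_dvd h3).resolve_left (hA p hp P (hS' hP)))
  refine ⟨S', hS', ?_, hc⟩
  intro P hP R hR
  apply prod_pow_dvd_of_primes _ (fun p hp => q6P_prime hp)
  intro p hp
  exact cube_p (q6P_prime hp) (q6P_ne3 hp) (step p hp P (hS' hP)) (step p hp R (hS' hR)) (hA p hp P (hS' hP))
    (un p hp P (hS' hP) 1 (by decide)).2.1 (un p hp R (hS' hR) 2 (by decide)).2.1
    (ratio_eq (q6P_prime hp) (un p hp P (hS' hP) 2 (by decide)).2.1 (un p hp R (hS' hR) 2 (by decide)).2.1 (hm p hp P hP R hR))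

lemma Box.omega {a X Y : Fin 3 → ℤ} {B : ℝ} {S : Finset Pt} (h : Box a X Y B S) {P : Pt} (hP : P ∈ S) (i : Fin 3)
    (hB : 1 ≤ B) : ((P.2 i).natAbs : ℝ) ≤ B := by
  have h1 := h.sizeY hP i
  have h2 : (1 : ℝ) ≤ P.2 i := by exact_mod_cast (h.sol P hP).ypos i
  rw [Nat.cast_natAbs, abs_of_pos ((h.sol P hP).ypos i)]
  exact (le_self_pow₀ h2 (by norm_num)).trans h1

lemma bracket_abs {Y1 Y2 a b c d : ℤ} (h1 : Y1 ≤ a) (h2 : a < 2 * Y1) (h3 : Y2 ≤ b) (h4 : b < 2 * Y2)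
    (h5 : Y1 ≤ c) (h6 : c < 2 * Y1) (h7 : Y2 ≤ d) (h8 : d < 2 * Y2) (hY1 : 1 ≤ Y1) (hY2 : 1 ≤ Y2) :
    |a * d - c * b| ≤ 3 * (Y1 * Y2) := by
  have e1 : Y1 * Y2 ≤ a * d := by nlinarith
  have e2 : a * d ≤ 4 * (Y1 * Y2) := by nlinarith
  have e3 : Y1 * Y2 ≤ c * b := by nlinarith
  have e4 : c * b ≤ 4 * (Y1 * Y2) := by nlinarith
  rw [abs_le]; constructor <;> linarith

lemma T3 (ε : ℝ) (hε : 0 < ε) : ∃ C : ℝ, 1 ≤ C ∧ ∀ (a X Y : Fin 3 → ℤ) (B : ℝ) (S : Finset Pt), 1 ≤ B → Box a X Y B S →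
    (S.card : ℝ) ≤ C * B ^ ε * (X 1 * X 2 * Y 0 * (1 + Y 1 * Y 2 / (Y 0 : ℝ) ^ 3)) := by
  obtain ⟨C, hC, hω⟩ := omega_bound 3 ε hε
  refine ⟨1296 * C, by linarith, ?_⟩
  intro a X Y B S hB hbox
  have hB0 : (0 : ℝ) < B := by linarith
  have Yp : ∀ i, (0 : ℝ) < Y i := fun i => by have := hbox.Y1 i; exact_mod_cast (by linarith : 0 < Y i)
  have Xp : ∀ i, (0 : ℝ) < X i := fun i => by have := hbox.X1 i; exact_mod_cast (by linarith : 0 < X i)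
  have y0' := Yp 0
  have y1' := Yp 1
  have y2' := Yp 2
  have x1' := Xp 1
  have x2' := Xp 2
  have := fiber_bound S (fun P => (P.1 1, P.1 2, P.2 0)) 
    (Finset.Ico (X 1) (2 * X 1) ×ˢ Finset.Ico (X 2) (2 * X 2) ×ˢ Finset.Ico (Y 0) (2 * Y 0))
    (C * B ^ ε * (1296 * (1 + Y 1 * Y 2 / (Y 0 : ℝ) ^ 3))) (by positivity) ?_ ?_
  · refine this.trans (le_of_eq ?_)
    rw [Finset.card_product, Finset.card_product]
    push_cast
    rw [card_Ico_two _ (hbox.X1 1), card_Ico_two _ (hbox.X1 2), card_Ico_two _ (hbox.Y1 0)]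
    ring
  · intro P hP
    simp only [Finset.mem_product, Finset.mem_Ico]
    exact ⟨⟨hbox.xlo P hP 1, hbox.xhi P hP 1⟩, ⟨hbox.xlo P hP 2, hbox.xhi P hP 2⟩, ⟨hbox.ylo P hP 0, hbox.yhi P hP 0⟩⟩
  · rintro ⟨x1, x2, y0⟩ hb
    set F := S.filter (fun P => (P.1 1, P.1 2, P.2 0) = (x1, x2, y0)) with hF
    rcases F.eq_empty_or_nonempty with he | ⟨P0, hP0⟩
    · rw [he]; simp; positivity
    have hFb : Box a X Y B F := hbox.mono (Finset.filter_subset _ _)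
    have hf : ∀ P ∈ F, P.1 1 = x1 ∧ P.1 2 = x2 ∧ P.2 0 = y0 := fun P hP => by
      have := (Finset.mem_filter.mp hP).2
      simpa using this
    obtain ⟨S', hS', hd, hc⟩ := cube_mono hFb x1 x2 y0 hf
    have hS'b := hFb.mono hS'
    have hq0 := q6_pos y0
    have hqr : (0 : ℝ) < (q6 y0 : ℝ) := by exact_mod_cast hq0
    have hy0 : (Y 0 : ℝ) ≤ 6 * q6 y0 := by
      have h1 := q6_le (by rw [← (hf P0 hP0).2.2]; exact (hFb.sol P0 hP0).sqf 0 : Squarefree y0)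
      have h2 := hFb.ylo P0 hP0 0
      have h3 := (hFb.sol P0 hP0).ypos 0
      rw [(hf P0 hP0).2.2] at h2 h3
      have : Y 0 ≤ 6 * (q6 y0 : ℤ) := by omega
      exact_mod_cast this
    have hcard : (S'.card : ℝ) ≤ 2 * (3 * (Y 1 * Y 2)) / (q6 y0 : ℝ) ^ 3 + 1 := by
      have e : S'.card = (S'.image (fun P => (P.2 1, P.2 2))).card := by
        rw [Finset.card_image_of_injOn]
        intro P hP R hR h
        simp only [Prod.mk.injEq] at h
        have hP' := hf P (hS' hP)
        have hR' := hf R (hS' hR)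
        have := (hS'b.sol P hP).x0_unique (hS'b.sol R hR) (by rw [hP'.2.2, hR'.2.2]) (by rw [hP'.1, hR'.1])
          (by rw [hP'.2.1, hR'.2.1]) h.1 h.2
        exact Prod.ext this.1 this.2
      rw [e]
      apply bracket_count (Y 1) (Y 2) _ _ (by positivity)
      · intro y hy
        obtain ⟨P, hP, rfl⟩ := Finset.mem_image.mp hy
        exact ⟨hS'b.ylo P hP 1, hS'b.yhi P hP 1, hS'b.ylo P hP 2, hS'b.yhi P hP 2⟩
      · intro y hy
        obtain ⟨P, hP, rfl⟩ := Finset.mem_image.mp hy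
        exact (((hS'b.sol P hP).cop 1 2 (by decide)).of_mul_left_right).of_mul_right_right
      · intro y hy z hz
        obtain ⟨P, hP, rfl⟩ := Finset.mem_image.mp hy
        obtain ⟨R, hR, rfl⟩ := Finset.mem_image.mp hz
        obtain ⟨k, hk⟩ := hd P hP R hR
        refine ⟨k, ?_⟩
        rw [hk]; push_cast; ring
      · positivity
      · intro y hy z hz
        obtain ⟨P, hP, rfl⟩ := Finset.mem_image.mp hy
        obtain ⟨R, hR, rfl⟩ := Finset.mem_image.mp hz
        have := bracket_abs (hS'b.ylo P hP 1) (hS'b.yhi P hP 1) (hS'b.ylo P hP 2) (hS'b.yhi P hP 2)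
          (hS'b.ylo R hR 1) (hS'b.yhi R hR 1) (hS'b.ylo R hR 2) (hS'b.yhi R hR 2) (hbox.Y1 1) (hbox.Y1 2)
        rw [← Int.cast_abs]
        exact_mod_cast this
    have hω' := hω y0.natAbs (by
      have h3 := (hFb.sol P0 hP0).ypos 0
      rw [(hf P0 hP0).2.2] at h3
      omega)
    have hom := hFb.omega hP0 0 hB
    rw [(hf P0 hP0).2.2] at hom
    have h3 : (3 : ℝ) ^ (q6P y0).card ≤ C * B ^ ε := by
      calc (3 : ℝ) ^ (q6P y0).card ≤ 3 ^ y0.natAbs.primeFactors.card := by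
            apply pow_le_pow_right₀ (by norm_num) (q6P_card y0)
        _ ≤ C * (y0.natAbs : ℝ) ^ ε := by exact_mod_cast hω'
        _ ≤ _ := by gcongr
    calc (F.card : ℝ) ≤ 3 ^ (q6P y0).card * S'.card := by exact_mod_cast hc
      _ ≤ C * B ^ ε * (1296 * (1 + Y 1 * Y 2 / (Y 0 : ℝ) ^ 3)) := by
        gcongr
        refine hcard.trans ?_
        have h5 : 2 * (3 * ((Y 1 : ℝ) * Y 2)) / (q6 y0 : ℝ) ^ 3 ≤ 1296 * (Y 1 * Y 2 / (Y 0 : ℝ) ^ 3) := by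
          rw [← mul_div_assoc, div_le_div_iff₀ (by positivity) (by positivity)]
          have : (Y 0 : ℝ) ^ 3 ≤ (6 * q6 y0) ^ 3 := by gcongr
          calc 2 * (3 * ((Y 1 : ℝ) * Y 2)) * (Y 0 : ℝ) ^ 3 ≤ 2 * (3 * ((Y 1 : ℝ) * Y 2)) * (6 * q6 y0) ^ 3 := by gcongr
            _ = _ := by ring
        linarith

set_option linter.unusedVariables false

section charsum
variable {F : Type*} [Field F] [Fintype F] [DecidableEq F]

lemma chi_pair_ne (hF : ringChar F ≠ 2) (w : F) (hw : w ≠ 0) :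
    ∑ t : F, quadraticChar F t * quadraticChar F (t + w) = -1 := by
  have h1 : ∀ t : F, quadraticChar F t * quadraticChar F (t + w) =
      quadraticChar F (1 + w * t⁻¹) - (if t = 0 then 1 else 0) := by
    intro t
    by_cases ht : t = 0
    · subst ht; simp
    · rw [if_neg ht, sub_zero]
      have : t + w = t * (1 + w * t⁻¹) := by field_simp
      rw [this, map_mul, ← mul_assoc, ← pow_two, quadraticChar_sq_one ht, one_mul]
  rw [Finset.sum_congr rfl (fun t _ => h1 t), Finset.sum_sub_distrib]
  have h2 : ∑ t : F, quadraticChar F (1 + w * t⁻¹) = 0 := by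
    have e : Function.Bijective (fun t : F => 1 + w * t⁻¹) := by
      constructor
      · intro s t h
        simp only [add_right_inj] at h
        exact inv_injective (mul_left_cancel₀ hw h)
      · intro s
        refine ⟨((s - 1) / w)⁻¹, ?_⟩
        simp only [inv_inv]; field_simp; ring
    rw [e.sum_comp (fun t => quadraticChar F t)]
    exact quadraticChar_sum_zero hF
  rw [h2]; simp

lemma chi_pair_le (hF : ringChar F ≠ 2) (u v : F) :
    ∑ b : F, quadraticChar F (u + b) * quadraticChar F (v + b) ≤ if u = v then (Fintype.card F : ℤ) else 0 := by
  split_ifs with h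
  · subst h
    calc _ ≤ ∑ b : F, (1 : ℤ) := by
          apply Finset.sum_le_sum
          intro b _
          rw [← pow_two]
          by_cases hb : u + b = 0
          · rw [hb]; simp
          · rw [quadraticChar_sq_one hb]
      _ = _ := by simp
  · have : ∑ b : F, quadraticChar F (u + b) * quadraticChar F (v + b) = -1 := by
      rw [← chi_pair_ne hF (v - u) (sub_ne_zero.mpr (Ne.symm h))]
      rw [← Equiv.sum_comp (Equiv.addLeft u) (fun t => quadraticChar F t * quadraticChar F (t + (v - u)))]
      apply Finset.sum_congr rfl
      intro b _
      simp only [Equiv.coe_addLeft]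
      congr 2; ring
    rw [this]; norm_num

lemma cube_roots_card (c : F) : (Finset.univ.filter (fun z : F => z ^ 3 = c)).card ≤ 3 := by
  have hsub : Finset.univ.filter (fun z : F => z ^ 3 = c) ⊆ (Polynomial.nthRoots 3 c).toFinset := by
    intro t ht
    rw [Multiset.mem_toFinset, Polynomial.mem_nthRoots (by norm_num)]
    exact (Finset.mem_filter.mp ht).2
  calc _ ≤ _ := Finset.card_le_card hsub
    _ ≤ _ := Multiset.toFinset_card_le _
    _ ≤ 3 := Polynomial.card_nthRoots _ _

def Tsum (A b : F) : ℤ := ∑ z : F, quadraticChar F (A * z ^ 3 + b)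

lemma Tsum_sq_sum (hF : ringChar F ≠ 2) (A : F) (hA : A ≠ 0) :
    ∑ b : F, (Tsum A b) ^ 2 ≤ 3 * (Fintype.card F : ℤ) ^ 2 := by
  have h1 : ∀ b : F, (Tsum A b) ^ 2 = ∑ z : F, ∑ w : F, quadraticChar F (A * z ^ 3 + b) * quadraticChar F (A * w ^ 3 + b) := by
    intro b; rw [pow_two, Tsum, Finset.sum_mul_sum]
  rw [Finset.sum_congr rfl (fun b _ => h1 b), Finset.sum_comm]
  calc ∑ z : F, ∑ b : F, ∑ w : F, quadraticChar F (A * z ^ 3 + b) * quadraticChar F (A * w ^ 3 + b)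
      ≤ ∑ z : F, 3 * (Fintype.card F : ℤ) := by
        apply Finset.sum_le_sum
        intro z _
        rw [Finset.sum_comm]
        calc _ ≤ ∑ w : F, if A * z ^ 3 = A * w ^ 3 then (Fintype.card F : ℤ) else 0 :=
              Finset.sum_le_sum (fun w _ => chi_pair_le hF _ _)
          _ = ((Finset.univ.filter (fun w : F => A * z ^ 3 = A * w ^ 3)).card : ℤ) * Fintype.card F := by
              rw [← Finset.sum_filter, Finset.sum_const, nsmul_eq_mul]
          _ ≤ 3 * (Fintype.card F : ℤ) := by
              gcongr
              have := cube_roots_card (z ^ 3)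
              refine le_trans ?_ (by exact_mod_cast this : ((Finset.univ.filter (fun w : F => w ^ 3 = z ^ 3)).card : ℤ) ≤ 3)
              norm_cast
              apply Finset.card_le_card
              intro w hw
              simp only [Finset.mem_filter, Finset.mem_univ, true_and] at hw ⊢
              exact (mul_left_cancel₀ hA hw).symm
    _ = _ := by rw [Finset.sum_const, Finset.card_univ, nsmul_eq_mul]; ring

lemma Tsum_scale (A b c : F) (hc : c ≠ 0) : (Tsum A (b * c ^ 3)) ^ 2 = (Tsum A b) ^ 2 := by
  have : Tsum A (b * c ^ 3) = quadraticChar F (c ^ 3) * Tsum A b := by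
    rw [Tsum, Tsum, Finset.mul_sum]
    rw [← Equiv.sum_comp (Equiv.mulLeft₀ c hc) (fun z => quadraticChar F (A * z ^ 3 + b * c ^ 3))]
    apply Finset.sum_congr rfl
    intro z _
    rw [← map_mul]; congr 1
    show A * (c * z) ^ 3 + b * c ^ 3 = _; ring
  rw [this, mul_pow, quadraticChar_sq_one (pow_ne_zero _ hc), one_mul]

lemma Tsum_bound (hF : ringChar F ≠ 2) (A b : F) (hA : A ≠ 0) (hb : b ≠ 0) :
    ((Fintype.card F : ℤ) - 1) * (Tsum A b) ^ 2 ≤ 9 * (Fintype.card F : ℤ) ^ 2 := by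
  have h1 : ∑ c ∈ Finset.univ.erase (0 : F), (Tsum A (b * c ^ 3)) ^ 2 = ((Fintype.card F : ℤ) - 1) * (Tsum A b) ^ 2 := by
    rw [Finset.sum_congr rfl (fun c hc => Tsum_scale A b c (Finset.ne_of_mem_erase hc)), Finset.sum_const,
      Finset.card_erase_of_mem (Finset.mem_univ _), Finset.card_univ, nsmul_eq_mul, Nat.cast_pred Fintype.card_pos]
  rw [← h1]
  calc ∑ c ∈ Finset.univ.erase (0 : F), (Tsum A (b * c ^ 3)) ^ 2 ≤ ∑ c : F, (Tsum A (b * c ^ 3)) ^ 2 :=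
        Finset.sum_le_sum_of_subset_of_nonneg (Finset.subset_univ _) (fun _ _ _ => by positivity)
    _ = ∑ d : F, ∑ c ∈ Finset.univ.filter (fun c : F => b * c ^ 3 = d), (Tsum A (b * c ^ 3)) ^ 2 :=
        (Finset.sum_fiberwise _ _ _).symm
    _ = ∑ d : F, ((Finset.univ.filter (fun c : F => b * c ^ 3 = d)).card : ℤ) * (Tsum A d) ^ 2 := by
        apply Finset.sum_congr rfl
        intro d _
        rw [Finset.sum_congr rfl (fun c hc => by rw [(Finset.mem_filter.mp hc).2]), Finset.sum_const, nsmul_eq_mul]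
    _ ≤ ∑ d : F, 3 * (Tsum A d) ^ 2 := by
        apply Finset.sum_le_sum
        intro d _
        gcongr
        have := cube_roots_card (b⁻¹ * d)
        refine le_trans ?_ (by exact_mod_cast this : ((Finset.univ.filter (fun w : F => w ^ 3 = b⁻¹ * d)).card : ℤ) ≤ 3)
        norm_cast
        apply Finset.card_le_card
        intro w hw
        simp only [Finset.mem_filter, Finset.mem_univ, true_and] at hw ⊢
        rw [← hw]; field_simp
    _ ≤ _ := by rw [← Finset.mul_sum]; linarith [Tsum_sq_sum hF A hA]

lemma nu_bound (hF : ringChar F ≠ 2) (A b : F) (hA : A ≠ 0) (hb : b ≠ 0) (hc : 1100 ≤ Fintype.card F) :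
    ((Finset.univ.filter (fun z : F => IsSquare (A * z ^ 3 + b))).card : ℝ) ≤ 0.55 * Fintype.card F := by
  set L : ℝ := (Fintype.card F : ℝ) with hL
  have hLb : (1100 : ℝ) ≤ L := by rw [hL]; exact_mod_cast hc
  have h1 : (2 : ℤ) * ((Finset.univ.filter (fun z : F => IsSquare (A * z ^ 3 + b))).card : ℤ) ≤ Fintype.card F + Tsum A b + 3 := by
    have h2 : ∀ z : F, 2 * (if IsSquare (A * z ^ 3 + b) then (1 : ℤ) else 0) ≤ 1 + quadraticChar F (A * z ^ 3 + b) + (if z ^ 3 = -b / A then 1 else 0) := by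
      intro z
      by_cases h0 : A * z ^ 3 + b = 0
      · have : z ^ 3 = -b / A := by field_simp; linear_combination h0
        rw [if_pos this, h0]; simp
      · by_cases hs : IsSquare (A * z ^ 3 + b)
        · rw [(quadraticChar_one_iff_isSquare h0).mpr hs]; split_ifs <;> norm_num
        · rw [quadraticChar_neg_one_iff_not_isSquare.mpr hs, if_neg hs]; split_ifs <;> norm_num
    have h3 := Finset.sum_le_sum (fun z (_ : z ∈ Finset.univ) => h2 z)
    rw [← Finset.mul_sum, Finset.sum_add_distrib, Finset.sum_add_distrib, Finset.sum_boole, Finset.sum_boole] at h3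
    have h4 := cube_roots_card (-b / A)
    have h5 : ((Finset.univ.filter (fun w : F => w ^ 3 = -b / A)).card : ℤ) ≤ 3 := by exact_mod_cast h4
    simp only [Finset.sum_const, Finset.card_univ, nsmul_eq_mul, mul_one] at h3
    rw [Tsum]; push_cast at h3 ⊢
    linarith
  have h6 := Tsum_bound hF A b hA hb
  have h6' : (L - 1) * (Tsum A b : ℝ) ^ 2 ≤ 9 * L ^ 2 := by rw [hL]; exact_mod_cast h6
  have h1' : 2 * ((Finset.univ.filter (fun z : F => IsSquare (A * z ^ 3 + b))).card : ℝ) ≤ L + Tsum A b + 3 := by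
    rw [hL]; exact_mod_cast h1
  have h7 : (Tsum A b : ℝ) ≤ 0.1 * L - 3 := by
    by_contra hcon
    push Not at hcon
    have h8 : (0.1 * L - 3) ^ 2 < (Tsum A b : ℝ) ^ 2 := by
      apply pow_lt_pow_left₀ hcon (by linarith) (by norm_num)
    have h9 : (L - 1) * (0.1 * L - 3) ^ 2 < 9 * L ^ 2 := by
      have : 0 < L - 1 := by linarith
      nlinarith
    nlinarith [sq_nonneg (L - 1100), mul_nonneg (by linarith : (0:ℝ) ≤ L - 1100) (sq_nonneg L)]
  linarith
end charsum

/-- Legendre-type lower bound. -/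
lemma prime_log_sum (n : ℕ) (hn : 1 ≤ n) :
    Real.log n - 1 ≤ ∑ p ∈ (Finset.range (n + 1)).filter Nat.Prime, Real.log p / ((p : ℝ) - 1) := by
  have hn0 : (0 : ℝ) < n := by exact_mod_cast hn
  have h1 : (n : ℝ) ^ n / (n.factorial : ℝ) ≤ Real.exp n := Real.pow_div_factorial_le_exp (n : ℝ) hn0.le n
  have hf : (0 : ℝ) < n.factorial := by exact_mod_cast n.factorial_pos
  have h2 : n * Real.log n - n ≤ Real.log (n.factorial) := by
    have h3 := Real.log_le_log (by positivity) h1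
    rw [Real.log_exp, Real.log_div (by positivity) hf.ne', Real.log_pow] at h3
    linarith
  have h4 : Real.log (n.factorial) ≤ n * ∑ p ∈ (Finset.range (n + 1)).filter Nat.Prime, Real.log p / ((p : ℝ) - 1) := by
    rw [Real.log_nat_eq_sum_factorization, Finsupp.sum, Finset.mul_sum]
    have hs : (n.factorial).factorization.support ⊆ (Finset.range (n + 1)).filter Nat.Prime := by
      intro p hp
      rw [Nat.support_factorization] at hp
      have hpp := Nat.prime_of_mem_primeFactors hp
      have := (hpp.dvd_factorial).mp (Nat.dvd_of_mem_primeFactors hp)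
      simp [hpp]; omega
    refine le_trans (Finset.sum_le_sum_of_subset_of_nonneg hs ?_) ?_
    · intro p hp _
      have := (Finset.mem_filter.mp hp).2.one_le
      have : 0 ≤ Real.log p := Real.log_nonneg (by exact_mod_cast this)
      positivity
    · apply Finset.sum_le_sum
      intro p hp
      have hpp := (Finset.mem_filter.mp hp).2
      have := Fact.mk hpp
      have h5 := sub_one_mul_padicValNat_factorial_lt_of_ne_zero (p := p) (n := n) (by omega)
      have hp1 : (1 : ℝ) < p := by exact_mod_cast hpp.one_lt
      have h6 : ((p : ℝ) - 1) * (n.factorial.factorization p : ℝ) ≤ n := by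
        rw [Nat.factorization_def _ hpp]
        have h7 : (((p - 1) * padicValNat p n.factorial : ℕ) : ℝ) ≤ n := by exact_mod_cast h5.le
        push_cast [Nat.cast_sub hpp.one_le] at h7
        exact h7
      have h8 : 0 ≤ Real.log p := Real.log_nonneg hp1.le
      rw [← mul_div_assoc, le_div_iff₀ (by linarith)]
      calc _ = ((p : ℝ) - 1) * (n.factorial.factorization p : ℝ) * Real.log p := by ring
        _ ≤ _ := by gcongr
  have h5 : n * (Real.log n - 1) ≤ n * ∑ p ∈ (Finset.range (n + 1)).filter Nat.Prime, Real.log p / ((p : ℝ) - 1) := by linarith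
  exact le_of_mul_le_mul_left h5 hn0

/-- Sum of logs of distinct primes dividing m. -/
lemma sum_log_primes_dvd (P : Finset ℕ) (hP : ∀ p ∈ P, p.Prime) (m : ℕ) (hm : m ≠ 0) (hd : ∀ p ∈ P, p ∣ m) :
    ∑ p ∈ P, Real.log p ≤ Real.log m := by
  rw [← Real.log_prod (fun p hp => by exact_mod_cast (hP p hp).ne_zero)]
  have h1 : (∏ p ∈ P, p) ∣ m := by
    have := prod_pow_dvd_of_primes P hP 1 m (fun p hp => by rw [pow_one]; exact_mod_cast hd p hp)
    rw [pow_one] at this; exact_mod_cast this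
  have h2 := Nat.le_of_dvd (Nat.pos_of_ne_zero hm) h1
  apply Real.log_le_log
  · exact Finset.prod_pos (fun p hp => by exact_mod_cast (hP p hp).pos)
  · have : ((∏ p ∈ P, p : ℕ) : ℝ) ≤ m := by exact_mod_cast h2
    push_cast at this; exact this

/-- Gallagher larger sieve. -/
lemma larger_sieve (S : Finset ℤ) (N : ℝ) (hN : 1 ≤ N) (hS : ∀ s ∈ S, ∀ t ∈ S, |((s - t : ℤ) : ℝ)| ≤ N)
    (Lp : Finset ℕ) (hp : ∀ p ∈ Lp, p.Prime) (ν : ℕ → ℝ) (hν0 : ∀ p ∈ Lp, 0 < ν p)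
    (hν : ∀ p ∈ Lp, ((S.image (fun s : ℤ => (s : ZMod p))).card : ℝ) ≤ ν p) :
    (S.card : ℝ) * (∑ p ∈ Lp, Real.log p / ν p - Real.log N) ≤ ∑ p ∈ Lp, Real.log p := by
  rcases S.eq_empty_or_nonempty with rfl | hne
  · simp
    apply Finset.sum_nonneg; intro p h; exact Real.log_nonneg (by exact_mod_cast (hp p h).one_le)
  have hcpos : (0 : ℝ) < S.card := by exact_mod_cast hne.card_pos
  set c : ℝ := (S.card : ℝ) with hc
  have hlog : ∀ p ∈ Lp, 0 ≤ Real.log p := fun p h => Real.log_nonneg (by exact_mod_cast (hp p h).one_le)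
  -- pairs congruent mod p
  have lower : ∀ p ∈ Lp, c ^ 2 / ν p ≤ ∑ s ∈ S, ∑ t ∈ S, (if (s : ZMod p) = (t : ZMod p) then (1 : ℝ) else 0) := by
    intro p hpL
    have h1 : ∑ s ∈ S, ∑ t ∈ S, (if (s : ZMod p) = (t : ZMod p) then (1 : ℝ) else 0) =
        ∑ b ∈ S.image (fun s : ℤ => (s : ZMod p)), ((S.filter (fun s : ℤ => (s : ZMod p) = b)).card : ℝ) ^ 2 := by
      rw [← Finset.sum_fiberwise_of_maps_to (g := fun s : ℤ => (s : ZMod p)) (t := S.image (fun s : ℤ => (s : ZMod p)))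
        (fun s hs => Finset.mem_image_of_mem _ hs)]
      apply Finset.sum_congr rfl
      intro b _
      rw [Finset.sum_congr rfl (fun s hs => by
        rw [(Finset.mem_filter.mp hs).2, Finset.sum_boole])]
      rw [Finset.sum_const, nsmul_eq_mul, pow_two]
      congr 3
      ext t; simp [eq_comm]
    have h2 : c = ∑ b ∈ S.image (fun s : ℤ => (s : ZMod p)), ((S.filter (fun s : ℤ => (s : ZMod p) = b)).card : ℝ) := by
      rw [hc, Finset.card_eq_sum_card_image (fun s : ℤ => (s : ZMod p)) S]; push_cast; rfl
    have h3 := sq_sum_le_card_mul_sum_sq (s := S.image (fun s : ℤ => (s : ZMod p))) (f := fun b => ((S.filter (fun s : ℤ => (s : ZMod p) = b)).card : ℝ))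
    rw [← h2, ← h1] at h3
    rw [div_le_iff₀ (hν0 p hpL)]
    refine h3.trans ?_
    rw [mul_comm]
    gcongr
    exact hν p hpL
  have upper : ∑ p ∈ Lp, Real.log p * ∑ s ∈ S, ∑ t ∈ S, (if (s : ZMod p) = (t : ZMod p) then (1 : ℝ) else 0) ≤
      c * ∑ p ∈ Lp, Real.log p + c ^ 2 * Real.log N := by
    have e1 : ∑ p ∈ Lp, Real.log p * ∑ s ∈ S, ∑ t ∈ S, (if (s : ZMod p) = (t : ZMod p) then (1 : ℝ) else 0) =
       ∑ s ∈ S, ∑ t ∈ S, ∑ p ∈ Lp, (if (s : ZMod p) = (t : ZMod p) then Real.log p else 0) := by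
      simp_rw [Finset.mul_sum]
      rw [Finset.sum_comm]
      apply Finset.sum_congr rfl; intro s _
      rw [Finset.sum_comm]
      simp
    rw [e1]
    have e2 : ∀ s ∈ S, ∀ t ∈ S, ∑ p ∈ Lp, (if (s : ZMod p) = (t : ZMod p) then Real.log p else 0) ≤
        (if s = t then ∑ p ∈ Lp, Real.log p else 0) + Real.log N := by
      intro s hs t ht
      split_ifs with hst
      · subst hst; simp; exact Real.log_nonneg hN
      · rw [← Finset.sum_filter, zero_add]
        refine (sum_log_primes_dvd _ (fun p h => hp p (Finset.mem_filter.mp h).1) (s - t).natAbs (by omega) ?_).trans ?_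
        · intro p h
          have := (Finset.mem_filter.mp h).2
          rw [← Int.natCast_dvd, ← ZMod.intCast_zmod_eq_zero_iff_dvd]
          push_cast; rw [this]; ring
        · apply Real.log_le_log
          · have : 0 < (s - t).natAbs := by omega
            exact_mod_cast this
          · rw [Nat.cast_natAbs]; push_cast; have := hS s hs t ht; push_cast at this; exact this
    calc _ ≤ ∑ s ∈ S, ∑ t ∈ S, ((if s = t then ∑ p ∈ Lp, Real.log p else 0) + Real.log N) :=
          Finset.sum_le_sum (fun s hs => Finset.sum_le_sum (fun t ht => e2 s hs t ht))
      _ = _ := by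
          simp_rw [Finset.sum_add_distrib, Finset.sum_const, nsmul_eq_mul]
          rw [Finset.sum_congr rfl (fun s hs => by rw [Finset.sum_ite_eq, if_pos hs])]
          rw [Finset.sum_const, nsmul_eq_mul, ← hc]; ring
  have low2 : c ^ 2 * ∑ p ∈ Lp, Real.log p / ν p ≤ c * ∑ p ∈ Lp, Real.log p + c ^ 2 * Real.log N := by
    refine le_trans ?_ upper
    rw [Finset.mul_sum]
    apply Finset.sum_le_sum
    intro p hpL
    calc c ^ 2 * (Real.log p / ν p) = Real.log p * (c ^ 2 / ν p) := by ring
      _ ≤ _ := mul_le_mul_of_nonneg_left (lower p hpL) (hlog p hpL)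
  have : c * (c * (∑ p ∈ Lp, Real.log p / ν p - Real.log N)) ≤ c * ∑ p ∈ Lp, Real.log p := by linarith
  exact le_of_mul_le_mul_left this hcpos

set_option linter.unusedVariables false

lemma sieve_count (ε : ℝ) (hε : 0 < ε) : ∃ C : ℝ, 1 ≤ C ∧ ∀ (B N : ℝ) (N0 : ℕ) (S : Finset ℤ), 1 ≤ B → 1 ≤ N → N0 ≠ 0 →
    (N0 : ℝ) ≤ B ^ 3 → (∀ s ∈ S, ∀ t ∈ S, |((s - t : ℤ) : ℝ)| ≤ N) →
    (∀ p : ℕ, p.Prime → 1100 ≤ p → ¬ p ∣ N0 → ((S.image (fun s : ℤ => (s : ZMod p))).card : ℝ) ≤ 0.55 * p) →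
    (S.card : ℝ) ≤ C * B ^ ε * N ^ (0.64 : ℝ) := by
  obtain ⟨z0, hz0⟩ := exists_nat_gt (3 / ε)
  set z : ℕ := max z0 1100 with hz
  have hz1 : (1100 : ℝ) ≤ z := by exact_mod_cast le_max_right _ _
  have hz2 : 3 / ε ≤ z := hz0.le.trans (by exact_mod_cast le_max_left _ _)
  have hzp : (0 : ℝ) < z := by linarith
  have hz3 : 3 / (z : ℝ) ≤ ε := by
    rw [div_le_iff₀ hzp]; rw [div_le_iff₀ hε] at hz2; linarith
  set cz : ℝ := ∑ p ∈ (Finset.range (z + 1)).filter Nat.Prime, Real.log p / ((p : ℝ) - 1) with hcz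
  have hterm : ∀ p : ℕ, p.Prime → 0 ≤ Real.log p / ((p : ℝ) - 1) := fun p hp => by
    have : (1 : ℝ) < p := by exact_mod_cast hp.one_lt
    exact div_nonneg (Real.log_nonneg this.le) (by linarith)
  have hcz0 : 0 ≤ cz := Finset.sum_nonneg (fun p hp => hterm p (Finset.mem_filter.mp hp).2)
  refine ⟨4 * Real.exp (1 + cz + 1 / 1.8), ?_, ?_⟩
  · have : 1 ≤ Real.exp (1 + cz + 1 / 1.8) := Real.one_le_exp (by positivity)
    linarith
  intro B N N0 S hB hN hN0 hN0B hdiff hcls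
  have hB0 : 0 < B := by linarith
  have hNp : 0 < N := by linarith
  have hlB : 0 ≤ Real.log B := Real.log_nonneg hB
  have hlN : 0 ≤ Real.log N := Real.log_nonneg hN
  set L : ℝ := 1 + cz + 3 * Real.log B / z + (Real.log N + 1) / 1.8 with hL
  have hL0 : 0 ≤ L := by positivity
  set n : ℕ := ⌈Real.exp L⌉₊ with hn
  have hnL : Real.exp L ≤ n := Nat.le_ceil _
  have hnU : (n : ℝ) ≤ 2 * Real.exp L := by
    have := (Nat.ceil_lt_add_one (Real.exp_pos L).le).le
    have h1 : 1 ≤ Real.exp L := Real.one_le_exp hL0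
    linarith
  have hn1 : 1 ≤ n := by
    have : (0 : ℝ) < n := (Real.exp_pos L).trans_le hnL
    exact_mod_cast this
  have hlogn : L ≤ Real.log n := by
    rw [← Real.log_exp L]; exact Real.log_le_log (Real.exp_pos _) hnL
  set PP := (Finset.range (n + 1)).filter Nat.Prime with hPP
  set Lp := PP.filter (fun p => z < p ∧ ¬ p ∣ N0) with hLp
  have hLpp : ∀ p ∈ Lp, p.Prime := fun p hp => (Finset.mem_filter.mp (Finset.mem_filter.mp hp).1).2
  have hLz : ∀ p ∈ Lp, z < p := fun p hp => ((Finset.mem_filter.mp hp).2).1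
  have hLd : ∀ p ∈ Lp, ¬ p ∣ N0 := fun p hp => ((Finset.mem_filter.mp hp).2).2
  have hs := larger_sieve S N hN hdiff Lp hLpp (fun p => 0.55 * p)
    (fun p hp => by have : (0 : ℝ) < p := by exact_mod_cast (hLpp p hp).pos
                    positivity)
    (fun p hp => hcls p (hLpp p hp) (by have := hLz p hp; have : 1100 ≤ z := le_max_right _ _; omega) (hLd p hp))
  -- theta bound
  have hθ : ∑ p ∈ Lp, Real.log p ≤ Real.log 4 * n := by
    have h1 := Chebyshev.theta_le_log4_mul_x (x := (n : ℝ)) (by positivity)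
    refine le_trans ?_ h1
    rw [Chebyshev.theta, Nat.floor_natCast]
    apply Finset.sum_le_sum_of_subset_of_nonneg
    · intro p hp
      have hpp := hLpp p hp
      have := (Finset.mem_filter.mp (Finset.mem_filter.mp hp).1).1
      simp only [Finset.mem_filter, Finset.mem_Ioc, hpp, and_true]
      have := hpp.pos
      simp at *; omega
    · intro p hp _
      exact Real.log_natCast_nonneg p
  -- prime supply
  have hsup : (Real.log N + 1) / 1.8 ≤ ∑ p ∈ Lp, Real.log p / ((p : ℝ) - 1) := by
    have h1 := prime_log_sum n hn1
    rw [← hPP] at h1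
    have h2 : ∑ p ∈ PP, Real.log p / ((p : ℝ) - 1) ≤ ∑ p ∈ Lp, Real.log p / ((p : ℝ) - 1) + cz +
        ∑ p ∈ PP.filter (fun p => z < p ∧ p ∣ N0), Real.log p / ((p : ℝ) - 1) := by
      rw [← Finset.sum_filter_add_sum_filter_not PP (fun p => z < p ∧ ¬ p ∣ N0), ← hLp]
      rw [← Finset.sum_filter_add_sum_filter_not (PP.filter (fun p => ¬ (z < p ∧ ¬ p ∣ N0))) (fun p => p ≤ z)]
      have e1 : ∑ p ∈ (PP.filter (fun p => ¬ (z < p ∧ ¬ p ∣ N0))).filter (fun p => p ≤ z), Real.log p / ((p : ℝ) - 1) ≤ cz := by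
        rw [hcz]
        apply Finset.sum_le_sum_of_subset_of_nonneg
        · intro p hp
          simp only [hPP, Finset.mem_filter, Finset.mem_range] at hp ⊢
          exact ⟨by omega, hp.1.1.2⟩
        · intro p hp _; exact hterm p (Finset.mem_filter.mp hp).2
      have e2 : ∑ p ∈ (PP.filter (fun p => ¬ (z < p ∧ ¬ p ∣ N0))).filter (fun p => ¬ p ≤ z), Real.log p / ((p : ℝ) - 1) ≤
          ∑ p ∈ PP.filter (fun p => z < p ∧ p ∣ N0), Real.log p / ((p : ℝ) - 1) := by
        apply Finset.sum_le_sum_of_subset_of_nonneg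
        · intro p hp
          simp only [Finset.mem_filter] at hp ⊢
          refine ⟨hp.1.1, by omega, ?_⟩
          by_contra hcon
          exact hp.1.2 ⟨by omega, hcon⟩
        · intro p hp _
          simp only [hPP, Finset.mem_filter] at hp
          exact hterm p hp.1.2
      linarith
    have h3 : ∑ p ∈ PP.filter (fun p => z < p ∧ p ∣ N0), Real.log p / ((p : ℝ) - 1) ≤ 3 * Real.log B / z := by
      calc _ ≤ ∑ p ∈ PP.filter (fun p => z < p ∧ p ∣ N0), Real.log p / z := by
            apply Finset.sum_le_sum
            intro p hp
            have hzp' : z + 1 ≤ p := (Finset.mem_filter.mp hp).2.1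
            have : (z : ℝ) + 1 ≤ p := by exact_mod_cast hzp'
            have := Real.log_natCast_nonneg p
            gcongr; linarith
        _ = (∑ p ∈ PP.filter (fun p => z < p ∧ p ∣ N0), Real.log p) / z := by rw [Finset.sum_div]
        _ ≤ _ := by
            gcongr
            refine (sum_log_primes_dvd _ ?_ N0 hN0 ?_).trans ?_
            · intro p hp
              simp only [hPP, Finset.mem_filter] at hp
              exact hp.1.2
            · intro p hp; exact (Finset.mem_filter.mp hp).2.2
            · have : Real.log N0 ≤ Real.log (B ^ 3) := Real.log_le_log (by exact_mod_cast Nat.pos_of_ne_zero hN0) hN0B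
              rw [Real.log_pow] at this; exact_mod_cast this
    linarith
  have hsup2 : 1 ≤ ∑ p ∈ Lp, Real.log p / (0.55 * (p : ℝ)) - Real.log N := by
    have h1 : 1.8 * ∑ p ∈ Lp, Real.log p / ((p : ℝ) - 1) ≤ ∑ p ∈ Lp, Real.log p / (0.55 * (p : ℝ)) := by
      rw [Finset.mul_sum]
      apply Finset.sum_le_sum
      intro p hp
      have h2 : (1100 : ℝ) ≤ p := hz1.trans (by exact_mod_cast (hLz p hp).le)
      have h3 := Real.log_natCast_nonneg p
      rw [← mul_div_assoc, div_le_div_iff₀ (by linarith) (by linarith)]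
      nlinarith
    rw [div_le_iff₀ (by norm_num)] at hsup
    linarith
  have hcard : (S.card : ℝ) ≤ Real.log 4 * n := by
    have : (0 : ℝ) ≤ S.card := by positivity
    nlinarith
  have hl4 : Real.log 4 ≤ 2 := by
    have : Real.log 4 = 2 * Real.log 2 := by rw [show (4 : ℝ) = 2 ^ 2 by norm_num, Real.log_pow]; norm_num
    rw [this]; linarith [Real.log_two_lt_d9]
  have hexp : Real.exp L ≤ Real.exp (1 + cz + 1 / 1.8) * (B ^ ε * N ^ (0.64 : ℝ)) := by
    have : L ≤ (1 + cz + 1 / 1.8) + (Real.log B * ε + Real.log N * 0.64) := by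
      have h1 : 3 * Real.log B / z ≤ Real.log B * ε := by
        calc 3 * Real.log B / z = Real.log B * (3 / z) := by ring
          _ ≤ _ := by gcongr
      have h2 : (Real.log N + 1) / 1.8 = Real.log N * (1 / 1.8) + 1 / 1.8 := by ring
      have h3 : Real.log N * (1 / 1.8) ≤ Real.log N * 0.64 := by gcongr; norm_num
      linarith
    calc Real.exp L ≤ Real.exp ((1 + cz + 1 / 1.8) + (Real.log B * ε + Real.log N * 0.64)) := Real.exp_le_exp.mpr this
      _ = _ := by rw [Real.exp_add (1 + cz + 1 / 1.8), Real.exp_add (Real.log B * ε), Real.rpow_def_of_pos hB0, Real.rpow_def_of_pos hNp]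
  calc (S.card : ℝ) ≤ Real.log 4 * n := hcard
    _ ≤ 2 * (2 * Real.exp L) := by gcongr
    _ ≤ 2 * (2 * (Real.exp (1 + cz + 1 / 1.8) * (B ^ ε * N ^ (0.64 : ℝ)))) := by gcongr
    _ = _ := by ring

set_option maxHeartbeats 1000000 in
lemma LS (ε : ℝ) (hε : 0 < ε) : ∃ C : ℝ, 1 ≤ C ∧ ∀ (a X Y : Fin 3 → ℤ) (B : ℝ) (S : Finset Pt), 1 ≤ B → Box a X Y B S →
    (S.card : ℝ) ≤ C * B ^ ε * (X 1 * X 2 * Y 0 * Y 1 * (1 + Y 2 / (Y 0 : ℝ) ^ 3) ^ (0.64 : ℝ)) := by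
  obtain ⟨C, hC, hω⟩ := omega_bound 3 (ε / 2) (by linarith)
  obtain ⟨C', hC', hsv⟩ := sieve_count (ε / 2) (by linarith)
  refine ⟨C * (C' * 216), by nlinarith, ?_⟩
  intro a X Y B S hB hbox
  have hB0 : (0 : ℝ) < B := by linarith
  have Yp : ∀ i, (0 : ℝ) < Y i := fun i => by have := hbox.Y1 i; exact_mod_cast (by linarith : 0 < Y i)
  have Xp : ∀ i, (0 : ℝ) < X i := fun i => by have := hbox.X1 i; exact_mod_cast (by linarith : 0 < X i)
  have y0' := Yp 0
  have y1' := Yp 1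
  have y2' := Yp 2
  have x1' := Xp 1
  have x2' := Xp 2
  have hBε : B ^ ε = B ^ (ε / 2) * B ^ (ε / 2) := by rw [← Real.rpow_add hB0]; congr 1; ring
  have := fiber_bound S (fun P => (P.1 1, P.1 2, P.2 0, P.2 1)) 
    (Finset.Ico (X 1) (2 * X 1) ×ˢ Finset.Ico (X 2) (2 * X 2) ×ˢ Finset.Ico (Y 0) (2 * Y 0) ×ˢ Finset.Ico (Y 1) (2 * Y 1))
    (C * (C' * 216) * B ^ ε * ((1 + Y 2 / (Y 0 : ℝ) ^ 3) ^ (0.64 : ℝ))) (by positivity) ?_ ?_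
  · refine this.trans (le_of_eq ?_)
    rw [Finset.card_product, Finset.card_product, Finset.card_product]
    push_cast
    rw [card_Ico_two _ (hbox.X1 1), card_Ico_two _ (hbox.X1 2), card_Ico_two _ (hbox.Y1 0), card_Ico_two _ (hbox.Y1 1)]
    ring
  · intro P hP
    simp only [Finset.mem_product, Finset.mem_Ico]
    exact ⟨⟨hbox.xlo P hP 1, hbox.xhi P hP 1⟩, ⟨hbox.xlo P hP 2, hbox.xhi P hP 2⟩, ⟨hbox.ylo P hP 0, hbox.yhi P hP 0⟩,
      ⟨hbox.ylo P hP 1, hbox.yhi P hP 1⟩⟩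
  · rintro ⟨x1, x2, y0, y1⟩ hb
    set F := S.filter (fun P => (P.1 1, P.1 2, P.2 0, P.2 1) = (x1, x2, y0, y1)) with hF
    rcases F.eq_empty_or_nonempty with he | ⟨P0, hP0⟩
    · rw [he]; simp; positivity
    have hFb : Box a X Y B F := hbox.mono (Finset.filter_subset _ _)
    have hf4 : ∀ P ∈ F, P.1 1 = x1 ∧ P.1 2 = x2 ∧ P.2 0 = y0 ∧ P.2 1 = y1 := fun P hP => by
      have := (Finset.mem_filter.mp hP).2
      simpa using this
    have hf : ∀ P ∈ F, P.1 1 = x1 ∧ P.1 2 = x2 ∧ P.2 0 = y0 := fun P hP =>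
      ⟨(hf4 P hP).1, (hf4 P hP).2.1, (hf4 P hP).2.2.1⟩
    obtain ⟨S', hS', hd, hc⟩ := cube_mono hFb x1 x2 y0 hf
    have hS'b := hFb.mono hS'
    have hq0 := q6_pos y0
    set q : ℤ := (q6 y0 : ℤ) with hq
    have hqz : 0 < q := by rw [hq]; exact_mod_cast hq0
    have hqr : (0 : ℝ) < (q : ℝ) := by exact_mod_cast hqz
    have hy0 : (Y 0 : ℝ) ≤ 6 * q := by
      have h1 := q6_le (by rw [← (hf P0 hP0).2.2]; exact (hFb.sol P0 hP0).sqf 0 : Squarefree y0)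
      have h2 := hFb.ylo P0 hP0 0
      have h3 := (hFb.sol P0 hP0).ypos 0
      rw [(hf P0 hP0).2.2] at h2 h3
      have : Y 0 ≤ 6 * q := by omega
      exact_mod_cast this
    have hω' := hω y0.natAbs (by
      have h3 := (hFb.sol P0 hP0).ypos 0
      rw [(hf P0 hP0).2.2] at h3
      omega)
    have hom := hFb.omega hP0 0 hB
    rw [(hf P0 hP0).2.2] at hom
    have h3 : (3 : ℝ) ^ (q6P y0).card ≤ C * B ^ (ε / 2) := by
      calc (3 : ℝ) ^ (q6P y0).card ≤ 3 ^ y0.natAbs.primeFactors.card := by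
            apply pow_le_pow_right₀ (by norm_num) (q6P_card y0)
        _ ≤ C * (y0.natAbs : ℝ) ^ (ε / 2) := by exact_mod_cast hω'
        _ ≤ _ := by gcongr
    -- the sieve
    have hcard : (S'.card : ℝ) ≤ C' * B ^ (ε / 2) * (216 * (1 + Y 2 / (Y 0 : ℝ) ^ 3)) ^ (0.64 : ℝ) := by
      rcases S'.eq_empty_or_nonempty with he | ⟨R0, hR0⟩
      · rw [he]; simp; positivity
      have hdv : ∀ P ∈ S', q ^ 3 ∣ P.2 2 - R0.2 2 := by
        intro P hP
        have h1 := hd R0 hR0 P hP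
        rw [(hf4 R0 (hS' hR0)).2.2.2, (hf4 P (hS' hP)).2.2.2] at h1
        have hcop : IsCoprime (q ^ 3) y1 := by
          have h2 := (hS'b.sol P hP).cop 0 1 (by decide)
          rw [(hf4 P (hS' hP)).2.2.1, (hf4 P (hS' hP)).2.2.2] at h2
          exact (h2.of_mul_left_right.of_mul_right_right.of_isCoprime_of_dvd_left (q6_dvd y0)).pow_left
        apply hcop.dvd_of_dvd_mul_left
        have : y1 * (P.2 2 - R0.2 2) = y1 * P.2 2 - y1 * R0.2 2 := by ring
        rw [this]; exact h1
      choose! k hk using hdv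
      have hkinj : Set.InjOn k S' := by
        intro P hP R hR h
        have h1 := hk P hP
        have h2 := hk R hR
        rw [h] at h1
        have h5 : P.2 2 = R.2 2 := by linarith
        have hP' := hf4 P (hS' hP)
        have hR' := hf4 R (hS' hR)
        have := (hS'b.sol P hP).x0_unique (hS'b.sol R hR) (by rw [hP'.2.2.1, hR'.2.2.1]) (by rw [hP'.1, hR'.1])
          (by rw [hP'.2.1, hR'.2.1]) (by rw [hP'.2.2.2, hR'.2.2.2]) h5
        exact Prod.ext this.1 this.2
      rw [← Finset.card_image_of_injOn hkinj]
      have sR := hS'b.sol R0 hR0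
      have fR := hf4 R0 (hS' hR0)
      have x1pos : 0 < x1 := by rw [← fR.1]; exact sR.xpos 1
      have x2pos : 0 < x2 := by rw [← fR.2.1]; exact sR.xpos 2
      have y0pos : 0 < y0 := by rw [← fR.2.2.1]; exact sR.ypos 0
      have y1pos : 0 < y1 := by rw [← fR.2.2.2]; exact sR.ypos 1
      set N0 : ℤ := (a 0 * y0) * (a 1 * x1 ^ 2 * y1 ^ 3) * (a 2 * x2 ^ 2) with hN0
      have hN0ne : N0 ≠ 0 := by
        rw [hN0]
        have := sR.ane 0
        have := sR.ane 1
        have := sR.ane 2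
        have := x1pos.ne'; have := x2pos.ne'; have := y0pos.ne'; have := y1pos.ne'
        positivity
      apply hsv B _ N0.natAbs _ hB
      · have : (0 : ℝ) ≤ Y 2 / (Y 0 : ℝ) ^ 3 := by positivity
        linarith
      · omega
      · have b0 := hS'b.bd R0 hR0 0
        have b1 := hS'b.bd R0 hR0 1
        have b2 := hS'b.bd R0 hR0 2
        rw [fR.2.2.1] at b0
        rw [fR.1, fR.2.2.2] at b1
        rw [fR.2.1] at b2
        have px0 := sR.xpos 0
        have py2 := sR.ypos 2
        have c0 : ((|a 0 * y0| : ℤ) : ℝ) ≤ B := by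
          refine le_trans ?_ b0
          have : |a 0 * y0| ≤ |a 0| * R0.1 0 ^ 2 * y0 ^ 3 := by
            rw [abs_mul, abs_of_pos y0pos]
            have e1 : |a 0| ≤ |a 0| * R0.1 0 ^ 2 := le_mul_of_one_le_right (abs_nonneg _) (pow_pos px0 2)
            have e2 : y0 ≤ y0 ^ 3 := le_self_pow₀ y0pos (by norm_num)
            gcongr
          exact_mod_cast this
        have c1 : ((|a 1 * x1 ^ 2 * y1 ^ 3| : ℤ) : ℝ) ≤ B := by
          refine le_trans (le_of_eq ?_) b1
          rw [abs_mul, abs_mul, abs_of_pos (pow_pos x1pos 2), abs_of_pos (pow_pos y1pos 3)]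
        have c2 : ((|a 2 * x2 ^ 2| : ℤ) : ℝ) ≤ B := by
          refine le_trans ?_ b2
          have : |a 2 * x2 ^ 2| ≤ |a 2| * x2 ^ 2 * R0.2 2 ^ 3 := by
            rw [abs_mul, abs_of_pos (pow_pos x2pos 2)]
            exact le_mul_of_one_le_right (by positivity) (pow_pos py2 3)
          exact_mod_cast this
        rw [Nat.cast_natAbs, hN0, abs_mul, abs_mul]
        push_cast at c0 c1 c2 ⊢
        calc _ ≤ B * B * B := by gcongr
          _ = B ^ 3 := by ring
      · intro s hs t ht
        obtain ⟨P, hP, rfl⟩ := Finset.mem_image.mp hs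
        obtain ⟨R, hR, rfl⟩ := Finset.mem_image.mp ht
        have h1 := hk P hP
        have h2 := hk R hR
        have h5 : q ^ 3 * (k P - k R) = P.2 2 - R.2 2 := by linarith
        have h6 : |P.2 2 - R.2 2| ≤ Y 2 := by
          have := hS'b.ylo P hP 2; have := hS'b.yhi P hP 2
          have := hS'b.ylo R hR 2; have := hS'b.yhi R hR 2
          rw [abs_le]; constructor <;> linarith
        have h7 : (q : ℝ) ^ 3 * |((k P - k R : ℤ) : ℝ)| ≤ Y 2 := by
          rw [← h5, abs_mul, abs_of_pos (pow_pos hqz 3)] at h6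
          rw [← Int.cast_abs]; exact_mod_cast h6
        have h8 : (Y 0 : ℝ) ^ 3 ≤ 216 * (q : ℝ) ^ 3 := by
          calc (Y 0 : ℝ) ^ 3 ≤ (6 * q) ^ 3 := by gcongr
            _ = _ := by ring
        have h9 : |((k P - k R : ℤ) : ℝ)| ≤ 216 * (Y 2 / (Y 0 : ℝ) ^ 3) := by
          rw [← mul_div_assoc, le_div_iff₀ (by positivity)]
          have := abs_nonneg ((k P - k R : ℤ) : ℝ)
          nlinarith
        linarith
      · intro p hp hp1 hpN
        have := Fact.mk hp
        have hpi : Prime (p : ℤ) := Nat.prime_iff_prime_int.mp hp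
        have hpN' : ¬ (p : ℤ) ∣ N0 := fun h => hpN (Int.natCast_dvd.mp h)
        have hnz : (N0 : ZMod p) ≠ 0 := fun h => hpN' ((ZMod.intCast_zmod_eq_zero_iff_dvd _ _).mp h)
        rw [hN0] at hnz
        push_cast at hnz
        have n1 := left_ne_zero_of_mul (left_ne_zero_of_mul hnz)
        have n2 := right_ne_zero_of_mul (left_ne_zero_of_mul hnz)
        have n3 := right_ne_zero_of_mul hnz
        have hchar : ringChar (ZMod p) ≠ 2 := by
          rw [ZMod.ringChar_zmod_n]; omega
        have hνb := nu_bound (F := ZMod p) hchar (-(a 0 * y0 : ZMod p) * (a 2 * x2 ^ 2)) (-(a 0 * y0 : ZMod p) * (a 1 * x1 ^ 2 * y1 ^ 3))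
          (mul_ne_zero (neg_ne_zero.mpr n1) n3) (mul_ne_zero (neg_ne_zero.mpr n1) n2) (by rw [ZMod.card]; exact hp1)
        rw [ZMod.card] at hνb
        refine le_trans ?_ hνb
        have hqp : (q : ZMod p) ≠ 0 := by
          intro h
          have h1 := (ZMod.intCast_zmod_eq_zero_iff_dvd _ _).mp h
          have h2 : (p : ℤ) ∣ y0 := h1.trans (q6_dvd y0)
          exact n1 (by rw [(ZMod.intCast_zmod_eq_zero_iff_dvd _ _).mpr h2, mul_zero])
        norm_cast
        apply Finset.card_le_card_of_injOn (fun t => (R0.2 2 : ZMod p) + (q : ZMod p) ^ 3 * t)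
        · intro t ht
          obtain ⟨s, hs, rfl⟩ := Finset.mem_image.mp ht
          obtain ⟨P, hP, rfl⟩ := Finset.mem_image.mp hs
          have h1 := hk P hP
          have h2 : ((R0.2 2 : ℤ) : ZMod p) + (q : ZMod p) ^ 3 * ((k P : ℤ) : ZMod p) = ((P.2 2 : ℤ) : ZMod p) := by
            have : P.2 2 = R0.2 2 + q ^ 3 * k P := by linarith
            rw [this]; push_cast; ring
          simp only [Finset.coe_filter, Finset.mem_univ, true_and, Set.mem_ofPred_eq]
          rw [h2]
          refine ⟨((a 0 * P.1 0 * y0 ^ 2 : ℤ) : ZMod p), ?_⟩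
          have fP := hf4 P (hS' hP)
          have e := (hS'b.sol P hP).eq
          rw [fP.1, fP.2.1, fP.2.2.1, fP.2.2.2] at e
          have e' : -(a 0 * y0) * (a 2 * x2 ^ 2) * (P.2 2) ^ 3 + -(a 0 * y0) * (a 1 * x1 ^ 2 * y1 ^ 3) = (a 0 * P.1 0 * y0 ^ 2) * (a 0 * P.1 0 * y0 ^ 2) := by
            linear_combination -(a 0 * y0) * e
          have e'' := congrArg (fun t : ℤ => (t : ZMod p)) e'
          push_cast at e'' ⊢
          exact e''
        · intro t _ t' _ h
          simp only [add_right_inj] at h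
          exact mul_left_cancel₀ (pow_ne_zero _ hqp) h
    have h216 : (216 : ℝ) ^ (0.64 : ℝ) ≤ 216 := by
      calc (216 : ℝ) ^ (0.64 : ℝ) ≤ 216 ^ (1 : ℝ) := Real.rpow_le_rpow_of_exponent_le (by norm_num) (by norm_num)
        _ = 216 := Real.rpow_one _
    rw [Real.mul_rpow (by norm_num) (by positivity)] at hcard
    calc (F.card : ℝ) ≤ 3 ^ (q6P y0).card * S'.card := by exact_mod_cast hc
      _ ≤ (C * B ^ (ε / 2)) * (C' * B ^ (ε / 2) * (216 * (1 + Y 2 / (Y 0 : ℝ) ^ 3) ^ (0.64 : ℝ))) := by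
        gcongr
        refine hcard.trans ?_
        gcongr
      _ = _ := by rw [hBε]; ring

set_option linter.unusedVariables false

lemma dvdE {M a b : ℤ} (h : M ∣ a) (e : b = a) : M ∣ b := e ▸ h

/-- A binary form vanishing modulo a prime power at enough independent points. -/
lemma VM {p s k : ℕ} (hp : p.Prime) (c m n : Fin k → ℤ)
    (h : ∀ i, (p : ℤ) ^ s ∣ ∑ j : Fin k, (m i ^ (j : ℕ) * n i ^ (j.rev : ℕ)) * c j)
    (hj : ∀ i l, i ≠ l → ¬ (p : ℤ) ∣ m i * n l - m l * n i) (j : Fin k) : (p : ℤ) ^ s ∣ c j := by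
  have hpi : Prime (p : ℤ) := Nat.prime_iff_prime_int.mp hp
  set A := Matrix.projVandermonde m n with hA
  have hdet : IsCoprime ((p : ℤ) ^ s) A.det := by
    apply IsCoprime.pow_left
    rw [hA, Matrix.det_projVandermonde]
    apply IsCoprime.prod_right
    intro i _
    apply IsCoprime.prod_right
    intro l hl
    rw [Prime.coprime_iff_not_dvd hpi]
    have := hj l i (by rintro rfl; simp at hl)
    exact this
  choose w hw using h
  have h1 : A.mulVec c = fun i => (p : ℤ) ^ s * w i := by
    funext i
    rw [← hw i]
    simp [Matrix.mulVec, dotProduct, hA, Matrix.projVandermonde_apply]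
  have h2 : A.adjugate.mulVec (A.mulVec c) = A.det • c := by
    rw [Matrix.mulVec_mulVec, Matrix.adjugate_mul]
    simp
  have h3 := congrFun h2 j
  rw [h1] at h3
  apply hdet.dvd_of_dvd_mul_left
  have h4 : A.det * c j = A.det • c j := rfl
  rw [h4]
  have h5 : (A.det • c) j = A.det • c j := rfl
  rw [← h5, ← h3]
  simp only [Matrix.mulVec, dotProduct]
  apply Finset.dvd_sum
  intro i _
  exact Dvd.intro _ (by ring : (p : ℤ) ^ s * (A.adjugate j i * w i) = _)

lemma core_rel {q S T a b : ℤ} (h6 : IsCoprime q 6) (ha : q ∣ a) (hb : q ∣ b) (hS : IsCoprime q S)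
    (hT : IsCoprime q T) (h : q ^ 3 ∣ (S + a) ^ 2 * (T + b) ^ 3 - S ^ 2 * T ^ 3) :
    q ^ 3 ∣ 4 * T * a + 6 * S * b + 5 * a * b := by
  have h2 : IsCoprime q 2 := h6.of_isCoprime_of_dvd_right ⟨3, by norm_num⟩
  obtain ⟨b', rfl⟩ := hb
  obtain ⟨a', rfl⟩ := ha
  have hTb : IsCoprime q (T + q * b') := hT.add_mul_left_right b'
  have h8 : IsCoprime q (8 * (S * T) + q * (6 * S * b' - 2 * S * b' + 4 * T * a' + 5 * a' * b' * q)) := by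
    apply IsCoprime.add_mul_left_right
    have : (8 : ℤ) = 2 ^ 3 := by norm_num
    rw [this]
    exact (h2.pow_right).mul_right (hS.mul_right hT)
  have key : q ^ 3 ∣ (T + q * b') ^ 3 * ((8 * (S * T) + q * (6 * S * b' - 2 * S * b' + 4 * T * a' + 5 * a' * b' * q)) *
      (4 * T * (q * a') + 6 * S * (q * b') + 5 * (q * a') * (q * b'))) := by
    have : (T + q * b') ^ 3 * ((8 * (S * T) + q * (6 * S * b' - 2 * S * b' + 4 * T * a' + 5 * a' * b' * q)) *
      (4 * T * (q * a') + 6 * S * (q * b') + 5 * (q * a') * (q * b'))) =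
      (4 * T + 5 * (q * b')) ^ 2 * ((S + q * a') ^ 2 * (T + q * b') ^ 3 - S ^ 2 * T ^ 3)
       - q ^ 3 * (S ^ 2 * b' ^ 3 * (-5 * T ^ 2 - 5 * T * (q * b') + (q * b') ^ 2)) := by ring
    rw [this]
    exact dvd_sub (h.mul_left _) (Dvd.intro _ rfl)
  exact (h8.pow_left).dvd_of_dvd_mul_left ((hTb.pow_left.pow_right).dvd_of_dvd_mul_left key)

/-- Local algebra behind the auxiliary form. -/
lemma local_rel {M q s t A x y B A' x' y' B' d f : ℤ}
    (hd : d = B * y' - B' * y) (hf : f = 4 * t * A * y' + 6 * s * x * B' + 5 * q * A * B')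
    (c0 : M ∣ 4 * t * A * y + 6 * s * x * B + 5 * q * A * B)
    (c1 : M ∣ 4 * t * (A * y' + A' * y) + 6 * s * (x * B' + x' * B) + 5 * q * (A * B' + A' * B))
    (c2 : M ∣ 4 * t * A' * y' + 6 * s * x' * B' + 5 * q * A' * B') :
    M ∣ d * (5 * q * A + 6 * s * x) + f * y ∧ M ∣ d * (4 * t * A) - f * B ∧
    M ∣ d * (5 * q * A' + 6 * s * x') + f * y' ∧ M ∣ d * (4 * t * A') - f * B' := by
  subst hd hf
  refine ⟨?_, ?_, ?_, ?_⟩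
  · have := c0.mul_left y'
    exact dvdE this (by ring)
  · have := c0.mul_left (-B')
    exact dvdE this (by ring)
  · have := dvd_add (c1.mul_left y') (c2.mul_left (-y))
    exact dvdE this (by ring)
  · have := dvd_sub (c2.mul_left B) (c1.mul_left B')
    exact dvdE this (by ring)

lemma local_A {M q s t A x y B A' x' y' B' : ℤ}
    (hd : IsCoprime M (B * y' - B' * y)) (h6 : IsCoprime M 6) (hs : IsCoprime M s) (ht : IsCoprime M t)
    (c0 : M ∣ 4 * t * A * y + 6 * s * x * B + 5 * q * A * B)
    (c1 : M ∣ 4 * t * (A * y' + A' * y) + 6 * s * (x * B' + x' * B) + 5 * q * (A * B' + A' * B))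
    (c2 : M ∣ 4 * t * A' * y' + 6 * s * x' * B' + 5 * q * A' * B') :
    M ∣ A * B' - A' * B ∧ M ∣ 2 * t * (A * y' - A' * y) - 3 * s * (x * B' - x' * B) ∧
    M ∣ 4 * t * (x * y' - x' * y) + 5 * q * (x * B' - x' * B) := by
  obtain ⟨d, hdd⟩ : ∃ d, d = B * y' - B' * y := ⟨_, rfl⟩
  obtain ⟨f, hf⟩ : ∃ f, f = 4 * t * A * y' + 6 * s * x * B' + 5 * q * A * B' := ⟨_, rfl⟩
  obtain ⟨e1, e2, e1', e2'⟩ := local_rel hdd hf c0 c1 c2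
  rw [← hdd] at hd
  have h2 : IsCoprime M 2 := h6.of_isCoprime_of_dvd_right ⟨3, by norm_num⟩
  have h4 : IsCoprime M 4 := by rw [show (4 : ℤ) = 2 ^ 2 by norm_num]; exact h2.pow_right
  have g1 : M ∣ A * B' - A' * B := by
    have : M ∣ (d * (4 * t)) * (A * B' - A' * B) := by
      have := dvd_sub (e2.mul_right B') (e2'.mul_right B)
      exact dvdE this (by ring)
    exact (hd.mul_right (h4.mul_right ht)).dvd_of_dvd_mul_left this
  have g2 : M ∣ 2 * t * (A * y' - A' * y) - 3 * s * (x * B' - x' * B) := by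
    have : M ∣ (d * 2) * (2 * t * (A * y' - A' * y) - 3 * s * (x * B' - x' * B)) := by
      have := dvd_add (dvd_sub (dvd_sub (e2.mul_right y') (e2'.mul_right y)) 
        (dvd_sub (e1.mul_right B') (e1'.mul_right B))) (g1.mul_left (d * 5 * q))
      exact dvdE this (by ring)
    exact (hd.mul_right h2).dvd_of_dvd_mul_left this
  refine ⟨g1, g2, ?_⟩
  have : M ∣ (d * (6 * s)) * (4 * t * (x * y' - x' * y) + 5 * q * (x * B' - x' * B)) := by
    have := dvd_sub ((dvd_sub (e1.mul_right y') (e1'.mul_right y)).mul_left (4 * t)) (g2.mul_left (d * 5 * q * 2))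
    exact dvdE this (by ring)
  exact (hd.mul_right (h6.mul_right hs)).dvd_of_dvd_mul_left this

/-- The case `p ∣ d`. -/
lemma local_h {p : ℕ} (hp : p.Prime) {q s t A x y B A' x' y' B' : ℤ} (hpq : (p : ℤ) ∣ q)
    (h6 : ¬ (p : ℤ) ∣ 6) (hs : ¬ (p : ℤ) ∣ s) (ht : ¬ (p : ℤ) ∣ t) (hx : ¬ (p : ℤ) ∣ x) (hy : ¬ (p : ℤ) ∣ y)
    (hd : (p : ℤ) ∣ B * y' - B' * y)
    (c0 : (p : ℤ) ^ 2 ∣ 4 * t * A * y + 6 * s * x * B + 5 * q * A * B)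
    (c1 : (p : ℤ) ^ 2 ∣ 4 * t * (A * y' + A' * y) + 6 * s * (x * B' + x' * B) + 5 * q * (A * B' + A' * B))
    (c2 : (p : ℤ) ^ 2 ∣ 4 * t * A' * y' + 6 * s * x' * B' + 5 * q * A' * B')
    (hno : ¬ ∃ l : ℤ, (p : ℤ) ∣ x' - l * x ∧ (p : ℤ) ∣ A' - l * A ∧ (p : ℤ) ∣ y' - l * y ∧ (p : ℤ) ∣ B' - l * B) :
    (p : ℤ) ^ 2 ∣ B * y' - B' * y ∧ (p : ℤ) ^ 2 ∣ A * x' - A' * x := by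
  have hpi : Prime (p : ℤ) := Nat.prime_iff_prime_int.mp hp
  obtain ⟨d, hdd⟩ : ∃ d, d = B * y' - B' * y := ⟨_, rfl⟩
  obtain ⟨f, hf⟩ : ∃ f, f = 4 * t * A * y' + 6 * s * x * B' + 5 * q * A * B' := ⟨_, rfl⟩
  obtain ⟨e1, e2, e1', e2'⟩ := local_rel hdd hf c0 c1 c2
  obtain ⟨q', rfl⟩ := hpq
  have cop : ∀ c : ℤ, ¬ (p : ℤ) ∣ c → IsCoprime (p : ℤ) c := fun c hc => (Prime.coprime_iff_not_dvd hpi).mpr hc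
  have c6 := cop _ h6
  have c2' : IsCoprime (p : ℤ) 2 := c6.of_isCoprime_of_dvd_right ⟨3, by norm_num⟩
  have c4 : IsCoprime (p : ℤ) 4 := by rw [show (4 : ℤ) = 2 ^ 2 by norm_num]; exact c2'.pow_right
  have cs := cop _ hs
  have ct := cop _ ht
  have cx := cop _ hx
  have cy := cop _ hy
  -- `d' k₁ ≡ f x`
  obtain ⟨d', hd'⟩ : ∃ d', d' = A * x' - A' * x := ⟨_, rfl⟩
  have k1 : (p : ℤ) ^ 2 ∣ d' * (5 * (p * q') * B + 4 * t * y) - f * x := by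
    have := dvd_sub (c0.mul_right x') (c1.mul_right x)
    rw [hd', hf]
    exact dvdE this (by ring)
  have uk : IsCoprime (p : ℤ) (5 * (p * q') * B + 4 * t * y) := by
    have := IsCoprime.add_mul_left_left (x := 4 * t * y) (y := (p : ℤ)) (((c4.mul_right ct).mul_right cy).symm) (5 * q' * B)
    exact (by ring : 4 * t * y + ↑p * (5 * q' * B) = 5 * (p * q') * B + 4 * t * y) ▸ this.symm
  have ug : IsCoprime (p : ℤ) (5 * (p * q') * A + 6 * s * x) := by
    have := IsCoprime.add_mul_left_left (x := 6 * s * x) (y := (p : ℤ)) (((c6.mul_right cs).mul_right cx).symm) (5 * q' * A)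
    exact (by ring : 6 * s * x + ↑p * (5 * q' * A) = 5 * (p * q') * A + 6 * s * x) ▸ this.symm
  rw [← hdd] at hd ⊢
  rw [← hd']
  have hpp : (p : ℤ) ∣ (p : ℤ) ^ 2 := dvd_pow_self _ two_ne_zero
  have pf : (p : ℤ) ∣ f := by
    have : (p : ℤ) ∣ y * f := by
      have h1 := hpp.trans e1
      have := dvd_sub h1 (hd.mul_right (5 * (p * q') * A + 6 * s * x))
      exact dvdE this (by ring)
    exact cy.dvd_of_dvd_mul_left this
  have pd' : (p : ℤ) ∣ d' := by
    have h1 := hpp.trans k1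
    have := dvd_add h1 (pf.mul_right x)
    rw [sub_add_cancel] at this
    exact uk.dvd_of_dvd_mul_right this
  have pd : (p : ℤ) ^ 2 ∣ d := by
    by_contra hcon
    obtain ⟨d1, rfl⟩ := hd
    obtain ⟨f1, rfl⟩ := pf
    have hd1 : ¬ (p : ℤ) ∣ d1 := by
      rintro ⟨c, rfl⟩
      exact hcon ⟨c, by ring⟩
    have cd := cop _ hd1
    have hp0 : (p : ℤ) ≠ 0 := hpi.ne_zero
    have i1 : (p : ℤ) ∣ d1 * (6 * s * x) + f1 * y := by
      have : (p : ℤ) * p ∣ p * (d1 * (5 * (p * q') * A + 6 * s * x) + f1 * y) := by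
        rw [← sq]; exact dvdE e1 (by ring)
      have := (mul_dvd_mul_iff_left hp0).mp this
      have := dvd_sub this (Dvd.intro (d1 * (5 * q' * A)) rfl : (p : ℤ) ∣ p * (d1 * (5 * q' * A)))
      exact dvdE this (by ring)
    have i1' : (p : ℤ) ∣ d1 * (6 * s * x') + f1 * y' := by
      have : (p : ℤ) * p ∣ p * (d1 * (5 * (p * q') * A' + 6 * s * x') + f1 * y') := by
        rw [← sq]; exact dvdE e1' (by ring)
      have := (mul_dvd_mul_iff_left hp0).mp this
      have := dvd_sub this (Dvd.intro (d1 * (5 * q' * A')) rfl : (p : ℤ) ∣ p * (d1 * (5 * q' * A')))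
      exact dvdE this (by ring)
    have hδ : (p : ℤ) ∣ x * y' - x' * y := by
      have : (p : ℤ) ∣ (d1 * (6 * s)) * (x * y' - x' * y) := by
        have := dvd_sub (i1.mul_right y') (i1'.mul_right y)
        exact dvdE this (by ring)
      exact (cd.mul_right (c6.mul_right cs)).dvd_of_dvd_mul_left this
    -- the multiplier
    obtain ⟨u, v, huv⟩ := cx
    apply hno
    refine ⟨v * x', ?_, ?_, ?_, ?_⟩
    · refine ⟨u * x', ?_⟩; linear_combination (-x') * huv
    · apply (cop _ hx).dvd_of_dvd_mul_left
      have h1 : x * (A' - v * x' * A) = p * (u * (x * A')) - v * x * d' := by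
        rw [hd']; linear_combination (-(x * A')) * huv
      rw [h1]
      exact dvd_sub (Dvd.intro _ rfl) (pd'.mul_left _)
    · have h1 : y' - v * x' * y = p * (u * y') + v * (x * y' - x' * y) := by
        linear_combination (- y') * huv
      rw [h1]
      exact dvd_add (Dvd.intro _ rfl) (hδ.mul_left _)
    · apply cy.dvd_of_dvd_mul_left
      have h2 : (p : ℤ) ∣ p * d1 := Dvd.intro _ rfl
      rw [hdd] at h2
      have h1 : y * (B' - v * x' * B) = B * (p * (u * y') + v * (x * y' - x' * y)) - (B * y' - B' * y) := by
        linear_combination (-y' * B) * huv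
      rw [h1]
      exact dvd_sub ((dvd_add (Dvd.intro _ rfl) (hδ.mul_left _)).mul_left _) h2
  refine ⟨pd, ?_⟩
  have p2f : (p : ℤ) ^ 2 ∣ f := by
    have : (p : ℤ) ^ 2 ∣ y * f := by
      have := dvd_sub e1 (pd.mul_right (5 * (p * q') * A + 6 * s * x))
      exact dvdE this (by ring)
    exact (cy.pow_left).dvd_of_dvd_mul_left this
  have := dvd_add k1 (p2f.mul_right x)
  rw [sub_add_cancel] at this
  exact (uk.pow_left).dvd_of_dvd_mul_right this

set_option linter.unusedVariables false

/-- value of the bilinear form `u` at `P = (x₁,x₂,y₁,y₂)`. -/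
def Ev (u P : Fin 4 → ℤ) : ℤ := u 0 * P 0 * P 2 + u 1 * P 0 * P 3 + u 2 * P 1 * P 2 + u 3 * P 1 * P 3

/-- The lattice of forms divisible by `q³` on the class. -/
def Dl (q s t : ℤ) : AddSubgroup (Fin 4 → ℤ) where
  carrier := {u | q ^ 3 ∣ u 0 * s * t + u 1 * s + u 2 * t + u 3 ∧
    q ^ 2 ∣ 2 * t * (u 0 * s + u 2) - 3 * s * (u 0 * t + u 1) ∧ q ∣ 4 * t * u 0 - 5 * (u 0 * t + u 1)}
  zero_mem' := by simp
  add_mem' := by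
    rintro u v ⟨h1, h2, h3⟩ ⟨g1, g2, g3⟩
    refine ⟨dvdE (dvd_add h1 g1) ?_, dvdE (dvd_add h2 g2) ?_, dvdE (dvd_add h3 g3) ?_⟩ <;>
      simp only [Pi.add_apply] <;> ring
  neg_mem' := by
    rintro u ⟨h1, h2, h3⟩
    refine ⟨dvdE (dvd_neg.mpr h1) ?_, dvdE (dvd_neg.mpr h2) ?_, dvdE (dvd_neg.mpr h3) ?_⟩ <;>
      simp only [Pi.neg_apply] <;> ring

lemma mem_Dl {q s t : ℤ} {u : Fin 4 → ℤ} : u ∈ Dl q s t ↔ (q ^ 3 ∣ u 0 * s * t + u 1 * s + u 2 * t + u 3 ∧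
    q ^ 2 ∣ 2 * t * (u 0 * s + u 2) - 3 * s * (u 0 * t + u 1) ∧ q ∣ 4 * t * u 0 - 5 * (u 0 * t + u 1)) := Iff.rfl

lemma Dl_dvd {q s t : ℤ} {u P : Fin 4 → ℤ} (hu : u ∈ Dl q s t) (h2 : IsCoprime q 2) (ht : IsCoprime q t)
    (ha : q ∣ P 0 - s * P 1) (hb : q ∣ P 2 - t * P 3)
    (hL : q ^ 3 ∣ 4 * t * (P 0 - s * P 1) * P 3 + 6 * s * P 1 * (P 2 - t * P 3) + 5 * (P 0 - s * P 1) * (P 2 - t * P 3)) :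
    q ^ 3 ∣ Ev u P := by
  obtain ⟨⟨k1, h1⟩, ⟨k2, h2'⟩, ⟨k3, h3⟩⟩ := mem_Dl.mp hu
  obtain ⟨a, ha'⟩ := ha
  obtain ⟨b, hb'⟩ := hb
  have h4 : IsCoprime q 4 := by rw [show (4 : ℤ) = 2 ^ 2 by norm_num]; exact h2.pow_right
  have : q ^ 3 ∣ (4 * t) * Ev u P := by
    have e : (4 * t) * Ev u P = (u 0 * t + u 1) * (4 * t * (P 0 - s * P 1) * P 3 + 6 * s * P 1 * (P 2 - t * P 3) + 5 * (P 0 - s * P 1) * (P 2 - t * P 3))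
      + q ^ 3 * (4 * t * P 1 * P 3 * k1 + 2 * P 1 * b * k2 + a * b * k3) := by
      have e0 : P 0 = s * P 1 + q * a := by linarith
      have e2 : P 2 = t * P 3 + q * b := by linarith
      have f1 : u 3 = q ^ 3 * k1 - (u 0 * s * t + u 1 * s + u 2 * t) := by linarith
      rw [Ev, e0, e2, f1]
      linear_combination (2 * P 1 * q * b) * h2' + (q ^ 2 * a * b) * h3
    rw [e]
    exact dvd_add (hL.mul_left _) (Dvd.intro _ rfl)
  exact ((h4.mul_right ht).pow_left).dvd_of_dvd_mul_left this

/-- forms of bounded size -/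
noncomputable def Rf (G : AddSubgroup (Fin 4 → ℤ)) (w : Fin 4 → ℤ) (ρ : ℝ) : Finset (Fin 4 → ℤ) :=
  @Finset.filter _ (fun u => u ∈ G) (Classical.decPred _) (Fintype.piFinset fun i => Finset.Icc (-⌊ρ / w i⌋) ⌊ρ / w i⌋)

lemma mem_Rf {G : AddSubgroup (Fin 4 → ℤ)} {w : Fin 4 → ℤ} (hw : ∀ i, 1 ≤ w i) {ρ : ℝ} {u : Fin 4 → ℤ} :
    u ∈ Rf G w ρ ↔ (∀ i, |(u i : ℝ)| * w i ≤ ρ) ∧ u ∈ G := by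
  classical
  rw [Rf, @Finset.mem_filter _ _ (Classical.decPred _), Fintype.mem_piFinset]
  refine and_congr_left fun _ => forall_congr' fun i => ?_
  have hwi : (0 : ℝ) < w i := by exact_mod_cast (by linarith [hw i] : 0 < w i)
  rw [Finset.mem_Icc, ← abs_le, Int.le_floor, le_div_iff₀ hwi]
  push_cast
  rfl

/-- Difference injection: fibres of a map whose fibres have differences in a set. -/
lemma fibre_diff {β : Type*} [DecidableEq β] (S R : Finset (Fin 4 → ℤ)) (f : (Fin 4 → ℤ) → β) (n : ℕ)
    (hn : (S.image f).card ≤ n)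
    (h : ∀ u ∈ S, ∀ v ∈ S, f u = f v → u - v ∈ R) : S.card ≤ R.card * n := by
  refine (Finset.card_le_mul_card_image (f := f) S R.card ?_).trans (Nat.mul_le_mul_left _ hn)
  intro b hb
  obtain ⟨v, hv, rfl⟩ := Finset.mem_image.mp hb
  apply Finset.card_le_card_of_injOn (fun u => u - v)
  · intro u hu
    have hu' := Finset.mem_filter.mp hu
    exact h u hu'.1 v hv hu'.2
  · intro u _ u' _ e
    exact sub_left_injective e

lemma Rf_lower {q : ℕ} (hq : 0 < q) (s t : ℤ) {w : Fin 4 → ℤ} (hw : ∀ i, 1 ≤ w i) {ρ : ℝ} (hρ : 0 ≤ ρ) :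
    ρ ^ 4 ≤ (Rf (Dl q s t) w ρ).card * (q : ℝ) ^ 6 * ∏ i, (w i : ℝ) := by
  classical
  have hwi : ∀ i, (0 : ℝ) < w i := fun i => by exact_mod_cast (by linarith [hw i] : 0 < w i)
  set S := Fintype.piFinset fun i => Finset.Icc (0 : ℤ) ⌊ρ / w i⌋ with hS
  have : NeZero (q ^ 3) := ⟨by positivity⟩
  have : NeZero (q ^ 2) := ⟨by positivity⟩
  have : NeZero q := ⟨by positivity⟩
  have h1 := fibre_diff S (Rf (Dl q s t) w ρ) (fun u => 
    (((u 0 * s * t + u 1 * s + u 2 * t + u 3 : ℤ) : ZMod (q ^ 3)),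
     ((2 * t * (u 0 * s + u 2) - 3 * s * (u 0 * t + u 1) : ℤ) : ZMod (q ^ 2)),
     ((4 * t * u 0 - 5 * (u 0 * t + u 1) : ℤ) : ZMod q))) (q ^ 6) (by
      refine (Finset.card_le_univ _).trans (le_of_eq ?_)
      rw [Fintype.card_prod, Fintype.card_prod, ZMod.card, ZMod.card, ZMod.card]; ring) (by
      intro u hu v hv e
      rw [Prod.mk.injEq, Prod.mk.injEq] at e
      obtain ⟨e1, e2, e3⟩ := e
      rw [ZMod.intCast_eq_intCast_iff_dvd_sub] at e1 e2 e3
      rw [hS, Fintype.mem_piFinset] at hu hv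
      rw [mem_Rf hw, mem_Dl]
      refine ⟨fun i => ?_, ?_, ?_, ?_⟩
      · have hu' := Finset.mem_Icc.mp (hu i)
        have hv' := Finset.mem_Icc.mp (hv i)
        have a1 := Int.le_floor.mp hu'.2
        have a2 := Int.le_floor.mp hv'.2
        have a3 : (0 : ℝ) ≤ u i := by exact_mod_cast hu'.1
        have a4 : (0 : ℝ) ≤ v i := by exact_mod_cast hv'.1
        rw [← le_div_iff₀ (hwi i), abs_le]
        simp only [Pi.sub_apply]; push_cast
        constructor <;> linarith
      · have h := dvd_neg.mpr e1
        push_cast at h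
        refine dvdE h ?_
        simp only [Pi.sub_apply]; ring
      · have h := dvd_neg.mpr e2
        push_cast at h
        refine dvdE h ?_
        simp only [Pi.sub_apply]; ring
      · refine dvdE (dvd_neg.mpr e3) ?_
        simp only [Pi.sub_apply]; ring)
  have h2 : ρ ^ 4 ≤ S.card * ∏ i, (w i : ℝ) := by
    rw [hS, Fintype.card_piFinset]
    push_cast
    rw [← Finset.prod_mul_distrib]
    have : ρ ^ 4 = ∏ i : Fin 4, ρ := by simp
    rw [this]
    apply Finset.prod_le_prod
    · intros; exact hρ
    · intro i _
      rw [← div_le_iff₀ (hwi i)]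
      have h0 : 0 ≤ ⌊ρ / w i⌋ := Int.floor_nonneg.mpr (by have := hwi i; positivity)
      have : ((Finset.Icc (0 : ℤ) ⌊ρ / w i⌋).card : ℤ) = ⌊ρ / w i⌋ + 1 := by
        rw [Int.card_Icc, Int.toNat_of_nonneg (by omega)]; ring
      have h3 : ((Finset.Icc (0 : ℤ) ⌊ρ / w i⌋).card : ℝ) = (⌊ρ / w i⌋ : ℝ) + 1 := by exact_mod_cast this
      rw [h3]
      exact (Int.lt_floor_add_one _).le
  have h3 : (S.card : ℝ) ≤ (Rf (Dl q s t) w ρ).card * (q : ℝ) ^ 6 := by exact_mod_cast h1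
  refine h2.trans ?_
  gcongr
  exact Finset.prod_nonneg fun i _ => (hwi i).le

lemma Rf_double (G : AddSubgroup (Fin 4 → ℤ)) {w : Fin 4 → ℤ} (hw : ∀ i, 1 ≤ w i) {ρ : ℝ} (hρ : 0 < ρ) :
    (Rf G w (4 * ρ)).card ≤ (Rf G w ρ).card * 9 ^ 4 := by
  classical
  have hwi : ∀ i, (0 : ℝ) < w i := fun i => by exact_mod_cast (by linarith [hw i] : 0 < w i)
  apply fibre_diff _ _ (fun u => fun i : Fin 4 => ⌊(u i : ℝ) * w i / ρ⌋)
  · have : ((Rf G w (4 * ρ)).image (fun u => fun i : Fin 4 => ⌊(u i : ℝ) * w i / ρ⌋)) ⊆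
        Fintype.piFinset fun _ : Fin 4 => Finset.Icc (-4 : ℤ) 4 := by
      intro k hk
      obtain ⟨u, hu, rfl⟩ := Finset.mem_image.mp hk
      rw [Fintype.mem_piFinset]
      intro i
      have h1 := ((mem_Rf hw).mp hu).1 i
      have h2 : |(u i : ℝ) * w i| ≤ 4 * ρ := by rw [abs_mul, abs_of_pos (hwi i)]; exact h1
      have h3 := abs_le.mp h2
      rw [Finset.mem_Icc]
      constructor
      · rw [Int.le_floor, le_div_iff₀ hρ]; push_cast; linarith
      · have : ⌊(u i : ℝ) * w i / ρ⌋ < 5 := by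
          rw [Int.floor_lt, div_lt_iff₀ hρ]; push_cast; linarith
        omega
    refine (Finset.card_le_card this).trans ?_
    rw [Fintype.card_piFinset]; simp
  · intro u hu v hv e
    rw [mem_Rf hw] at hu hv ⊢
    refine ⟨fun i => ?_, G.sub_mem hu.2 hv.2⟩
    have h1 := Int.abs_sub_lt_one_of_floor_eq_floor (congrFun e i)
    rw [← sub_div, abs_div, abs_of_pos hρ, div_lt_one hρ, ← sub_mul, abs_mul, abs_of_pos (hwi i)] at h1
    simp only [Pi.sub_apply]; push_cast; exact h1.le

lemma Rf_inj {q : ℕ} (hq : 0 < q) {s t : ℤ} {w : Fin 4 → ℤ} (hw : ∀ i, 1 ≤ w i) {ρ : ℝ} (hρ : 0 ≤ ρ) (P : Fin 4 → ℤ)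
    (hd : ∀ u ∈ Dl q s t, (q : ℤ) ^ 3 ∣ Ev u P)
    (hE : ∀ u, (∀ i, |(u i : ℝ)| * w i ≤ ρ) → |(Ev u P : ℝ)| ≤ 16 * ρ)
    (hP : ∀ u ∈ Dl q s t, u ≠ 0 → (∀ i, |(u i : ℝ)| * w i ≤ 2 * ρ) → Ev u P ≠ 0) :
    ((Rf (Dl q s t) w ρ).card : ℝ) ≤ 32 * ρ / (q : ℝ) ^ 3 + 1 := by
  classical
  have hq3 : (0 : ℝ) < (q : ℝ) ^ 3 := by positivity
  choose! k hk using hd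
  have hcard : (Rf (Dl q s t) w ρ).card ≤ (Finset.Icc (-⌊16 * ρ / (q : ℝ) ^ 3⌋) ⌊16 * ρ / (q : ℝ) ^ 3⌋).card := by
    apply Finset.card_le_card_of_injOn k
    · intro u hu
      obtain ⟨h1, h2⟩ := (mem_Rf hw).mp hu
      have h3 := hE u h1
      rw [hk u h2] at h3
      push_cast at h3
      rw [abs_mul, abs_of_pos hq3] at h3
      rw [Finset.coe_Icc, Set.mem_Icc, ← abs_le, Int.le_floor, le_div_iff₀ hq3]
      push_cast; linarith
    · intro u hu v hv e
      obtain ⟨h1, h2⟩ := (mem_Rf hw).mp hu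
      obtain ⟨g1, g2⟩ := (mem_Rf hw).mp hv
      by_contra hne
      apply hP (u - v) ((Dl q s t).sub_mem h2 g2) (sub_ne_zero.mpr hne)
      · intro i
        have hwi : (0 : ℝ) < w i := by exact_mod_cast (by linarith [hw i] : 0 < w i)
        simp only [Pi.sub_apply]; push_cast
        calc |(u i : ℝ) - v i| * w i ≤ (|(u i : ℝ)| + |(v i : ℝ)|) * w i := by gcongr; exact abs_sub _ _
          _ ≤ 2 * ρ := by linarith [h1 i, g1 i]
      · have : Ev (u - v) P = Ev u P - Ev v P := by simp only [Ev, Pi.sub_apply]; ring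
        rw [this, hk u h2, hk v g2, e, sub_self]
  have h0 : 0 ≤ ⌊16 * ρ / (q : ℝ) ^ 3⌋ := Int.floor_nonneg.mpr (by positivity)
  have : ((Rf (Dl q s t) w ρ).card : ℤ) ≤ 2 * ⌊16 * ρ / (q : ℝ) ^ 3⌋ + 1 := by
    calc ((Rf (Dl q s t) w ρ).card : ℤ) ≤ ((Finset.Icc (-⌊16 * ρ / (q : ℝ) ^ 3⌋) ⌊16 * ρ / (q : ℝ) ^ 3⌋).card : ℤ) := by exact_mod_cast hcard
      _ = _ := by rw [Int.card_Icc, Int.toNat_of_nonneg (by omega)]; ring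
  have h4 : ((Rf (Dl q s t) w ρ).card : ℝ) ≤ 2 * (⌊16 * ρ / (q : ℝ) ^ 3⌋ : ℝ) + 1 := by exact_mod_cast this
  have h5 := Int.floor_le (16 * ρ / (q : ℝ) ^ 3)
  have : 32 * ρ / (q : ℝ) ^ 3 = 2 * (16 * ρ / (q : ℝ) ^ 3) := by ring
  linarith

/-- size of a form -/
def nz (w u : Fin 4 → ℤ) : ℕ := Finset.univ.sup fun i => (u i * w i).natAbs

lemma nz_le {w u : Fin 4 → ℤ} (hw : ∀ i, 1 ≤ w i) {n : ℕ} : nz w u ≤ n ↔ ∀ i, |(u i : ℝ)| * w i ≤ n := by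
  rw [nz, Finset.sup_le_iff]
  simp only [Finset.mem_univ, true_implies]
  refine forall_congr' fun i => ?_
  have h : (((u i * w i).natAbs : ℕ) : ℝ) = |(u i : ℝ)| * w i := by
    rw [Nat.cast_natAbs, abs_mul, abs_of_pos (by linarith [hw i] : 0 < w i)]; push_cast; rfl
  rw [← h]; exact_mod_cast Iff.rfl

lemma le_nz {w u : Fin 4 → ℤ} (hw : ∀ i, 1 ≤ w i) (i : Fin 4) : |(u i : ℝ)| * w i ≤ nz w u := (nz_le hw).mp le_rfl i

lemma nz_pos {w u : Fin 4 → ℤ} (hw : ∀ i, 1 ≤ w i) (hu : u ≠ 0) : 1 ≤ nz w u := by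
  by_contra h
  have h0 : nz w u ≤ 0 := by omega
  rw [nz_le hw] at h0
  apply hu
  funext i
  have h1 := h0 i
  have hwi : (0 : ℝ) < w i := by exact_mod_cast (by linarith [hw i] : 0 < w i)
  have h2 : |(u i : ℝ)| ≤ 0 := by
    by_contra h3; push Not at h3
    have := mul_pos h3 hwi
    push_cast at h1; linarith
  have := abs_nonpos_iff.mp h2
  simpa using this

/-- `u` is a minimal form of `G` killing `P`. -/
structure MinF (G : AddSubgroup (Fin 4 → ℤ)) (w P u : Fin 4 → ℤ) : Prop where
  mem : u ∈ G
  ne : u ≠ 0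
  ev : Ev u P = 0
  min : ∀ v ∈ G, v ≠ 0 → Ev v P = 0 → nz w u ≤ nz w v

lemma exists_min (G : AddSubgroup (Fin 4 → ℤ)) (w P : Fin 4 → ℤ) (h : ∃ v ∈ G, v ≠ 0 ∧ Ev v P = 0) :
    ∃ u, MinF G w P u := by
  classical
  have hex : ∃ n : ℕ, ∃ v ∈ G, v ≠ 0 ∧ Ev v P = 0 ∧ nz w v = n := by
    obtain ⟨v, h1, h2, h3⟩ := h
    exact ⟨_, v, h1, h2, h3, rfl⟩
  obtain ⟨u, h1, h2, h3, h4⟩ := Nat.find_spec hex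
  refine ⟨u, h1, h2, h3, fun v g1 g2 g3 => ?_⟩
  rw [h4]
  exact Nat.find_min' hex ⟨v, g1, g2, g3, rfl⟩

lemma min_count {q : ℕ} (hq : 0 < q) {s t : ℤ} {w P u : Fin 4 → ℤ} (hw : ∀ i, 1 ≤ w i)
    (hd : ∀ u ∈ Dl q s t, (q : ℤ) ^ 3 ∣ Ev u P)
    (hE : ∀ (ρ : ℝ) u, (∀ i, |(u i : ℝ)| * w i ≤ ρ) → |(Ev u P : ℝ)| ≤ 16 * ρ)
    (hm : MinF (Dl q s t) w P u) :
    ((Rf (Dl q s t) w (nz w u)).card : ℝ) ≤ 9 ^ 4 * (8 * nz w u / (q : ℝ) ^ 3 + 1) ∧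
    (nz w u : ℝ) ^ 4 ≤ 256 * (8 * nz w u / (q : ℝ) ^ 3 + 1) * (q : ℝ) ^ 6 * ∏ i, (w i : ℝ) := by
  have hn := nz_pos hw hm.ne
  have hn' : (1 : ℝ) ≤ nz w u := by exact_mod_cast hn
  set n : ℝ := (nz w u : ℝ) with hnn
  have h1 := Rf_inj (ρ := n / 4) hq hw (by positivity) P hd (hE _) (by
    intro v hv hv0 hb hev
    have h2 := hm.min v hv hv0 hev
    have h3 : (nz w v : ℝ) ≤ n / 2 := by
      have : nz w v ≤ ⌊n / 2⌋₊ := by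
        rw [nz_le hw]
        intro i
        have h4 : |(v i : ℝ)| * w i = ((|v i| * w i : ℤ) : ℝ) := by push_cast; ring
        have h5 := hb i
        have h0 : 0 ≤ |v i| * w i := mul_nonneg (abs_nonneg _) (by linarith [hw i])
        obtain ⟨k, hk⟩ := Int.eq_ofNat_of_zero_le h0
        rw [h4, hk] at h5 ⊢
        have : k ≤ ⌊n / 2⌋₊ := by
          apply Nat.le_floor
          push_cast at h5; linarith
        exact_mod_cast this
      exact (Nat.cast_le.mpr this).trans (Nat.floor_le (by positivity))
    have h4 : n ≤ (nz w v : ℝ) := by rw [hnn]; exact_mod_cast h2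
    linarith)
  have h2 := Rf_double (Dl q s t) hw (ρ := n / 4) (by positivity)
  have h3 := Rf_lower hq s t hw (ρ := n / 4) (by positivity)
  rw [show 4 * (n / 4) = n by ring] at h2
  rw [show 32 * (n / 4) = 8 * n by ring] at h1
  have hwp : 0 ≤ ∏ i, (w i : ℝ) := Finset.prod_nonneg fun i _ => by exact_mod_cast (by linarith [hw i] : 0 ≤ w i)
  constructor
  · have h4 : ((Rf (Dl q s t) w n).card : ℝ) ≤ (Rf (Dl q s t) w (n / 4)).card * 9 ^ 4 := by exact_mod_cast h2
    linarith
  · have h5 : (n / 4) ^ 4 ≤ (8 * n / (q : ℝ) ^ 3 + 1) * (q : ℝ) ^ 6 * ∏ i, (w i : ℝ) := by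
      refine h3.trans ?_
      gcongr
    have : n ^ 4 = 256 * (n / 4) ^ 4 := by ring
    rw [this]
    linarith

set_option linter.unusedVariables false

/-- projective colour -/
noncomputable def pcol (p : ℕ) (m n : ℤ) : ℕ := by
  classical exact if (p : ℤ) ∣ n then p else ratio p m n

lemma ratio_lt {p : ℕ} (hp : p.Prime) (m n : ℤ) : ratio p m n < p := by
  have := Fact.mk hp
  exact ZMod.val_lt _

lemma pcol_eq_iff {p : ℕ} (hp : p.Prime) {m n m' n' : ℤ} (h : ¬ ((p : ℤ) ∣ m ∧ (p : ℤ) ∣ n))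
    (h' : ¬ ((p : ℤ) ∣ m' ∧ (p : ℤ) ∣ n')) : pcol p m n = pcol p m' n' ↔ (p : ℤ) ∣ m * n' - m' * n := by
  have hpi : Prime (p : ℤ) := Nat.prime_iff_prime_int.mp hp
  have := Fact.mk hp
  unfold pcol
  by_cases h1 : (p : ℤ) ∣ n <;> by_cases h2 : (p : ℤ) ∣ n'
  · rw [if_pos h1, if_pos h2]
    exact ⟨fun _ => dvd_sub (h2.mul_left _) (h1.mul_left _), fun _ => rfl⟩
  · rw [if_pos h1, if_neg h2]
    constructor
    · intro e; have := ratio_lt hp m' n'; omega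
    · intro e
      have : (p : ℤ) ∣ m * n' := by
        have := dvd_add e (h1.mul_left m'); rwa [sub_add_cancel] at this
      rcases hpi.dvd_or_dvd this with h3 | h3
      · exact absurd ⟨h3, h1⟩ h
      · exact absurd h3 h2
  · rw [if_neg h1, if_pos h2]
    constructor
    · intro e; have := ratio_lt hp m n; omega
    · intro e
      have : (p : ℤ) ∣ m' * n := by
        have := dvd_sub (h2.mul_left m) e; rwa [sub_sub_cancel] at this
      rcases hpi.dvd_or_dvd this with h3 | h3
      · exact absurd ⟨h3, h2⟩ h'
      · exact absurd h3 h1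
  · rw [if_neg h1, if_neg h2]
    refine ⟨ratio_eq hp h1 h2, fun e => ?_⟩
    have e1 : (n : ZMod p) ≠ 0 := fun h => h1 ((ZMod.intCast_zmod_eq_zero_iff_dvd _ _).mp h)
    have e2 : (n' : ZMod p) ≠ 0 := fun h => h2 ((ZMod.intCast_zmod_eq_zero_iff_dvd _ _).mp h)
    unfold ratio
    congr 1
    rw [← div_eq_mul_inv, ← div_eq_mul_inv, div_eq_div_iff e1 e2]
    rw [← ZMod.intCast_zmod_eq_zero_iff_dvd] at e
    push_cast at e
    exact sub_eq_zero.mp e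

lemma six_points {α : Type*} [DecidableEq α] (T : Finset α) (col : α → ℕ) (h : 6 ≤ (T.image col).card) :
    ∃ g : Fin 6 → α, (∀ i, g i ∈ T) ∧ ∀ i l, i ≠ l → col (g i) ≠ col (g l) := by
  obtain ⟨U, hU, hc⟩ := Finset.exists_subset_card_eq h
  have hex : ∀ i : Fin 6, ∃ a ∈ T, col a = ((U.equivFinOfCardEq hc).symm i : ℕ) := by
    intro i
    have := hU ((U.equivFinOfCardEq hc).symm i).2
    simpa using this
  choose g hg hgc using hex
  refine ⟨g, hg, fun i l hil e => hil ?_⟩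
  rw [hgc, hgc] at e
  exact (U.equivFinOfCardEq hc).symm.injective (Subtype.ext e)

/-- basis of a rank two lattice -/
lemma lat_basis (Γ : AddSubgroup (Fin 4 → ℤ)) (p : Fin 4 → ℤ) (hp : p ∈ Γ) (hc : IsCoprime (p 2) (p 3))
    (hinj : ∀ w ∈ Γ, w 2 = 0 → w 3 = 0 → w = 0) (hex : ∃ w ∈ Γ, p 2 * w 3 - w 2 * p 3 ≠ 0) :
    ∃ r ∈ Γ, 0 < p 2 * r 3 - r 2 * p 3 ∧ ∀ w ∈ Γ, ∃ m n : ℤ, w = m • p + n • r := by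
  classical
  have hex' : ∃ k : ℕ, 0 < k ∧ ∃ w ∈ Γ, p 2 * w 3 - w 2 * p 3 = k := by
    obtain ⟨w, hw, h0⟩ := hex
    rcases lt_or_gt_of_ne h0 with h | h
    · refine ⟨(p 2 * w 3 - w 2 * p 3).natAbs, by omega, -w, Γ.neg_mem hw, ?_⟩
      simp only [Pi.neg_apply]
      rw [Int.natCast_natAbs, abs_of_neg h]; ring
    · refine ⟨(p 2 * w 3 - w 2 * p 3).natAbs, by omega, w, hw, ?_⟩
      rw [Int.natCast_natAbs, abs_of_pos h]
  obtain ⟨hk0, r, hr, hrk⟩ := Nat.find_spec hex'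
  set k := Nat.find hex' with hk
  have hmin : ∀ j : ℕ, 0 < j → (∃ w ∈ Γ, p 2 * w 3 - w 2 * p 3 = j) → k ≤ j := fun j h1 h2 =>
    Nat.find_min' hex' ⟨h1, h2⟩
  refine ⟨r, hr, by rw [hrk]; exact_mod_cast hk0, fun w hw => ?_⟩
  set b := p 2 * w 3 - w 2 * p 3 with hb
  set n := b / (k : ℤ) with hn
  have hkz : (0 : ℤ) < k := by exact_mod_cast hk0
  set w' := w - n • r with hw'
  have hw'Γ : w' ∈ Γ := Γ.sub_mem hw (Γ.zsmul_mem hr n)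
  have hbr : p 2 * w' 3 - w' 2 * p 3 = b % k := by
    have := Int.mul_ediv_add_emod b k
    simp only [hw', Pi.sub_apply, Pi.smul_apply, smul_eq_mul]
    have e : p 2 * (w 3 - n * r 3) - (w 2 - n * r 2) * p 3 = b - n * k := by rw [← hrk, hb]; ring
    rw [e, hn]; linarith
  have hz : b % k = 0 := by
    by_contra hne
    have h1 := Int.emod_nonneg b hkz.ne'
    have h2 := Int.emod_lt_of_pos b hkz
    have := hmin (b % k).natAbs (by omega) ⟨w', hw'Γ, by rw [hbr, Int.natCast_natAbs, abs_of_nonneg h1]⟩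
    omega
  rw [hz] at hbr
  obtain ⟨x, y, hxy⟩ := hc
  set m := x * w' 2 + y * w' 3 with hm
  refine ⟨m, n, ?_⟩
  have h0 : w' - m • p = 0 := by
    apply hinj _ (Γ.sub_mem hw'Γ (Γ.zsmul_mem hp m))
    · simp only [Pi.sub_apply, Pi.smul_apply, smul_eq_mul]
      rw [hm]; linear_combination (-(w' 2)) * hxy - y * hbr
    · simp only [Pi.sub_apply, Pi.smul_apply, smul_eq_mul]
      rw [hm]; linear_combination (-(w' 3)) * hxy + x * hbr
  have : w = (w' - m • p) + m • p + n • r := by rw [hw']; abel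
  rw [this, h0, zero_add]

/-- the `L`-form of a vector -/
def Lq (s t : ℤ) (P : Fin 4 → ℤ) : ℤ :=
  4 * t * (P 0 - s * P 1) * P 3 + 6 * s * P 1 * (P 2 - t * P 3) + 5 * (P 0 - s * P 1) * (P 2 - t * P 3)

lemma cgood {p0 q : ℕ} (hp : p0.Prime) (hpq : p0 ∣ q) (hq : 0 < q) {s t : ℤ} {p r : Fin 4 → ℤ} {A A' B B' : ℤ}
    (hA : p 0 = s * p 1 + q * A) (hB : p 2 = t * p 3 + q * B)
    (hA' : r 0 = s * r 1 + q * A') (hB' : r 2 = t * r 3 + q * B')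
    (m n : Fin 3 → ℤ) (hL : ∀ i, (q : ℤ) ^ 3 ∣ Lq s t (m i • p + n i • r))
    (hj : ∀ i l, i ≠ l → ¬ (p0 : ℤ) ∣ m i * n l - m l * n i) :
    (p0 : ℤ) ^ 2 ∣ 4 * t * A * p 3 + 6 * s * p 1 * B + 5 * q * A * B ∧
    (p0 : ℤ) ^ 2 ∣ 4 * t * (A * r 3 + A' * p 3) + 6 * s * (p 1 * B' + r 1 * B) + 5 * q * (A * B' + A' * B) ∧
    (p0 : ℤ) ^ 2 ∣ 4 * t * A' * r 3 + 6 * s * r 1 * B' + 5 * q * A' * B' := by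
  have hqz : (q : ℤ) ≠ 0 := by exact_mod_cast hq.ne'
  have h := VM (s := 2) hp (![4 * t * A' * r 3 + 6 * s * r 1 * B' + 5 * q * A' * B',
    4 * t * (A * r 3 + A' * p 3) + 6 * s * (p 1 * B' + r 1 * B) + 5 * q * (A * B' + A' * B),
    4 * t * A * p 3 + 6 * s * p 1 * B + 5 * q * A * B]) m n (by
      intro i
      rw [Fin.sum_univ_three]
      have h1 := hL i
      have e : Lq s t (m i • p + n i • r) = q * (m i ^ 2 * (4 * t * A * p 3 + 6 * s * p 1 * B + 5 * q * A * B)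
         + m i * n i * (4 * t * (A * r 3 + A' * p 3) + 6 * s * (p 1 * B' + r 1 * B) + 5 * q * (A * B' + A' * B))
         + n i ^ 2 * (4 * t * A' * r 3 + 6 * s * r 1 * B' + 5 * q * A' * B')) := by
        simp only [Lq, Pi.add_apply, Pi.smul_apply, smul_eq_mul, hA, hB, hA', hB']; ring
      rw [e, pow_succ', mul_dvd_mul_iff_left hqz] at h1
      have h2 : (p0 : ℤ) ^ 2 ∣ (q : ℤ) ^ 2 := pow_dvd_pow_of_dvd (by exact_mod_cast hpq) 2
      refine dvdE (h2.trans h1) ?_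
      simp [Fin.rev]
      ring) hj
  exact ⟨h 2, h 1, h 0⟩

/-- the quintic -/
def fq (a1 a2 : ℤ) (P : Fin 4 → ℤ) : ℤ := a1 * P 0 ^ 2 * P 2 ^ 3 + a2 * P 1 ^ 2 * P 3 ^ 3

lemma quint (x x' y y' m n : ℤ) : (m * x + n * x') ^ 2 * (m * y + n * y') ^ 3 =
    n ^ 5 * (x' ^ 2 * y' ^ 3) + m * n ^ 4 * (2 * x * x' * y' ^ 3 + 3 * x' ^ 2 * y * y' ^ 2)
    + m ^ 2 * n ^ 3 * (x ^ 2 * y' ^ 3 + 6 * x * x' * y * y' ^ 2 + 3 * x' ^ 2 * y ^ 2 * y')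
    + m ^ 3 * n ^ 2 * (3 * x ^ 2 * y * y' ^ 2 + 6 * x * x' * y ^ 2 * y' + x' ^ 2 * y ^ 3)
    + m ^ 4 * n * (3 * x ^ 2 * y ^ 2 * y' + 2 * x * x' * y ^ 3) + m ^ 5 * (x ^ 2 * y ^ 3) := by ring

/-- coefficients of the quintic along a plane -/
def fc (a1 a2 : ℤ) (p r : Fin 4 → ℤ) : Fin 6 → ℤ :=
  ![a1 * (r 0 ^ 2 * r 2 ^ 3) + a2 * (r 1 ^ 2 * r 3 ^ 3),
    a1 * (2 * p 0 * r 0 * r 2 ^ 3 + 3 * r 0 ^ 2 * p 2 * r 2 ^ 2) + a2 * (2 * p 1 * r 1 * r 3 ^ 3 + 3 * r 1 ^ 2 * p 3 * r 3 ^ 2),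
    a1 * (p 0 ^ 2 * r 2 ^ 3 + 6 * p 0 * r 0 * p 2 * r 2 ^ 2 + 3 * r 0 ^ 2 * p 2 ^ 2 * r 2) +
      a2 * (p 1 ^ 2 * r 3 ^ 3 + 6 * p 1 * r 1 * p 3 * r 3 ^ 2 + 3 * r 1 ^ 2 * p 3 ^ 2 * r 3),
    a1 * (3 * p 0 ^ 2 * p 2 * r 2 ^ 2 + 6 * p 0 * r 0 * p 2 ^ 2 * r 2 + r 0 ^ 2 * p 2 ^ 3) +
      a2 * (3 * p 1 ^ 2 * p 3 * r 3 ^ 2 + 6 * p 1 * r 1 * p 3 ^ 2 * r 3 + r 1 ^ 2 * p 3 ^ 3),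
    a1 * (3 * p 0 ^ 2 * p 2 ^ 2 * r 2 + 2 * p 0 * r 0 * p 2 ^ 3) + a2 * (3 * p 1 ^ 2 * p 3 ^ 2 * r 3 + 2 * p 1 * r 1 * p 3 ^ 3),
    a1 * (p 0 ^ 2 * p 2 ^ 3) + a2 * (p 1 ^ 2 * p 3 ^ 3)]

lemma fq_eq (a1 a2 : ℤ) (p r : Fin 4 → ℤ) (m n : ℤ) :
    fq a1 a2 (m • p + n • r) = ∑ j : Fin 6, (m ^ (j : ℕ) * n ^ (j.rev : ℕ)) * fc a1 a2 p r j := by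
  have e : fq a1 a2 (m • p + n • r) = a1 * ((m * p 0 + n * r 0) ^ 2 * (m * p 2 + n * r 2) ^ 3) +
      a2 * ((m * p 1 + n * r 1) ^ 2 * (m * p 3 + n * r 3) ^ 3) := by
    simp only [fq, Pi.add_apply, Pi.smul_apply, smul_eq_mul]; ring
  rw [e, quint, quint, Fin.sum_univ_six]
  simp only [fc, Fin.rev]
  simp
  ring

lemma fgood {p0 : ℕ} (hp : p0.Prime) {a1 a2 : ℤ} {p r : Fin 4 → ℤ} (m n : Fin 6 → ℤ)
    (hf : ∀ i, (p0 : ℤ) ^ 3 ∣ fq a1 a2 (m i • p + n i • r))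
    (hj : ∀ i l, i ≠ l → ¬ (p0 : ℤ) ∣ m i * n l - m l * n i) (M N : ℤ) :
    (p0 : ℤ) ^ 3 ∣ fq a1 a2 (M • p + N • r) := by
  have h := VM (s := 3) hp (fc a1 a2 p r) m n (by intro i; rw [← fq_eq]; exact hf i) hj
  rw [fq_eq]
  exact Finset.dvd_sum fun j _ => (h j).mul_left _

/-- A quintic vanishing at six points of a line vanishes on the plane. -/
lemma fvanish {a1 a2 : ℤ} {p r : Fin 4 → ℤ} (h : ∀ k : Fin 6, fq a1 a2 (p + ((k : ℕ) : ℤ) • r) = 0) (M N : ℤ) :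
    fq a1 a2 (M • p + N • r) = 0 := by
  -- use a large prime
  obtain ⟨P, hP, hpr⟩ := Nat.exists_infinite_primes ((fq a1 a2 (M • p + N • r)).natAbs + 7)
  have h1 := fgood hpr (a1 := a1) (a2 := a2) (p := p) (r := r) (fun _ => 1) (fun k : Fin 6 => ((k : ℕ) : ℤ)) (by
    intro i; rw [one_smul, h i]; exact dvd_zero _) (by
    intro i l hil hd
    have h2 : ((l : ℕ) : ℤ) - ((i : ℕ) : ℤ) = 0 := by
      apply Int.eq_zero_of_abs_lt_dvd (m := (P : ℤ)) (by simpa using hd)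
      have := i.2; have := l.2
      rw [abs_lt]; constructor <;> omega
    apply hil; apply Fin.ext; omega) M N
  apply Int.eq_zero_of_abs_lt_dvd h1
  have h3 : (P : ℤ) ≤ (P : ℤ) ^ 3 := by
    apply le_self_pow₀ _ (by norm_num)
    have := hpr.one_lt; omega
  have : |fq a1 a2 (M • p + N • r)| < P := by rw [Int.abs_eq_natAbs]; omega
  linarith

/-- minors -/
def mn (p r : Fin 4 → ℤ) (i k : Fin 4) : ℤ := p i * r k - r i * p k

lemma Asharp {q : ℕ} {Pr : Finset ℕ} (hqP : q = ∏ p ∈ Pr, p) (hpr : ∀ p ∈ Pr, p.Prime) {s t : ℤ}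
    (hq0 : 0 < q)
    (h6 : ∀ p ∈ Pr, ¬ (p : ℤ) ∣ 6) (hs : ∀ p ∈ Pr, ¬ (p : ℤ) ∣ s) (ht : ∀ p ∈ Pr, ¬ (p : ℤ) ∣ t)
    {p r : Fin 4 → ℤ} {A A' B B' : ℤ}
    (hA : p 0 = s * p 1 + q * A) (hB : p 2 = t * p 3 + q * B)
    (hA' : r 0 = s * r 1 + q * A') (hB' : r 2 = t * r 3 + q * B') (z : ℤ)
    (hz : ∀ p0 ∈ Pr, (p0 : ℤ) ∣ z ∨ (¬ (p0 : ℤ) ∣ B * r 3 - B' * p 3 ∧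
      (p0 : ℤ) ^ 2 ∣ 4 * t * A * p 3 + 6 * s * p 1 * B + 5 * q * A * B ∧
      (p0 : ℤ) ^ 2 ∣ 4 * t * (A * r 3 + A' * p 3) + 6 * s * (p 1 * B' + r 1 * B) + 5 * q * (A * B' + A' * B) ∧
      (p0 : ℤ) ^ 2 ∣ 4 * t * A' * r 3 + 6 * s * r 1 * B' + 5 * q * A' * B')) :
    ∃ v ∈ Dl q s t, ((q : ℤ) * v 0 = z ^ 2 * mn p r 1 3) ∧ ((q : ℤ) * v 1 = - (z ^ 2 * mn p r 1 2)) ∧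
      ((q : ℤ) * v 2 = - (z ^ 2 * mn p r 0 3)) ∧ ((q : ℤ) * v 3 = z ^ 2 * mn p r 0 2) := by
  have hqz : (q : ℤ) ≠ 0 := by exact_mod_cast hq0.ne'
  have key : ∀ N : ℤ, (∀ p0 ∈ Pr, (p0 : ℤ) ∣ z ∨ (p0 : ℤ) ^ 2 ∣ N) → (q : ℤ) ^ 2 ∣ z ^ 2 * N := by
    intro N hN
    rw [hqP]
    apply prod_pow_dvd_of_primes Pr hpr
    intro p0 hp0
    rcases hN p0 hp0 with h | h
    · exact (pow_dvd_pow_of_dvd h 2).mul_right _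
    · exact h.mul_left _
  have loc : ∀ p0 ∈ Pr, (p0 : ℤ) ∣ z ∨ ((p0 : ℤ) ^ 2 ∣ A * B' - A' * B ∧ 
      (p0 : ℤ) ^ 2 ∣ 2 * t * (A * r 3 - A' * p 3) - 3 * s * (p 1 * B' - r 1 * B) ∧
      (p0 : ℤ) ^ 2 ∣ 4 * t * (p 1 * r 3 - r 1 * p 3) + 5 * q * (p 1 * B' - r 1 * B)) := by
    intro p0 hp0
    rcases hz p0 hp0 with h | ⟨hd, c0, c1, c2⟩
    · exact Or.inl h
    right
    have hpi : Prime (p0 : ℤ) := Nat.prime_iff_prime_int.mp (hpr p0 hp0)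
    have cop : ∀ c : ℤ, ¬ (p0 : ℤ) ∣ c → IsCoprime ((p0 : ℤ) ^ 2) c := fun c hc => ((Prime.coprime_iff_not_dvd hpi).mpr hc).pow_left
    exact local_A (cop _ hd) (cop _ (h6 p0 hp0)) (cop _ (hs p0 hp0)) (cop _ (ht p0 hp0)) c0 c1 c2
  obtain ⟨k1, K1⟩ := key _ (fun p0 hp0 => (loc p0 hp0).imp id fun h => h.1)
  obtain ⟨k2, K2⟩ := key _ (fun p0 hp0 => (loc p0 hp0).imp id fun h => h.2.1)
  obtain ⟨k3, K3⟩ := key _ (fun p0 hp0 => (loc p0 hp0).imp id fun h => h.2.2)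
  -- divisibility of `z² δ`
  have hcop : IsCoprime (q : ℤ) (4 * t) := by
    rw [hqP]; push_cast
    apply IsCoprime.prod_left
    intro p0 hp0
    have hpi : Prime (p0 : ℤ) := Nat.prime_iff_prime_int.mp (hpr p0 hp0)
    apply IsCoprime.mul_right
    · rw [Prime.coprime_iff_not_dvd hpi]
      intro h
      have : (p0 : ℤ) ∣ 2 ^ 2 := by norm_num; exact h
      exact h6 p0 hp0 ((hpi.dvd_of_dvd_pow this).trans ⟨3, by norm_num⟩)
    · exact (Prime.coprime_iff_not_dvd hpi).mpr (ht p0 hp0)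
  obtain ⟨v0, hv0⟩ : (q : ℤ) ∣ z ^ 2 * (p 1 * r 3 - r 1 * p 3) := by
    apply hcop.dvd_of_dvd_mul_left
    refine ⟨q * k3 - 5 * z ^ 2 * (p 1 * B' - r 1 * B), ?_⟩
    linear_combination K3
  refine ⟨![v0, -(t * v0 + z ^ 2 * (p 1 * B' - r 1 * B)), -(s * v0 + z ^ 2 * (A * r 3 - A' * p 3)),
    s * t * v0 + s * z ^ 2 * (p 1 * B' - r 1 * B) + t * z ^ 2 * (A * r 3 - A' * p 3) + q * z ^ 2 * (A * B' - A' * B)], ?_, ?_, ?_, ?_, ?_⟩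
  · rw [mem_Dl]
    refine ⟨⟨k1, ?_⟩, ⟨-k2, ?_⟩, ⟨k3, ?_⟩⟩
    · simp; linear_combination q * K1
    · simp; linear_combination -K2
    · simp
      apply mul_left_cancel₀ hqz
      linear_combination K3 - 4 * t * hv0
  · simp [mn]; linear_combination -hv0
  · simp [mn, hB, hB']; linear_combination t * hv0
  · simp [mn, hA, hA']; linear_combination s * hv0
  · simp [mn, hA, hA', hB, hB']; linear_combination -s * t * hv0

set_option linter.unusedVariables false

/-- A class of points modulo `q`. Coordinates `(x₁, x₂, y₁, y₂)`. -/
structure Cls (q : ℕ) (Pr : Finset ℕ) (s t a1 a2 : ℤ) (Z : Fin 4 → ℤ) (S : Finset (Fin 4 → ℤ)) : Prop where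
  qP : q = ∏ p ∈ Pr, p
  prime : ∀ p ∈ Pr, p.Prime
  n6 : ∀ p ∈ Pr, ¬ (p : ℤ) ∣ 6
  us : ∀ p ∈ Pr, ¬ (p : ℤ) ∣ s
  ut : ∀ p ∈ Pr, ¬ (p : ℤ) ∣ t
  Z1 : ∀ i, 1 ≤ Z i
  lo : ∀ P ∈ S, ∀ i, Z i ≤ P i
  hi : ∀ P ∈ S, ∀ i, P i < 2 * Z i
  copx : ∀ P ∈ S, IsCoprime (P 0) (P 1)
  copy : ∀ P ∈ S, IsCoprime (P 2) (P 3)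
  unit : ∀ P ∈ S, ∀ p ∈ Pr, ∀ i, ¬ (p : ℤ) ∣ P i
  ax : ∀ P ∈ S, (q : ℤ) ∣ P 0 - s * P 1
  ay : ∀ P ∈ S, (q : ℤ) ∣ P 2 - t * P 3
  L : ∀ P ∈ S, (q : ℤ) ^ 3 ∣ Lq s t P
  inj : ∀ P ∈ S, ∀ P' ∈ S, P ≠ P' → mn P P' 0 1 ≠ 0 ∧ mn P P' 2 3 ≠ 0
  f3 : ∀ P ∈ S, (q : ℤ) ^ 3 ∣ fq a1 a2 P
  fne : ∀ P ∈ S, fq a1 a2 P ≠ 0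

lemma Cls.q0 {q Pr s t a1 a2 Z S} (h : Cls q Pr s t a1 a2 Z S) : 0 < q := by
  rw [h.qP]; exact Finset.prod_pos fun p hp => (h.prime p hp).pos

lemma Cls.cop {q Pr s t a1 a2 Z S} (h : Cls q Pr s t a1 a2 Z S) (c : ℤ) (hc : ∀ p ∈ Pr, ¬ (p : ℤ) ∣ c) :
    IsCoprime (q : ℤ) c := by
  rw [h.qP]; push_cast
  apply IsCoprime.prod_left
  intro p hp
  exact (Prime.coprime_iff_not_dvd (Nat.prime_iff_prime_int.mp (h.prime p hp))).mpr (hc p hp)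

/-- The rank two lattice cut out by a form. -/
def LatU (q s t : ℤ) (u : Fin 4 → ℤ) (G : ℤ) : AddSubgroup (Fin 4 → ℤ) where
  carrier := {w | G * w 0 = u 2 * w 2 + u 3 * w 3 ∧ G * w 1 = -(u 0 * w 2 + u 1 * w 3) ∧
    q ∣ w 0 - s * w 1 ∧ q ∣ w 2 - t * w 3}
  zero_mem' := by simp
  add_mem' := by
    rintro v w ⟨h1, h2, h3, h4⟩ ⟨g1, g2, g3, g4⟩
    refine ⟨?_, ?_, dvdE (dvd_add h3 g3) ?_, dvdE (dvd_add h4 g4) ?_⟩ <;> simp only [Pi.add_apply]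
    · linear_combination h1 + g1
    · linear_combination h2 + g2
    · ring
    · ring
  neg_mem' := by
    rintro v ⟨h1, h2, h3, h4⟩
    refine ⟨?_, ?_, dvdE (dvd_neg.mpr h3) ?_, dvdE (dvd_neg.mpr h4) ?_⟩ <;> simp only [Pi.neg_apply]
    · linear_combination -h1
    · linear_combination -h2
    · ring
    · ring

lemma mem_LatU {q s t : ℤ} {u : Fin 4 → ℤ} {G : ℤ} {w : Fin 4 → ℤ} : w ∈ LatU q s t u G ↔
    (G * w 0 = u 2 * w 2 + u 3 * w 3 ∧ G * w 1 = -(u 0 * w 2 + u 1 * w 3) ∧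
    q ∣ w 0 - s * w 1 ∧ q ∣ w 2 - t * w 3) := Iff.rfl

lemma mn_comb (p r : Fin 4 → ℤ) (m n m' n' : ℤ) (i k : Fin 4) :
    mn (m • p + n • r) (m' • p + n' • r) i k = (m * n' - m' * n) * mn p r i k := by
  simp only [mn, Pi.add_apply, Pi.smul_apply, smul_eq_mul]; ring

lemma mn_bound {Z P P' : Fin 4 → ℤ} (Z1 : ∀ i, 1 ≤ Z i) (lo : ∀ i, Z i ≤ P i) (hi : ∀ i, P i < 2 * Z i)
    (lo' : ∀ i, Z i ≤ P' i) (hi' : ∀ i, P' i < 2 * Z i) (i k : Fin 4) : |mn P P' i k| ≤ 3 * (Z i * Z k) := by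
  have h1 := lo i; have h2 := hi i; have h3 := lo k; have h4 := hi k
  have g1 := lo' i; have g2 := hi' i; have g3 := lo' k; have g4 := hi' k
  have z1 := Z1 i; have z2 := Z1 k
  have a1 : Z i * Z k ≤ P i * P' k := by nlinarith
  have a2 : Z i * Z k ≤ P' i * P k := by nlinarith
  have a3 : P i * P' k ≤ (2 * Z i) * (2 * Z k) := by nlinarith
  have a4 : P' i * P k ≤ (2 * Z i) * (2 * Z k) := by nlinarith
  rw [abs_le, mn]; constructor <;> nlinarith

/-- Output of the analysis of a fibre. -/
structure FibData (q : ℕ) (s t a1 a2 : ℤ) (Z : Fin 4 → ℤ) (Γ : AddSubgroup (Fin 4 → ℤ)) (T : Finset (Fin 4 → ℤ))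
    (K : ℝ) (p r : Fin 4 → ℤ) (e e' h J : ℕ) : Prop where
  pT : p ∈ T
  rL : r ∈ Γ
  e1 : 1 ≤ e
  h1 : 1 ≤ h
  J1 : 1 ≤ J
  qe : q = e * e'
  card : (T.card : ℝ) ≤ K * (2 * (J / e : ℝ) + 1)
  mb : ∀ i k, |mn p r i k| * J ≤ 3 * (Z i * Z k)
  hx : (q : ℤ) * h ^ 2 ≤ |mn p r 0 1|
  hy : (q : ℤ) * h ^ 2 ≤ |mn p r 2 3|
  v : ∃ v ∈ Dl q s t, ((q : ℤ) * v 0 = ((e * h : ℕ) : ℤ) ^ 2 * mn p r 1 3) ∧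
      ((q : ℤ) * v 1 = - (((e * h : ℕ) : ℤ) ^ 2 * mn p r 1 2)) ∧
      ((q : ℤ) * v 2 = - (((e * h : ℕ) : ℤ) ^ 2 * mn p r 0 3)) ∧ ((q : ℤ) * v 3 = ((e * h : ℕ) : ℤ) ^ 2 * mn p r 0 2)
  f : ∀ w ∈ Γ, (e' : ℤ) ^ 3 ∣ fq a1 a2 w
  gen : ∀ w ∈ Γ, ∃ m n : ℤ, w = m • p + n • r

set_option maxHeartbeats 1000000 in
lemma fib_data {q Pr s t a1 a2 Z S} (cls : Cls q Pr s t a1 a2 Z S) {T : Finset (Fin 4 → ℤ)} (hT : T ⊆ S)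
    {u : Fin 4 → ℤ} {G : ℤ} (hG : G ≠ 0) (hL : ∀ P ∈ T, P ∈ LatU q s t u G) :
    (T.card : ℝ) ≤ 5 ^ Pr.card ∨ ∃ p r e e' h J, FibData q s t a1 a2 Z (LatU q s t u G) T (5 ^ Pr.card) p r e e' h J := by
  classical
  have hq0 := cls.q0
  have hqz : (q : ℤ) ≠ 0 := by exact_mod_cast hq0.ne'
  have hqzp : (0 : ℤ) < q := by exact_mod_cast hq0
  have h5 : (1 : ℝ) ≤ 5 ^ Pr.card := one_le_pow₀ (by norm_num)
  by_cases hT1 : T.card ≤ 1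
  · left
    have : (T.card : ℝ) ≤ 1 := by exact_mod_cast hT1
    linarith
  push Not at hT1
  obtain ⟨p, hpT, p', hpT', hne⟩ := Finset.one_lt_card.mp hT1
  set Γ := LatU q s t u G with hΓ
  obtain ⟨r, hrΓ, hκ, hgen⟩ := lat_basis Γ p (hL p hpT) (cls.copy p (hT hpT)) (by
    intro w hw h2 h3
    obtain ⟨g1, g2, -, -⟩ := mem_LatU.mp hw
    rw [h2, h3] at g1 g2
    have e0 : w 0 = 0 := by
      have : G * w 0 = 0 := by linarith
      exact (mul_eq_zero.mp this).resolve_left hG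
    have e1 : w 1 = 0 := by
      have : G * w 1 = 0 := by linarith
      exact (mul_eq_zero.mp this).resolve_left hG
    funext i; fin_cases i <;> simp [e0, e1, h2, h3]) ⟨p', hL p' hpT', (cls.inj p (hT hpT) p' (hT hpT') hne).2⟩
  choose! m n hmn using hgen
  -- integers `A, B`
  obtain ⟨A, hA'⟩ := cls.ax p (hT hpT)
  obtain ⟨B, hB'⟩ := cls.ay p (hT hpT)
  obtain ⟨-, -, ⟨A', hA''⟩, ⟨B', hB''⟩⟩ := mem_LatU.mp hrΓ
  have eA : p 0 = s * p 1 + q * A := by linarith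
  have eB : p 2 = t * p 3 + q * B := by linarith
  have eA' : r 0 = s * r 1 + q * A' := by linarith
  have eB' : r 2 = t * r 3 + q * B' := by linarith
  clear hA' hB' hA'' hB''
  set d := B * r 3 - B' * p 3 with hd
  set d' := A * r 1 - A' * p 1 with hd'
  have m23 : mn p r 2 3 = q * d := by rw [mn, eB, eB', hd]; ring
  have m01 : mn p r 0 1 = q * d' := by rw [mn, eA, eA', hd']; ring
  have m23' : 0 < mn p r 2 3 := hκ
  have m01' : mn p r 0 1 ≠ 0 := by
    have h1 := (cls.inj p (hT hpT) p' (hT hpT') hne).1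
    rw [hmn p (hL p hpT), hmn p' (hL p' hpT'), mn_comb] at h1
    exact right_ne_zero_of_mul h1
  -- colours
  set col : ℕ → (Fin 4 → ℤ) → ℕ := fun p0 P => pcol p0 (m P) (n P) with hcol
  have hprim : ∀ p0 ∈ Pr, ∀ P ∈ T, ¬ ((p0 : ℤ) ∣ m P ∧ (p0 : ℤ) ∣ n P) := by
    rintro p0 hp0 P hP ⟨h1, h2⟩
    apply cls.unit P (hT hP) p0 hp0 2
    rw [hmn P (hL P hP)]
    simp only [Pi.add_apply, Pi.smul_apply, smul_eq_mul]
    exact dvd_add (h1.mul_right _) (h2.mul_right _)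
  have hcoliff : ∀ p0 ∈ Pr, ∀ P ∈ T, ∀ P' ∈ T, (col p0 P = col p0 P' ↔ (p0 : ℤ) ∣ m P * n P' - m P' * n P) :=
    fun p0 hp0 P hP P' hP' => pcol_eq_iff (cls.prime p0 hp0) (hprim p0 hp0 P hP) (hprim p0 hp0 P' hP')
  set E := Pr.filter (fun p0 => (T.image (col p0)).card ≤ 5) with hE
  have hEsub : E ⊆ Pr := Finset.filter_subset _ _
  set F := Pr.filter (fun p0 => ¬ (T.image (col p0)).card ≤ 5) with hF
  have hFsub : F ⊆ Pr := Finset.filter_subset _ _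
  obtain ⟨T', hT', hmono, hcard⟩ := colour_lemma 5 col E T (by
    intro p0 hp0 S' hS'
    exact (Finset.card_le_card (Finset.image_subset_image hS')).trans (Finset.mem_filter.mp hp0).2)
  have hcardR : (T.card : ℝ) ≤ 5 ^ Pr.card * T'.card := by
    have h1 : (T.card : ℝ) ≤ 5 ^ E.card * T'.card := by exact_mod_cast hcard
    exact h1.trans (mul_le_mul_of_nonneg_right (pow_le_pow_right₀ (by norm_num) (Finset.card_le_card hEsub)) (Nat.cast_nonneg _))
  by_cases hT1' : T'.card ≤ 1
  · left
    have : (T'.card : ℝ) ≤ 1 := by exact_mod_cast hT1'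
    nlinarith
  push Not at hT1'
  right
  set e := ∏ p0 ∈ E, p0 with he
  set e' := ∏ p0 ∈ F, p0 with he'
  set H := F.filter (fun p0 => ((p0 : ℕ) : ℤ) ∣ d) with hH
  have hHF : H ⊆ F := Finset.filter_subset _ _
  set h := ∏ p0 ∈ H, p0 with hh
  -- the integer `j`
  set j : (Fin 4 → ℤ) × (Fin 4 → ℤ) → ℤ := fun PP => m PP.1 * n PP.2 - m PP.2 * n PP.1 with hj
  have hjm : ∀ P ∈ T, ∀ P' ∈ T, ∀ i k, mn P P' i k = j (P, P') * mn p r i k := by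
    intro P hP P' hP' i k
    conv_lhs => rw [hmn P (hL P hP), hmn P' (hL P' hP')]
    rw [mn_comb]
  have hjne : ∀ P ∈ T, ∀ P' ∈ T, P ≠ P' → j (P, P') ≠ 0 := by
    intro P hP P' hP' hne h0
    have h1 := (cls.inj P (hT hP) P' (hT hP') hne).2
    rw [hjm P hP P' hP', h0, zero_mul] at h1
    exact h1 rfl
  obtain ⟨P1, hP1, P2, hP2, hne12⟩ := Finset.one_lt_card.mp hT1'
  obtain ⟨PP, hPP, hmax⟩ := Finset.exists_max_image (T' ×ˢ T') (fun PP => (j PP).natAbs) ⟨(P1, P2), Finset.mem_product.mpr ⟨hP1, hP2⟩⟩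
  set J := (j PP).natAbs with hJ
  have hJ1 : 1 ≤ J := by
    have h1 := hmax (P1, P2) (Finset.mem_product.mpr ⟨hP1, hP2⟩)
    have h2 := hjne P1 (hT' hP1) P2 (hT' hP2) hne12
    have : 1 ≤ (j (P1, P2)).natAbs := by omega
    exact this.trans h1
  have hepos : 0 < e := Finset.prod_pos fun p0 hp0 => (cls.prime p0 (hEsub hp0)).pos
  have hhpos : 0 < h := Finset.prod_pos fun p0 hp0 => (cls.prime p0 (hFsub (hHF hp0))).pos
  have hedvd : ∀ P ∈ T', ∀ P' ∈ T', (e : ℤ) ∣ j (P, P') := by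
    intro P hP P' hP'
    have := prod_pow_dvd_of_primes E (fun p0 hp0 => cls.prime p0 (hEsub hp0)) 1 (j (P, P')) (by
      intro p0 hp0
      rw [pow_one]
      exact (hcoliff p0 (hEsub hp0) P (hT' hP) P' (hT' hP')).mp (hmono p0 hp0 P hP P' hP'))
    rwa [pow_one] at this
  have hκR : (0 : ℝ) < ((mn p r 2 3 : ℤ) : ℝ) := by exact_mod_cast m23'
  have heR : (0 : ℝ) < (e : ℝ) := by exact_mod_cast hepos
  have hcardT' : (T'.card : ℝ) ≤ 2 * (J / e : ℝ) + 1 := by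
    have hinj : Set.InjOn (fun P : Fin 4 → ℤ => (P 2, P 3)) T' := by
      intro P hP P' hP' hPP'
      by_contra hne
      apply (cls.inj P (hT (hT' hP)) P' (hT (hT' hP')) hne).2
      simp only [Prod.mk.injEq] at hPP'
      rw [mn, hPP'.1, hPP'.2]; ring
    rw [← Finset.card_image_of_injOn hinj]
    have hb := bracket_count (Z 2) (Z 3) (((mn p r 2 3 : ℤ) : ℝ) * J) (((mn p r 2 3 : ℤ) : ℝ) * e) (by positivity)
      (T'.image (fun P : Fin 4 → ℤ => (P 2, P 3))) (by
        intro y hy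
        obtain ⟨P, hP, rfl⟩ := Finset.mem_image.mp hy
        have hPS := hT (hT' hP)
        exact ⟨cls.lo P hPS 2, cls.hi P hPS 2, cls.lo P hPS 3, cls.hi P hPS 3⟩) (by
        intro y hy
        obtain ⟨P, hP, rfl⟩ := Finset.mem_image.mp hy
        exact cls.copy P (hT (hT' hP))) (by
        intro y hy z hz
        obtain ⟨P, hP, rfl⟩ := Finset.mem_image.mp hy
        obtain ⟨P', hP', rfl⟩ := Finset.mem_image.mp hz
        obtain ⟨k, hk⟩ := hedvd P hP P' hP'
        refine ⟨k, ?_⟩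
        have := hjm P (hT' hP) P' (hT' hP') 2 3
        rw [hk] at this
        have h2 : P 2 * P' 3 - P' 2 * P 3 = mn p r 2 3 * e * k := by
          rw [mn] at this; rw [this]; ring
        have h3 : ((P 2 * P' 3 - P' 2 * P 3 : ℤ) : ℝ) = ((mn p r 2 3 * e * k : ℤ) : ℝ) := by rw [h2]
        rw [h3]; push_cast; ring) (by positivity) (by
        intro y hy z hz
        obtain ⟨P, hP, rfl⟩ := Finset.mem_image.mp hy
        obtain ⟨P', hP', rfl⟩ := Finset.mem_image.mp hz
        have := hjm P (hT' hP) P' (hT' hP') 2 3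
        have hm := hmax (P, P') (Finset.mem_product.mpr ⟨hP, hP'⟩)
        have h2 : P 2 * P' 3 - P' 2 * P 3 = j (P, P') * mn p r 2 3 := this
        have h3 : ((P 2 * P' 3 - P' 2 * P 3 : ℤ) : ℝ) = ((j (P, P') * mn p r 2 3 : ℤ) : ℝ) := by rw [h2]
        rw [h3]; push_cast
        rw [abs_mul, abs_of_pos hκR, mul_comm]
        gcongr
        rw [← Int.cast_abs, Int.abs_eq_natAbs]
        exact_mod_cast hm)
    refine hb.trans (le_of_eq ?_)
    field_simp
  -- local conditions at good primes
  have hgood : ∀ p0 ∈ F, ∃ g : Fin 6 → (Fin 4 → ℤ), (∀ i, g i ∈ T) ∧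
      ∀ i l, i ≠ l → ¬ (p0 : ℤ) ∣ m (g i) * n (g l) - m (g l) * n (g i) := by
    intro p0 hp0
    have h6 : 6 ≤ (T.image (col p0)).card := by
      have := (Finset.mem_filter.mp hp0).2; omega
    obtain ⟨g, hg, hgc⟩ := six_points T (col p0) h6
    refine ⟨g, hg, fun i l hil hdv => hgc i l hil ?_⟩
    exact (hcoliff p0 (hFsub hp0) _ (hg i) _ (hg l)).mpr hdv
  have hpq : ∀ p0 ∈ Pr, p0 ∣ q := fun p0 hp0 => by rw [cls.qP]; exact Finset.dvd_prod_of_mem _ hp0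
  have hc : ∀ p0 ∈ F, (p0 : ℤ) ^ 2 ∣ 4 * t * A * p 3 + 6 * s * p 1 * B + 5 * q * A * B ∧
    (p0 : ℤ) ^ 2 ∣ 4 * t * (A * r 3 + A' * p 3) + 6 * s * (p 1 * B' + r 1 * B) + 5 * q * (A * B' + A' * B) ∧
    (p0 : ℤ) ^ 2 ∣ 4 * t * A' * r 3 + 6 * s * r 1 * B' + 5 * q * A' * B' := by
    intro p0 hp0
    obtain ⟨g, hg, hgj⟩ := hgood p0 hp0
    refine cgood (cls.prime p0 (hFsub hp0)) (hpq p0 (hFsub hp0)) hq0 eA eB eA' eB' 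
      (fun i : Fin 3 => m (g (Fin.castLE (by norm_num) i))) (fun i : Fin 3 => n (g (Fin.castLE (by norm_num) i))) ?_ ?_
    · intro i
      rw [← hmn _ (hL _ (hg _))]
      exact cls.L _ (hT (hg _))
    · intro i l hil
      apply hgj
      intro hcon
      exact hil (Fin.castLE_injective _ hcon)
  -- the primes dividing `d`
  have hHl : ∀ p0 ∈ H, (p0 : ℤ) ^ 2 ∣ d ∧ (p0 : ℤ) ^ 2 ∣ d' := by
    intro p0 hp0
    have hp0F := hHF hp0
    have hp0P := hFsub hp0F
    have hpr := cls.prime p0 hp0P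
    have hpz : (p0 : ℤ) ≠ 0 := by exact_mod_cast hpr.ne_zero
    obtain ⟨c0, c1, c2⟩ := hc p0 hp0F
    refine local_h hpr (by exact_mod_cast hpq p0 hp0P) (cls.n6 p0 hp0P) (cls.us p0 hp0P) (cls.ut p0 hp0P)
      (cls.unit p (hT hpT) p0 hp0P 1) (cls.unit p (hT hpT) p0 hp0P 3) (Finset.mem_filter.mp hp0).2 c0 c1 c2 ?_
    rintro ⟨l, ⟨x1, h1⟩, ⟨x2, h2⟩, ⟨x3, h3⟩, ⟨x4, h4⟩⟩
    set w : Fin 4 → ℤ := ![s * x1 + q * x2, x1, t * x3 + q * x4, x3] with hw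
    have hwr : (p0 : ℤ) • w = r - l • p := by
      funext i
      fin_cases i
      · simp [hw]; rw [eA, eA']; linear_combination -s * h1 - q * h2
      · simp [hw]; linear_combination -h1
      · simp [hw]; rw [eB, eB']; linear_combination -t * h3 - q * h4
      · simp [hw]; linear_combination -h3
    have hw0 : ∀ i, (p0 : ℤ) * w i = r i - l * p i := by
      intro i
      have := congrFun hwr i
      simpa using this
    have hwΓ : w ∈ Γ := by
      obtain ⟨g1, g2, -, -⟩ := mem_LatU.mp hrΓ
      obtain ⟨k1, k2, -, -⟩ := mem_LatU.mp (hL p hpT)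
      refine mem_LatU.mpr ⟨?_, ?_, ⟨x2, ?_⟩, ⟨x4, ?_⟩⟩
      · apply mul_left_cancel₀ hpz
        linear_combination g1 - l * k1 + G * hw0 0 - u 2 * hw0 2 - u 3 * hw0 3
      · apply mul_left_cancel₀ hpz
        linear_combination g2 - l * k2 + G * hw0 1 + u 0 * hw0 2 + u 1 * hw0 3
      · simp [hw]
      · simp [hw]
    have e1 := hmn w hwΓ
    have e2 : p 2 * w 3 - w 2 * p 3 = n w * mn p r 2 3 := by
      conv_lhs => rw [e1]
      simp only [mn, Pi.add_apply, Pi.smul_apply, smul_eq_mul]; ring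
    have e3 : (p0 : ℤ) * (p 2 * w 3 - w 2 * p 3) = mn p r 2 3 := by
      rw [mn]; linear_combination p 2 * hw0 3 - p 3 * hw0 2
    have e4 : ((p0 : ℤ) * n w - 1) * mn p r 2 3 = 0 := by rw [e2] at e3; linear_combination e3
    have e5 : (p0 : ℤ) * n w = 1 := by
      have := (mul_eq_zero.mp e4).resolve_right m23'.ne'
      linarith
    have := (Nat.prime_iff_prime_int.mp hpr).not_isUnit
    exact this (IsUnit.of_mul_eq_one _ e5)
  have hprH : ∀ p0 ∈ H, p0.Prime := fun p0 hp0 => cls.prime p0 (hFsub (hHF hp0))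
  have h2d : (h : ℤ) ^ 2 ∣ d := prod_pow_dvd_of_primes H hprH 2 d fun p0 hp0 => (hHl p0 hp0).1
  have h2d' : (h : ℤ) ^ 2 ∣ d' := prod_pow_dvd_of_primes H hprH 2 d' fun p0 hp0 => (hHl p0 hp0).2
  have hdne : d ≠ 0 := by
    intro h0; rw [h0, mul_zero] at m23; exact m23'.ne' m23
  have hdne' : d' ≠ 0 := by
    intro h0; rw [h0, mul_zero] at m01; exact m01' m01
  refine ⟨p, r, e, e', h, J, ⟨hpT, hrΓ, hepos, hhpos, hJ1, ?_, ?_, ?_, ?_, ?_, ?_, ?_, ?_⟩⟩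
  · rw [cls.qP, he, he', hE, hF]
    exact (Finset.prod_filter_mul_prod_filter_not Pr _ _).symm
  · refine hcardR.trans ?_
    gcongr
  · intro i k
    obtain ⟨hQ1, hQ2⟩ := Finset.mem_product.mp hPP
    have h1 := hjm PP.1 (hT' hQ1) PP.2 (hT' hQ2) i k
    have s1 := hT (hT' hQ1)
    have s2 := hT (hT' hQ2)
    have h2 := mn_bound cls.Z1 (cls.lo _ s1) (cls.hi _ s1) (cls.lo _ s2) (cls.hi _ s2) i k
    rw [h1, abs_mul] at h2
    have h3 : |j (PP.1, PP.2)| = (J : ℤ) := by rw [hJ, Int.natCast_natAbs]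
    rw [h3] at h2
    linarith
  · rw [m01, abs_mul, abs_of_pos hqzp]
    apply mul_le_mul_of_nonneg_left _ hqzp.le
    have h1 := Int.le_of_dvd (abs_pos.mpr hdne') ((dvd_abs _ _).mpr h2d')
    exact h1
  · rw [m23, abs_mul, abs_of_pos hqzp]
    apply mul_le_mul_of_nonneg_left _ hqzp.le
    exact Int.le_of_dvd (abs_pos.mpr hdne) ((dvd_abs _ _).mpr h2d)
  · refine Asharp cls.qP cls.prime hq0 cls.n6 cls.us cls.ut eA eB eA' eB' _ ?_
    intro p0 hp0
    by_cases h1 : (T.image (col p0)).card ≤ 5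
    · left
      have : p0 ∣ e := Finset.dvd_prod_of_mem _ (Finset.mem_filter.mpr ⟨hp0, h1⟩)
      exact_mod_cast this.mul_right h
    · have hp0F : p0 ∈ F := Finset.mem_filter.mpr ⟨hp0, h1⟩
      by_cases h2 : (p0 : ℤ) ∣ d
      · left
        have : p0 ∣ h := Finset.dvd_prod_of_mem _ (Finset.mem_filter.mpr ⟨hp0F, h2⟩)
        exact_mod_cast this.mul_left e
      · right
        exact ⟨h2, hc p0 hp0F⟩
  · intro w hw
    apply prod_pow_dvd_of_primes F (fun p0 hp0 => cls.prime p0 (hFsub hp0))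
    intro p0 hp0
    obtain ⟨g, hg, hgj⟩ := hgood p0 hp0
    rw [hmn w hw]
    refine fgood (cls.prime p0 (hFsub hp0)) (fun i => m (g i)) (fun i => n (g i)) ?_ hgj _ _
    intro i
    rw [← hmn _ (hL _ (hg i))]
    exact (pow_dvd_pow_of_dvd (by exact_mod_cast hpq p0 (hFsub hp0)) 3).trans (cls.f3 _ (hT (hg i)))
  · intro w hw
    exact ⟨m w, n w, hmn w hw⟩

set_option linter.unusedVariables false

/-- weights on forms -/
def wZ (Z : Fin 4 → ℤ) : Fin 4 → ℤ := ![Z 0 * Z 2, Z 0 * Z 3, Z 1 * Z 2, Z 1 * Z 3]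

lemma wZ_pos {Z : Fin 4 → ℤ} (h : ∀ i, 1 ≤ Z i) : ∀ i, 1 ≤ wZ Z i := by
  intro i
  have h0 := h 0; have h1 := h 1; have h2 := h 2; have h3 := h 3
  fin_cases i <;> simp [wZ] <;> nlinarith

lemma FibData.mnne {q : ℕ} {s t a1 a2 : ℤ} {Z : Fin 4 → ℤ} {Γ : AddSubgroup (Fin 4 → ℤ)} {T : Finset (Fin 4 → ℤ)}
    {K : ℝ} {p r : Fin 4 → ℤ} {e e' h J : ℕ} (hq : 0 < q) (F : FibData q s t a1 a2 Z Γ T K p r e e' h J) :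
    mn p r 0 1 ≠ 0 ∧ mn p r 2 3 ≠ 0 := by
  have hqz : (0 : ℤ) < q := by exact_mod_cast hq
  have hhz : (0 : ℤ) < h := by exact_mod_cast F.h1
  have h1 : (0 : ℤ) < q * h ^ 2 := by positivity
  exact ⟨abs_pos.mp (h1.trans_le F.hx), abs_pos.mp (h1.trans_le F.hy)⟩

/-- Consequence of minimality. -/
lemma min_bound {q : ℕ} {s t a1 a2 : ℤ} {Z : Fin 4 → ℤ} {Γ : AddSubgroup (Fin 4 → ℤ)} {T : Finset (Fin 4 → ℤ)}
    {K : ℝ} {p r u : Fin 4 → ℤ} {e e' h J : ℕ} (hq : 0 < q) (hZ : ∀ i, 1 ≤ Z i)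
    (F : FibData q s t a1 a2 Z Γ T K p r e e' h J) 
    (hm : ∀ P ∈ T, MinF (Dl q s t) (wZ Z) P u) :
    ((nz (wZ Z) u : ℝ) * q ^ 2 * J ^ 2) ^ 2 ≤ 81 * (Z 0 * Z 1 * Z 2 * Z 3 : ℝ) ^ 3 * e ^ 4 := by
  obtain ⟨v, hvD, v0, v1, v2, v3⟩ := F.v
  obtain ⟨n1, n2⟩ := F.mnne hq
  have hqz : (0 : ℤ) < q := by exact_mod_cast hq
  have hez : (0 : ℤ) < ((e * h : ℕ) : ℤ) := by exact_mod_cast Nat.mul_pos F.e1 F.h1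
  set E : ℤ := ((e * h : ℕ) : ℤ) with hE
  have hev : Ev v p = 0 := by
    have : (q : ℤ) * Ev v p = 0 := by
      rw [Ev]
      have : (q : ℤ) * (v 0 * p 0 * p 2 + v 1 * p 0 * p 3 + v 2 * p 1 * p 2 + v 3 * p 1 * p 3) = 
        (q * v 0) * (p 0 * p 2) + (q * v 1) * (p 0 * p 3) + (q * v 2) * (p 1 * p 2) + (q * v 3) * (p 1 * p 3) := by ring
      rw [this, v0, v1, v2, v3]; simp only [mn]; ring
    exact (mul_eq_zero.mp this).resolve_left hqz.ne'
  have hv0 : v ≠ 0 := by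
    intro h0
    rw [h0] at v0 v1 v2 v3
    simp only [Pi.zero_apply, mul_zero] at v0 v1 v2 v3
    have e2 : E ^ 2 ≠ 0 := pow_ne_zero _ hez.ne'
    have g13 := (mul_eq_zero.mp v0.symm).resolve_left e2
    have g12 := (mul_eq_zero.mp (neg_eq_zero.mp v1.symm)).resolve_left e2
    have pl : mn p r 0 1 * mn p r 2 3 = mn p r 0 2 * mn p r 1 3 - mn p r 0 3 * mn p r 1 2 := by
      simp only [mn]; ring
    rw [g13, g12, mul_zero, mul_zero, sub_zero] at pl
    exact (mul_ne_zero n1 n2) pl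
  have hmin := (hm p F.pT).min v hvD hv0 hev
  set n := nz (wZ Z) u with hn
  have hqR : (0 : ℝ) < q := by exact_mod_cast hq
  have hJR : (0 : ℝ) < J := by exact_mod_cast F.J1
  have heR : (0 : ℝ) < e := by exact_mod_cast F.e1
  have hhR : (0 : ℝ) < h := by exact_mod_cast F.h1
  set W : ℤ := Z 0 * Z 1 * Z 2 * Z 3 with hW
  have z0 := hZ 0; have z1 := hZ 1; have z2 := hZ 2; have z3 := hZ 3
  have hWp : 0 < W := by rw [hW]; positivity
  have hJz : (0 : ℤ) < J := by exact_mod_cast F.J1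
  have key : ∀ i, (|v i| * wZ Z i) * (q * J) ≤ 3 * W * E ^ 2 := by
    have gen : ∀ (c m z w : ℤ), (q : ℤ) * c = E ^ 2 * m ∨ (q : ℤ) * c = -(E ^ 2 * m) → |m| * J ≤ 3 * z → 0 < w → z * w = W →
        (|c| * w) * (q * J) ≤ 3 * W * E ^ 2 := by
      intro c m z w hc hm hw hzw
      have h1 : (q : ℤ) * |c| = E ^ 2 * |m| := by
        have : |(q : ℤ) * c| = |E ^ 2 * m| := by rcases hc with hc | hc <;> rw [hc]; rw [abs_neg]
        rwa [abs_mul, abs_mul, abs_of_pos hqz, abs_of_pos (by positivity : 0 < E ^ 2)] at this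
      calc (|c| * w) * (q * J) = (q * |c|) * J * w := by ring
        _ = E ^ 2 * (|m| * J) * w := by rw [h1]; ring
        _ ≤ E ^ 2 * (3 * z) * w := by gcongr
        _ = 3 * W * E ^ 2 := by rw [← hzw]; ring
    intro i
    fin_cases i
    · exact gen _ _ (Z 1 * Z 3) (Z 0 * Z 2) (Or.inl v0) (F.mb 1 3) (by positivity) (by rw [hW]; ring)
    · exact gen _ _ (Z 1 * Z 2) (Z 0 * Z 3) (Or.inr v1) (F.mb 1 2) (by positivity) (by rw [hW]; ring)
    · exact gen _ _ (Z 0 * Z 3) (Z 1 * Z 2) (Or.inr v2) (F.mb 0 3) (by positivity) (by rw [hW]; ring)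
    · exact gen _ _ (Z 0 * Z 2) (Z 1 * Z 3) (Or.inl v3) (F.mb 0 2) (by positivity) (by rw [hW]; ring)
  have hnv : (n : ℤ) * (q * J) ≤ 3 * W * E ^ 2 := by
    have hex : ∃ i ∈ Finset.univ, (Finset.univ.sup fun i => (v i * wZ Z i).natAbs) = (v i * wZ Z i).natAbs :=
      Finset.exists_mem_eq_sup _ Finset.univ_nonempty _
    obtain ⟨i, -, hi⟩ := hex
    have h1 : (nz (wZ Z) v : ℤ) = |v i| * wZ Z i := by
      rw [nz, hi, Int.natCast_natAbs, abs_mul, abs_of_pos (by linarith [wZ_pos hZ i] : 0 < wZ Z i)]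
    have h2 : (n : ℤ) ≤ nz (wZ Z) v := by exact_mod_cast hmin
    refine le_trans ?_ (key i)
    rw [← h1]
    gcongr
  have hqh : ((q : ℤ) * h ^ 2 * J) ^ 2 ≤ 9 * W := by
    have a1 : (q : ℤ) * h ^ 2 * J ≤ 3 * (Z 0 * Z 1) := le_trans (by gcongr; exact F.hx) (F.mb 0 1)
    have a2 : (q : ℤ) * h ^ 2 * J ≤ 3 * (Z 2 * Z 3) := le_trans (by gcongr; exact F.hy) (F.mb 2 3)
    calc ((q : ℤ) * h ^ 2 * J) ^ 2 = (q * h ^ 2 * J) * (q * h ^ 2 * J) := by ring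
      _ ≤ (3 * (Z 0 * Z 1)) * (3 * (Z 2 * Z 3)) := by gcongr
      _ = 9 * W := by rw [hW]; ring
  have fin : ((n : ℤ) * q ^ 2 * J ^ 2) ^ 2 ≤ 81 * W ^ 3 * e ^ 4 := by
    have hh4 : (0 : ℤ) < h ^ 4 := by have := F.h1; positivity
    have : (((n : ℤ) * q ^ 2 * J ^ 2) ^ 2) * h ^ 4 ≤ (81 * W ^ 3 * e ^ 4) * h ^ 4 := by
      calc (((n : ℤ) * q ^ 2 * J ^ 2) ^ 2) * h ^ 4 = (n * (q * J)) * (n * (q * J)) * ((q * h ^ 2 * J) ^ 2) := by ring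
        _ ≤ (3 * W * E ^ 2) * (3 * W * E ^ 2) * (9 * W) := by gcongr
        _ = (81 * W ^ 3 * e ^ 4) * h ^ 4 := by rw [hE]; push_cast; ring
    exact le_of_mul_le_mul_right this hh4
  have := (Int.cast_le (R := ℝ)).mpr fin
  rw [hW] at this
  push_cast at this
  exact this

/-- Points killed by a fixed form. -/
lemma fixed_u {q Pr s t a1 a2 Z S} (cls : Cls q Pr s t a1 a2 Z S) {u : Fin 4 → ℤ} (hu : u ≠ 0) {T : Finset (Fin 4 → ℤ)}
    (hT : T ⊆ S) (hE : ∀ P ∈ T, Ev u P = 0) (N : ℝ) (hN1 : 1 ≤ N)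
    (hN : ∀ T' ⊆ T, ∀ G : ℤ, G ≠ 0 → (∀ P ∈ T', P ∈ LatU q s t u G) → (T'.card : ℝ) ≤ N) :
    (T.card : ℝ) ≤ N * (2 * ((u 0 * u 3 - u 1 * u 2).natAbs.divisors.card + 1)) := by
  classical
  have hpos : ∀ P ∈ S, ∀ i, 0 < P i := fun P hP i => lt_of_lt_of_le (by linarith [cls.Z1 i]) (cls.lo P hP i)
  have hGex : ∀ P ∈ T, ∃ G : ℤ, u 2 * P 2 + u 3 * P 3 = G * P 0 ∧ u 0 * P 2 + u 1 * P 3 = -(G * P 1) := by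
    intro P hP
    have h1 := hE P hP
    have hc := cls.copx P (hT hP)
    have h2 : P 0 * (u 0 * P 2 + u 1 * P 3) = - (P 1 * (u 2 * P 2 + u 3 * P 3)) := by rw [Ev] at h1; linarith
    have h3 : P 0 ∣ u 2 * P 2 + u 3 * P 3 := by
      apply hc.dvd_of_dvd_mul_left
      exact ⟨-(u 0 * P 2 + u 1 * P 3), by linarith⟩
    obtain ⟨G, hG⟩ := h3
    refine ⟨G, by linarith, ?_⟩
    have h0 := (hpos P (hT hP) 0).ne'
    apply mul_left_cancel₀ h0
    rw [h2, hG]; ring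
  choose! G hG2 hG0 using hGex
  set D := u 0 * u 3 - u 1 * u 2 with hD
  have hD2 : ∀ P ∈ T, D * P 2 = - G P * (u 3 * P 1 + u 1 * P 0) := by
    intro P hP
    rw [hD]; linear_combination u 3 * hG0 P hP - u 1 * hG2 P hP
  have hD3 : ∀ P ∈ T, D * P 3 = G P * (u 0 * P 0 + u 2 * P 1) := by
    intro P hP
    rw [hD]; linear_combination u 0 * hG2 P hP - u 2 * hG0 P hP
  have hlat : ∀ P ∈ T, P ∈ LatU q s t u (G P) := fun P hP =>
    mem_LatU.mpr ⟨(hG2 P hP).symm, by linarith [hG0 P hP], cls.ax P (hT hP), cls.ay P (hT hP)⟩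
  -- at most one point with G = 0
  have hz : (T.filter (fun P => G P = 0)).card ≤ 1 := by
    rw [Finset.card_le_one]
    intro P hP P' hP'
    obtain ⟨hP, g⟩ := Finset.mem_filter.mp hP
    obtain ⟨hP', g'⟩ := Finset.mem_filter.mp hP'
    by_contra hne
    have hm := (cls.inj P (hT hP) P' (hT hP') hne).2
    have a1 := hG2 P hP; have a2 := hG0 P hP
    have b1 := hG2 P' hP'; have b2 := hG0 P' hP'
    rw [g] at a1 a2; rw [g'] at b1 b2
    have c0 : u 0 * mn P P' 2 3 = 0 := by rw [mn]; linear_combination P' 3 * a2 - P 3 * b2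
    have c1 : u 1 * mn P P' 2 3 = 0 := by rw [mn]; linear_combination P 2 * b2 - P' 2 * a2
    have c2 : u 2 * mn P P' 2 3 = 0 := by rw [mn]; linear_combination P' 3 * a1 - P 3 * b1
    have c3 : u 3 * mn P P' 2 3 = 0 := by rw [mn]; linear_combination P 2 * b1 - P' 2 * a1
    apply hu
    funext i
    fin_cases i
    · exact (mul_eq_zero.mp c0).resolve_right hm
    · exact (mul_eq_zero.mp c1).resolve_right hm
    · exact (mul_eq_zero.mp c2).resolve_right hm
    · exact (mul_eq_zero.mp c3).resolve_right hm
  by_cases hD0 : D = 0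
  · have hz' : (T.filter (fun P => ¬ G P = 0)).card ≤ 1 := by
      rw [Finset.card_le_one]
      intro P hP P' hP'
      obtain ⟨hP, g⟩ := Finset.mem_filter.mp hP
      obtain ⟨hP', g'⟩ := Finset.mem_filter.mp hP'
      by_contra hne
      have hm := (cls.inj P (hT hP) P' (hT hP') hne).1
      have a1 := hD2 P hP; have a2 := hD3 P hP
      have b1 := hD2 P' hP'; have b2 := hD3 P' hP'
      rw [hD0, zero_mul] at a1 a2 b1 b2
      have a1 := (mul_eq_zero.mp a1.symm).resolve_left (neg_ne_zero.mpr g)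
      have a2 := (mul_eq_zero.mp a2.symm).resolve_left g
      have b1 := (mul_eq_zero.mp b1.symm).resolve_left (neg_ne_zero.mpr g')
      have b2 := (mul_eq_zero.mp b2.symm).resolve_left g'
      have c0 : u 0 * mn P P' 0 1 = 0 := by rw [mn]; linear_combination P' 1 * a2 - P 1 * b2
      have c1 : u 1 * mn P P' 0 1 = 0 := by rw [mn]; linear_combination P' 1 * a1 - P 1 * b1
      have c2 : u 2 * mn P P' 0 1 = 0 := by rw [mn]; linear_combination P 0 * b2 - P' 0 * a2
      have c3 : u 3 * mn P P' 0 1 = 0 := by rw [mn]; linear_combination P 0 * b1 - P' 0 * a1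
      apply hu
      funext i
      fin_cases i
      · exact (mul_eq_zero.mp c0).resolve_right hm
      · exact (mul_eq_zero.mp c1).resolve_right hm
      · exact (mul_eq_zero.mp c2).resolve_right hm
      · exact (mul_eq_zero.mp c3).resolve_right hm
    have h2 : T.card ≤ 2 := by
      rw [← Finset.card_filter_add_card_filter_not (s := T) (fun P => G P = 0)]; omega
    have h2' : (T.card : ℝ) ≤ 2 := by exact_mod_cast h2
    have : (0 : ℝ) ≤ D.natAbs.divisors.card := Nat.cast_nonneg _
    nlinarith
  · have hGD : ∀ P ∈ T, G P ∣ D := by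
      intro P hP
      obtain ⟨x, y, hxy⟩ := cls.copy P (hT hP)
      have : D = G P * (x * (-(u 3 * P 1 + u 1 * P 0)) + y * (u 0 * P 0 + u 2 * P 1)) := by
        linear_combination x * hD2 P hP + y * hD3 P hP - D * hxy
      exact ⟨_, this⟩
    set A : Finset ℤ := (D.natAbs.divisors.image (fun d : ℕ => (d : ℤ))) ∪ (D.natAbs.divisors.image (fun d : ℕ => -(d : ℤ))) with hA
    have hAc : A.card ≤ 2 * D.natAbs.divisors.card := by
      have := Finset.card_union_le (D.natAbs.divisors.image (fun d : ℕ => (d : ℤ))) (D.natAbs.divisors.image (fun d : ℕ => -(d : ℤ)))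
      have h1 := Finset.card_image_le (s := D.natAbs.divisors) (f := fun d : ℕ => (d : ℤ))
      have h2 := Finset.card_image_le (s := D.natAbs.divisors) (f := fun d : ℕ => -(d : ℤ))
      rw [hA]; omega
    have hf := fiber_bound T G A N (by linarith) (by
      intro P hP
      have hd : (G P).natAbs ∈ D.natAbs.divisors := Nat.mem_divisors.mpr ⟨Int.natAbs_dvd_natAbs.mpr (hGD P hP), by simpa using hD0⟩
      rw [hA, Finset.mem_union, Finset.mem_image, Finset.mem_image]
      rcases Int.natAbs_eq (G P) with h | h
      · left; exact ⟨_, hd, h.symm⟩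
      · right; exact ⟨_, hd, h.symm⟩) (by
      intro g hg
      by_cases hg0 : g = 0
      · have : (Finset.filter (fun s => G s = g) T).card ≤ 1 := by rw [hg0]; exact hz
        have : ((Finset.filter (fun s => G s = g) T).card : ℝ) ≤ 1 := by exact_mod_cast this
        linarith
      · apply hN _ (Finset.filter_subset _ _) g hg0
        intro P hP
        obtain ⟨hP1, hP2⟩ := Finset.mem_filter.mp hP
        rw [← hP2]
        exact hlat P hP1)
    refine hf.trans ?_
    have : (A.card : ℝ) ≤ 2 * D.natAbs.divisors.card := by exact_mod_cast hAc
    gcongr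
    linarith

set_option linter.unusedVariables false

lemma near_mul (a b : ℤ) (ha : a ≠ 0) : ∃ k : ℤ, 2 * |b - k * a| ≤ |a| := by
  have h1 := Int.emod_nonneg b ha
  have h2 := Int.emod_lt_abs b ha
  have h3 := Int.emod_add_mul_ediv b a
  by_cases h : 2 * (b % a) ≤ |a|
  · refine ⟨b / a, ?_⟩
    have : b - b / a * a = b % a := by linear_combination h3.symm
    rw [this, abs_of_nonneg h1]; exact h
  · push Not at h
    rcases le_or_gt 0 a with h0 | h0
    · rw [abs_of_nonneg h0] at *
      refine ⟨b / a + 1, ?_⟩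
      have : b - (b / a + 1) * a = b % a - a := by linear_combination h3.symm
      rw [this, abs_of_nonpos (by linarith)]; linarith
    · rw [abs_of_neg h0] at *
      refine ⟨b / a - 1, ?_⟩
      have : b - (b / a - 1) * a = b % a + a := by linear_combination h3.symm
      rw [this, abs_of_nonpos (by linarith)]; linarith

/-- weights on points -/
def wP (Z : Fin 4 → ℤ) : Fin 4 → ℤ := ![Z 1 * Z 2 * Z 3, Z 0 * Z 2 * Z 3, Z 0 * Z 1 * Z 3, Z 0 * Z 1 * Z 2]

lemma wP_mul (Z : Fin 4 → ℤ) (i : Fin 4) : wP Z i * Z i = Z 0 * Z 1 * Z 2 * Z 3 := by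
  fin_cases i <;> simp [wP] <;> ring

lemma wP_pos {Z : Fin 4 → ℤ} (h : ∀ i, 1 ≤ Z i) : ∀ i, 1 ≤ wP Z i := by
  intro i
  have h0 := h 0; have h1 := h 1; have h2 := h 2; have h3 := h 3
  fin_cases i <;> simp [wP] <;> nlinarith [mul_pos (by linarith : 0 < Z 0) (by linarith : 0 < Z 1), mul_pos (by linarith : 0 < Z 2) (by linarith : 0 < Z 1), mul_pos (by linarith : 0 < Z 0) (by linarith : 0 < Z 2)]

/-- A short basis of a rank two lattice. -/
lemma short_basis {Z : Fin 4 → ℤ} (hZ : ∀ i, 1 ≤ Z i) (Γ : AddSubgroup (Fin 4 → ℤ)) {p r : Fin 4 → ℤ} (hp : p ∈ Γ) (hr : r ∈ Γ)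
    (hgen : ∀ w ∈ Γ, ∃ m n : ℤ, w = m • p + n • r) (hne : mn p r 2 3 ≠ 0) {J : ℝ} (hJ : 0 < J)
    (mb : ∀ i k, |(mn p r i k : ℝ)| * J ≤ 3 * (Z i * Z k)) :
    ∃ P' ∈ Γ, ∃ P'' ∈ Γ, ∃ τ1 : ℝ, 0 < τ1 ∧ P' ≠ 0 ∧ (∀ i, |(P' i : ℝ)| ≤ τ1 * Z i) ∧
      (∀ i, |(P'' i : ℝ)| ≤ (3 / (J * τ1) + τ1 / 2) * Z i) ∧ τ1 ^ 2 ≤ 6 / J ∧ ∃ m n : ℤ, p = m • P' + n • P'' := by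
  classical
  have hw := wP_pos hZ
  have hp0 : p ≠ 0 := by rintro rfl; simp [mn] at hne
  have hex : ∃ n : ℕ, ∃ v ∈ Γ, v ≠ 0 ∧ nz (wP Z) v = n := ⟨_, p, hp, hp0, rfl⟩
  obtain ⟨Q, hQ, hQ0, hQn⟩ := Nat.find_spec hex
  have hQmin : ∀ v ∈ Γ, v ≠ 0 → nz (wP Z) Q ≤ nz (wP Z) v := by
    intro v hv hv0
    rw [hQn]; exact Nat.find_min' hex ⟨v, hv, hv0, rfl⟩
  set n := nz (wP Z) Q with hn
  have hn1 : 1 ≤ n := nz_pos hw hQ0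
  obtain ⟨α0, β0, hQe⟩ := hgen Q hQ
  -- primitive part
  set g := Int.gcd α0 β0 with hg
  have hg0 : g ≠ 0 := by
    intro h0
    obtain ⟨h1, h2⟩ := Int.gcd_eq_zero_iff.mp h0
    rw [h1, h2] at hQe; apply hQ0; rw [hQe]; simp
  obtain ⟨α, hα⟩ := Int.gcd_dvd_left (a := α0) (b := β0)
  obtain ⟨β, hβ⟩ := Int.gcd_dvd_right (a := α0) (b := β0)
  rw [← hg] at hα hβ
  have hgz : (g : ℤ) ≠ 0 := by exact_mod_cast hg0
  have hbez : α * Int.gcdA α0 β0 + β * Int.gcdB α0 β0 = 1 := by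
    have := Int.gcd_eq_gcd_ab α0 β0
    rw [← hg] at this
    apply mul_left_cancel₀ hgz
    rw [mul_one]
    conv_rhs => rw [this]
    linear_combination (-Int.gcdA α0 β0) * hα - Int.gcdB α0 β0 * hβ
  set P' := α • p + β • r with hP'
  have hP'Γ : P' ∈ Γ := Γ.add_mem (Γ.zsmul_mem hp _) (Γ.zsmul_mem hr _)
  have hQP : ∀ i, Q i = g * P' i := by
    intro i
    rw [hQe, hP', hα, hβ]; simp only [Pi.add_apply, Pi.smul_apply, smul_eq_mul]; ring
  have hP'0 : P' ≠ 0 := by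
    intro h0; apply hQ0; funext i; rw [hQP, h0]; simp
  have hP'n : nz (wP Z) P' ≤ n := by
    rw [nz_le hw]
    intro i
    refine le_trans ?_ (le_nz hw (u := Q) i)
    rw [hQP]; push_cast
    rw [abs_mul]
    have : (1 : ℝ) ≤ |(g : ℝ)| := by rw [Nat.abs_cast]; exact_mod_cast Nat.one_le_iff_ne_zero.mpr hg0
    have hwi : (0 : ℝ) ≤ wP Z i := by exact_mod_cast (by linarith [hw i] : 0 ≤ wP Z i)
    nlinarith [mul_nonneg (abs_nonneg (P' i : ℝ)) hwi]
  have hPn2 : nz (wP Z) P' = n := le_antisymm hP'n (hQmin P' hP'Γ hP'0)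
  obtain ⟨i0, -, hi0⟩ := Finset.exists_mem_eq_sup Finset.univ Finset.univ_nonempty (fun i => (P' i * wP Z i).natAbs)
  have hi0' : |(P' i0 : ℝ)| * wP Z i0 = n := by
    have h1 : (n : ℤ) = |P' i0| * wP Z i0 := by
      rw [← hPn2, nz, hi0, Int.natCast_natAbs, abs_mul, abs_of_pos (by linarith [hw i0] : 0 < wP Z i0)]
    have := congrArg (Int.cast : ℤ → ℝ) h1
    push_cast at this; linarith
  set W : ℝ := ((Z 0 * Z 1 * Z 2 * Z 3 : ℤ) : ℝ) with hW
  have hWpos : 0 < W := by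
    have z0 := hZ 0; have z1 := hZ 1; have z2 := hZ 2; have z3 := hZ 3
    rw [hW]; exact_mod_cast (by positivity : 0 < Z 0 * Z 1 * Z 2 * Z 3)
  have hZR : ∀ i, (0 : ℝ) < Z i := fun i => by exact_mod_cast (by linarith [hZ i] : 0 < Z i)
  have hwZ : ∀ i, (wP Z i : ℝ) * Z i = W := fun i => by rw [hW, ← wP_mul Z i]; push_cast; ring
  set τ1 : ℝ := n / W with hτ
  have hnR : (1 : ℝ) ≤ n := by exact_mod_cast hn1
  have hτ0 : 0 < τ1 := by positivity
  have hP'b : ∀ i, |(P' i : ℝ)| ≤ τ1 * Z i := by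
    intro i
    have h1 := le_nz hw (u := P') i
    rw [hPn2] at h1
    rw [hτ, div_mul_eq_mul_div, le_div_iff₀ hWpos, ← hwZ i]
    nlinarith [hZR i]
  have hP'i0 : |(P' i0 : ℝ)| = τ1 * Z i0 := by
    rw [hτ, div_mul_eq_mul_div, eq_div_iff hWpos.ne', ← hwZ i0, ← hi0']; ring
  have hP'i0ne : P' i0 ≠ 0 := by
    intro h0
    rw [h0] at hP'i0
    have := mul_pos hτ0 (hZR i0)
    simp at hP'i0
    rcases hP'i0 with h | h
    · linarith
    · have := hZ i0; omega
  set R0 := (-Int.gcdB α0 β0) • p + (Int.gcdA α0 β0) • r with hR0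
  obtain ⟨k, hk⟩ := near_mul (P' i0) (R0 i0) hP'i0ne
  set P'' := R0 - k • P' with hP''
  have hP''Γ : P'' ∈ Γ := Γ.sub_mem (Γ.add_mem (Γ.zsmul_mem hp _) (Γ.zsmul_mem hr _)) (Γ.zsmul_mem hP'Γ _)
  have hmn : ∀ i l, mn P' P'' i l = mn p r i l := by
    intro i l
    rw [hP'', hR0, hP', mn, mn]
    simp only [Pi.add_apply, Pi.smul_apply, smul_eq_mul, Pi.sub_apply]
    linear_combination (p i * r l - r i * p l) * hbez
  have hP''0 : P'' ≠ 0 := by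
    intro h0
    have := hmn 2 3
    rw [h0] at this
    apply hne; rw [← this]; simp [mn]
  have hP''i0 : |(P'' i0 : ℝ)| ≤ τ1 * Z i0 / 2 := by
    have : 2 * |P'' i0| ≤ |P' i0| := by
      have e : P'' i0 = R0 i0 - k * P' i0 := by rw [hP'']; simp
      rw [e]; exact hk
    have h2 := (Int.cast_le (R := ℝ)).mpr this
    push_cast at h2
    rw [hP'i0] at h2; linarith
  have hP''b : ∀ i, |(P'' i : ℝ)| ≤ (3 / (J * τ1) + τ1 / 2) * Z i := by
    intro l
    have h1 : (P' i0 : ℝ) * P'' l = mn p r i0 l + P'' i0 * P' l := by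
      have := hmn i0 l
      have e : P' i0 * P'' l = mn p r i0 l + P'' i0 * P' l := by rw [← this, mn]; ring
      exact_mod_cast e
    have h2 : |(P' i0 : ℝ)| * |(P'' l : ℝ)| ≤ |(mn p r i0 l : ℝ)| + |(P'' i0 : ℝ)| * |(P' l : ℝ)| := by
      rw [← abs_mul, h1, ← abs_mul]; exact abs_add_le _ _
    have h3 : |(mn p r i0 l : ℝ)| ≤ 3 * (Z i0 * Z l) / J := by rw [le_div_iff₀ hJ]; exact mb i0 l
    have h4 : |(P'' i0 : ℝ)| * |(P' l : ℝ)| ≤ (τ1 * Z i0 / 2) * (τ1 * Z l) := by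
      apply mul_le_mul hP''i0 (hP'b l) (abs_nonneg _)
      have := hZR i0; positivity
    have h5 : (τ1 * Z i0) * |(P'' l : ℝ)| ≤ (τ1 * Z i0) * ((3 / (J * τ1) + τ1 / 2) * Z l) := by
      rw [← hP'i0]
      refine h2.trans ((add_le_add h3 h4).trans (le_of_eq ?_))
      rw [hP'i0]
      field_simp
    exact le_of_mul_le_mul_left h5 (mul_pos hτ0 (hZR i0))
  refine ⟨P', hP'Γ, P'', hP''Γ, τ1, hτ0, hP'0, hP'b, hP''b, ?_, Int.gcdA α0 β0 - β * k, -β, ?_⟩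
  · have h1 := hQmin P'' hP''Γ hP''0
    obtain ⟨i1, -, hi1⟩ := Finset.exists_mem_eq_sup Finset.univ Finset.univ_nonempty (fun i => (P'' i * wP Z i).natAbs)
    have h2 : (n : ℝ) ≤ |(P'' i1 : ℝ)| * wP Z i1 := by
      have h2 : (nz (wP Z) P'' : ℤ) = |P'' i1| * wP Z i1 := by
        rw [nz, hi1, Int.natCast_natAbs, abs_mul, abs_of_pos (by linarith [hw i1] : 0 < wP Z i1)]
      have h3 : (n : ℤ) ≤ |P'' i1| * wP Z i1 := by rw [← h2]; exact_mod_cast h1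
      exact_mod_cast h3
    have hwi : (0 : ℝ) < wP Z i1 := by exact_mod_cast (by linarith [hw i1] : 0 < wP Z i1)
    have h3 : (n : ℝ) ≤ (3 / (J * τ1) + τ1 / 2) * W := by
      rw [← hwZ i1]
      refine h2.trans ?_
      have := mul_le_mul_of_nonneg_right (hP''b i1) hwi.le
      linarith
    have h4 : τ1 ≤ 3 / (J * τ1) + τ1 / 2 := by
      rw [hτ, div_le_iff₀ hWpos]; exact h3
    have h5 : τ1 / 2 ≤ 3 / (J * τ1) := by linarith
    rw [le_div_iff₀ (by positivity)] at h5
    rw [le_div_iff₀ hJ]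
    nlinarith
  · funext i
    rw [hP'', hR0, hP']
    simp only [Pi.add_apply, Pi.smul_apply, smul_eq_mul, Pi.sub_apply]
    linear_combination (-(p i)) * hbez

/-- Exceptional fibres. -/
lemma exceptional {q : ℕ} {s t a1 a2 : ℤ} {Z : Fin 4 → ℤ} {Γ : AddSubgroup (Fin 4 → ℤ)} {T : Finset (Fin 4 → ℤ)}
    {K : ℝ} {p r : Fin 4 → ℤ} {e e' h J : ℕ} (hq : 0 < q) (hZ : ∀ i, 1 ≤ Z i)
    (F : FibData q s t a1 a2 Z Γ T K p r e e' h J) (hpΓ : p ∈ Γ) (hΓ : ∀ w ∈ Γ, (q : ℤ) ∣ w 2 - t * w 3)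
    (hfp : fq a1 a2 p ≠ 0) {τ B : ℝ} (hτ : 0 < τ) 
    (hns : ∀ z1 z2 : ℤ, (z1 ≠ 0 ∨ z2 ≠ 0) → |(z1 : ℝ)| ≤ τ * Z 2 → |(z2 : ℝ)| ≤ τ * Z 3 → ¬ (q : ℤ) ∣ p 2 * z2 - z1 * p 3)
    (hB1 : |(a1 : ℝ)| * Z 0 ^ 2 * Z 2 ^ 3 ≤ B) (hB2 : |(a2 : ℝ)| * Z 1 ^ 2 * Z 3 ^ 3 ≤ B) :
    (e' : ℝ) ^ 3 ≤ 2 * B * (9 / √J + 15 / (J * τ)) ^ 5 := by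
  have hne := (F.mnne hq).2
  have hJR : (0 : ℝ) < J := by exact_mod_cast F.J1
  obtain ⟨P', hP', P'', hP'', τ1, hτ1, hP'0, hb', hb'', hτ6, m, n, hpe⟩ := short_basis hZ Γ hpΓ F.rL F.gen hne hJR (by
    intro i k; exact_mod_cast F.mb i k)
  have hge : τ ≤ τ1 := by
    by_contra hlt
    push Not at hlt
    have hz2 : (0 : ℝ) < Z 2 := by exact_mod_cast (by linarith [hZ 2] : 0 < Z 2)
    have hz3 : (0 : ℝ) < Z 3 := by exact_mod_cast (by linarith [hZ 3] : 0 < Z 3)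
    refine hns (P' 2) (P' 3) ?_ ((hb' 2).trans (by gcongr)) ((hb' 3).trans (by gcongr)) ?_
    · by_contra hcon
      push Not at hcon
      obtain ⟨c2, c3⟩ := hcon
      obtain ⟨x, y, hxy⟩ := F.gen P' hP'
      rw [hxy] at c2 c3
      simp only [Pi.add_apply, Pi.smul_apply, smul_eq_mul] at c2 c3
      have hx : x * mn p r 2 3 = 0 := by rw [mn]; linear_combination r 3 * c2 - r 2 * c3
      have hy : y * mn p r 2 3 = 0 := by rw [mn]; linear_combination p 2 * c3 - p 3 * c2
      have hx := (mul_eq_zero.mp hx).resolve_right hne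
      have hy := (mul_eq_zero.mp hy).resolve_right hne
      apply hP'0; rw [hxy, hx, hy]; simp
    · have h1 := hΓ p hpΓ
      have h2 := hΓ P' hP'
      exact dvdE (dvd_sub (h1.mul_right (P' 3)) (h2.mul_right (p 3))) (by ring)
  set κ : ℝ := 9 / √J + 15 / (J * τ) with hκ
  have hsJ : 0 < √(J : ℝ) := Real.sqrt_pos.mpr hJR
  have hκb : τ1 + 5 * (3 / (J * τ1) + τ1 / 2) ≤ κ := by
    have h1 : τ1 ≤ (5 / 2) / √J := by
      rw [le_div_iff₀ hsJ]
      have : (τ1 * √J) ^ 2 ≤ (5 / 2) ^ 2 := by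
        rw [mul_pow, Real.sq_sqrt hJR.le]
        rw [le_div_iff₀ hJR] at hτ6; linarith
      exact le_of_sq_le_sq this (by norm_num)
    have h2 : 3 / (J * τ1) ≤ 3 / (J * τ) := by gcongr
    have h3 : κ = (18 / 5) * ((5 / 2) / √J) + 5 * (3 / (J * τ)) := by rw [hκ]; ring
    have h4 : 0 < 5 / 2 / √(J : ℝ) := by positivity
    rw [h3]; linarith
  by_contra hlt
  push Not at hlt
  have hzero : ∀ k : Fin 6, fq a1 a2 (P' + ((k : ℕ) : ℤ) • P'') = 0 := by
    intro k
    have hmem : P' + ((k : ℕ) : ℤ) • P'' ∈ Γ := Γ.add_mem hP' (Γ.zsmul_mem hP'' _)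
    set R := P' + ((k : ℕ) : ℤ) • P'' with hR
    have hdv := F.f R hmem
    have hb : ∀ i, |(R i : ℝ)| ≤ κ * Z i := by
      intro i
      have hzi : (0 : ℝ) < Z i := by exact_mod_cast (by linarith [hZ i] : 0 < Z i)
      have e1 : (R i : ℝ) = P' i + (k : ℕ) * P'' i := by rw [hR]; simp
      have hk5 : ((k : ℕ) : ℝ) ≤ 5 := by
        have := k.2
        exact_mod_cast (by omega : (k : ℕ) ≤ 5)
      rw [e1]
      calc |(P' i : ℝ) + (k : ℕ) * P'' i| ≤ |(P' i : ℝ)| + |((k : ℕ) : ℝ) * P'' i| := abs_add_le _ _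
        _ = |(P' i : ℝ)| + ((k : ℕ) : ℝ) * |(P'' i : ℝ)| := by rw [abs_mul, Nat.abs_cast]
        _ ≤ τ1 * Z i + 5 * ((3 / (J * τ1) + τ1 / 2) * Z i) := by
          have := hb' i; have := hb'' i
          gcongr
        _ = (τ1 + 5 * (3 / (J * τ1) + τ1 / 2)) * Z i := by ring
        _ ≤ κ * Z i := by gcongr
    have hκ0 : 0 ≤ κ := by positivity
    have hsz : |(fq a1 a2 R : ℝ)| ≤ 2 * B * κ ^ 5 := by
      rw [fq]; push_cast
      have hZR : ∀ i, (0 : ℝ) < Z i := fun i => by exact_mod_cast (by linarith [hZ i] : 0 < Z i)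
      have g : ∀ (c : ℝ) (i l : Fin 4), |c| * Z i ^ 2 * Z l ^ 3 ≤ B → |c * (R i : ℝ) ^ 2 * (R l : ℝ) ^ 3| ≤ B * κ ^ 5 := by
        intro c i l hc
        rw [abs_mul, abs_mul, abs_pow, abs_pow]
        have z1 := hZR i; have z2 := hZR l
        calc |c| * |(R i : ℝ)| ^ 2 * |(R l : ℝ)| ^ 3 ≤ |c| * (κ * Z i) ^ 2 * (κ * Z l) ^ 3 := by
              have := hb i; have := hb l
              gcongr
          _ = (|c| * Z i ^ 2 * Z l ^ 3) * κ ^ 5 := by ring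
          _ ≤ B * κ ^ 5 := by gcongr
      refine (abs_add_le _ _).trans ?_
      linarith [g a1 0 2 hB1, g a2 1 3 hB2]
    by_contra h0
    have h1 := Int.le_of_dvd (abs_pos.mpr h0) ((dvd_abs _ _).mpr hdv)
    have h2 : (e' : ℝ) ^ 3 ≤ |(fq a1 a2 R : ℝ)| := by exact_mod_cast h1
    linarith
  apply hfp
  rw [hpe]
  exact fvanish hzero m n

set_option linter.unusedVariables false

open Filter in
lemma ev_const (c δ : ℝ) (hδ : 0 < δ) : ∀ᶠ B : ℝ in atTop, c ≤ B ^ δ :=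
  (tendsto_rpow_atTop hδ).eventually_ge_atTop c

lemma rp_pow {B x a : ℝ} (hB : 0 ≤ B) (hx : 0 ≤ x) (h : x ≤ B ^ a) (n : ℕ) : x ^ n ≤ B ^ (a * n) := by
  rw [Real.rpow_mul hB, Real.rpow_natCast]
  exact pow_le_pow_left₀ hx h n

lemma rp_root {B x a : ℝ} (hB : 0 ≤ B) (n : ℕ) (hn : n ≠ 0) (h : x ^ n ≤ B ^ (a * n)) : x ≤ B ^ a := by
  rw [Real.rpow_mul hB, Real.rpow_natCast] at h
  exact le_of_pow_le_pow_left₀ hn (by positivity) h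

/-- sizes in a class -/
structure Szs (q : ℕ) (a1 a2 : ℤ) (Z : Fin 4 → ℤ) (B : ℝ) : Prop where
  q1 : B ^ (0.1975 : ℝ) ≤ 6 * q
  q2 : (q : ℝ) ≤ 2 * B ^ (0.20125 : ℝ)
  W : (Z 0 * Z 1 * Z 2 * Z 3 : ℝ) ≤ B ^ (0.802 : ℝ)
  Y : (Z 2 * Z 3 : ℝ) ≤ B ^ (0.4025 : ℝ)
  B1 : |(a1 : ℝ)| * Z 0 ^ 2 * Z 2 ^ 3 ≤ B
  B2 : |(a2 : ℝ)| * Z 1 ^ 2 * Z 3 ^ 3 ≤ B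

/-- nonskew -/
def NSk (q : ℕ) (Z : Fin 4 → ℤ) (B : ℝ) (P : Fin 4 → ℤ) : Prop :=
  ∀ z1 z2 : ℤ, (z1 ≠ 0 ∨ z2 ≠ 0) → |(z1 : ℝ)| ≤ B ^ (-0.105 : ℝ) * Z 2 → |(z2 : ℝ)| ≤ B ^ (-0.105 : ℝ) * Z 3 →
    ¬ (q : ℤ) ∣ P 2 * z2 - z1 * P 3

lemma fib_count {q Pr s t a1 a2 Z S} (cls : Cls q Pr s t a1 a2 Z S) {B : ℝ} (hB : 1 ≤ B)
    (hbig : 2 * 24 ^ 5 * 108 ^ 3 + 1 ≤ B ^ (0.0085 : ℝ)) (sz : Szs q a1 a2 Z B) (hns : ∀ P ∈ S, NSk q Z B P)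
    {T : Finset (Fin 4 → ℤ)} (hT : T ⊆ S)
    {u : Fin 4 → ℤ} {G : ℤ} (hG : G ≠ 0) (hL : ∀ P ∈ T, P ∈ LatU q s t u G) (hm : ∀ P ∈ T, MinF (Dl q s t) (wZ Z) P u) :
    ∃ x : ℝ, 0 ≤ x ∧ (T.card : ℝ) ≤ 5 ^ Pr.card * (2 * x + 1) ∧ x ≤ B ^ (0.1945 : ℝ) ∧
      ((nz (wZ Z) u : ℝ) * q ^ 2 * x ^ 2) ^ 2 ≤ 81 * (Z 0 * Z 1 * Z 2 * Z 3 : ℝ) ^ 3 := by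
  have hB0 : 0 < B := by linarith
  have hZR : ∀ i, (0 : ℝ) < Z i := fun i => by exact_mod_cast (by linarith [cls.Z1 i] : 0 < Z i)
  have z0 := hZR 0; have z1 := hZR 1; have z2 := hZR 2; have z3 := hZR 3
  rcases fib_data cls hT hG hL with h | ⟨p, r, e, e', h, J, F⟩
  · refine ⟨0, le_rfl, by simpa using h, by positivity, ?_⟩
    have : ((nz (wZ Z) u : ℝ) * q ^ 2 * 0 ^ 2) ^ 2 = 0 := by ring
    rw [this]
    positivity
  have hq := cls.q0
  have hqR : (0 : ℝ) < q := by exact_mod_cast hq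
  have hJR : (0 : ℝ) < J := by exact_mod_cast F.J1
  have heR : (1 : ℝ) ≤ e := by exact_mod_cast F.e1
  have he0 : (0 : ℝ) < e := by linarith
  refine ⟨J / e, by positivity, F.card, ?_, ?_⟩
  · by_contra hlt
    push Not at hlt
    rw [lt_div_iff₀ he0] at hlt
    have hex := exceptional hq cls.Z1 F (hL p F.pT) (fun w hw => (mem_LatU.mp hw).2.2.2) (cls.fne p (hT F.pT))
      (τ := B ^ (-0.105 : ℝ)) (B := B) (by positivity) (hns p (hT F.pT)) sz.B1 sz.B2
    have hJb : B ^ (0.1945 : ℝ) ≤ J := by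
      have : 0 < B ^ (0.1945 : ℝ) := by positivity
      nlinarith
    have hβ : 0 < B ^ (0.0895 : ℝ) := by positivity
    have h1 : B ^ (0.0895 : ℝ) ≤ √J := by
      apply Real.le_sqrt_of_sq_le
      rw [← Real.rpow_natCast, ← Real.rpow_mul hB0.le]
      refine le_trans ?_ hJb
      apply Real.rpow_le_rpow_of_exponent_le hB; norm_num
    have h2 : B ^ (0.0895 : ℝ) ≤ J * B ^ (-0.105 : ℝ) := by
      have : B ^ (0.0895 : ℝ) = B ^ (0.1945 : ℝ) * B ^ (-0.105 : ℝ) := by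
        rw [← Real.rpow_add hB0]; norm_num
      rw [this]
      gcongr
    have h3 : 9 / √(J : ℝ) + 15 / (J * B ^ (-0.105 : ℝ)) ≤ 24 / B ^ (0.0895 : ℝ) := by
      have g1 : 9 / √(J : ℝ) ≤ 9 / B ^ (0.0895 : ℝ) := by gcongr
      have g2 : 15 / (J * B ^ (-0.105 : ℝ)) ≤ 15 / B ^ (0.0895 : ℝ) := by gcongr
      have : 24 / B ^ (0.0895 : ℝ) = 9 / B ^ (0.0895 : ℝ) + 15 / B ^ (0.0895 : ℝ) := by ring
      linarith
    have h4 : (e' : ℝ) ^ 3 ≤ 2 * B * (24 / B ^ (0.0895 : ℝ)) ^ 5 := hex.trans (by gcongr)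
    have h5 : 2 * B * (24 / B ^ (0.0895 : ℝ)) ^ 5 = 2 * 24 ^ 5 * B ^ (0.5525 : ℝ) := by
      have : B ^ (0.5525 : ℝ) * (B ^ (0.0895 : ℝ)) ^ 5 = B := by
        rw [← Real.rpow_natCast, ← Real.rpow_mul hB0.le, ← Real.rpow_add hB0]
        norm_num
      rw [div_pow, mul_div_assoc', div_eq_iff (by positivity)]
      linear_combination (-(2 * 24 ^ 5)) * this
    rw [h5] at h4
    -- lower bound for e'
    have hqJ : (q : ℝ) * J ≤ 3 * B ^ (0.4025 : ℝ) := by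
      have a2 : (q : ℤ) * h ^ 2 * J ≤ 3 * (Z 2 * Z 3) := le_trans (by gcongr; exact F.hy) (F.mb 2 3)
      have a3 : (q : ℝ) * h ^ 2 * J ≤ 3 * (Z 2 * Z 3) := by exact_mod_cast a2
      have hh : (1 : ℝ) ≤ (h : ℝ) ^ 2 := one_le_pow₀ (by exact_mod_cast F.h1)
      have := mul_pos hqR hJR
      have := sz.Y
      nlinarith
    have hqe : (q : ℝ) = e * e' := by exact_mod_cast F.qe
    have he'0 : (0 : ℝ) ≤ e' := Nat.cast_nonneg _
    have h6 : (q : ℝ) ^ 2 * B ^ (0.1945 : ℝ) ≤ 3 * B ^ (0.4025 : ℝ) * e' := by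
      calc (q : ℝ) ^ 2 * B ^ (0.1945 : ℝ) = q * (B ^ (0.1945 : ℝ) * e) * e' := by rw [hqe]; ring
        _ ≤ q * J * e' := by gcongr
        _ ≤ _ := by gcongr
    have h7 : B ^ (0.187 : ℝ) ≤ 108 * e' := by
      have g1 : (B ^ (0.1975 : ℝ)) ^ 2 ≤ (6 * q) ^ 2 := by gcongr; exact sz.q1
      have g2 : (B ^ (0.1975 : ℝ)) ^ 2 * B ^ (0.1945 : ℝ) = B ^ (0.187 : ℝ) * B ^ (0.4025 : ℝ) := by
        rw [← Real.rpow_natCast, ← Real.rpow_mul hB0.le, ← Real.rpow_add hB0, ← Real.rpow_add hB0]; norm_num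
      have g3 : B ^ (0.187 : ℝ) * B ^ (0.4025 : ℝ) ≤ (108 * e') * B ^ (0.4025 : ℝ) := by
        rw [← g2]
        calc _ ≤ (6 * (q : ℝ)) ^ 2 * B ^ (0.1945 : ℝ) := by gcongr
          _ = 36 * (q ^ 2 * B ^ (0.1945 : ℝ)) := by ring
          _ ≤ 36 * (3 * B ^ (0.4025 : ℝ) * e') := by gcongr
          _ = _ := by ring
      exact le_of_mul_le_mul_right g3 (by positivity)
    have h8 : B ^ (0.0085 : ℝ) * B ^ (0.5525 : ℝ) ≤ (2 * 24 ^ 5 * 108 ^ 3) * B ^ (0.5525 : ℝ) := by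
      have : B ^ (0.0085 : ℝ) * B ^ (0.5525 : ℝ) = (B ^ (0.187 : ℝ)) ^ 3 := by
        rw [← Real.rpow_natCast, ← Real.rpow_mul hB0.le, ← Real.rpow_add hB0]; norm_num
      rw [this]
      calc (B ^ (0.187 : ℝ)) ^ 3 ≤ (108 * e') ^ 3 := by gcongr
        _ = 108 ^ 3 * (e' : ℝ) ^ 3 := by ring
        _ ≤ 108 ^ 3 * (2 * 24 ^ 5 * B ^ (0.5525 : ℝ)) := by gcongr
        _ = _ := by ring
    have h9 := le_of_mul_le_mul_right h8 (by positivity)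
    linarith
  · have := min_bound hq cls.Z1 F hm
    have e4 : ((nz (wZ Z) u : ℝ) * q ^ 2 * (J / e : ℝ) ^ 2) ^ 2 = ((nz (wZ Z) u : ℝ) * q ^ 2 * J ^ 2) ^ 2 / e ^ 4 := by
      field_simp
    rw [e4, div_le_iff₀ (by positivity)]
    exact this

/-- For every point there is a minimal form. -/
lemma Cls.minF {q Pr s t a1 a2 Z S} (cls : Cls q Pr s t a1 a2 Z S) {P : Fin 4 → ℤ} (hP : P ∈ S) :
    ∃ u, MinF (Dl q s t) (wZ Z) P u := by
  apply exists_min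
  have hq : (0 : ℤ) < q := by exact_mod_cast cls.q0
  have h1 : 0 < P 1 := lt_of_lt_of_le (by linarith [cls.Z1 1]) (cls.lo P hP 1)
  refine ⟨![q ^ 3 * P 1, 0, -(q ^ 3 * P 0), 0], ?_, ?_, ?_⟩
  · refine mem_Dl.mpr ⟨?_, ?_, ?_⟩ <;> simp only [Matrix.cons_val]
    · exact ⟨P 1 * s * t - P 0 * t, by ring⟩
    · exact ⟨2 * t * q * (P 1 * s - P 0) - 3 * s * (q * P 1 * t), by ring⟩
    · exact ⟨4 * t * q ^ 2 * P 1 - 5 * q ^ 2 * P 1 * t, by ring⟩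
  · intro h0
    have := congrFun h0 0
    simp only [Matrix.cons_val, Pi.zero_apply] at this
    have : 0 < (q : ℤ) ^ 3 * P 1 := by positivity
    omega
  · rw [Ev]; simp only [Matrix.cons_val]; ring

lemma Cls.mc {q Pr s t a1 a2 Z S} (cls : Cls q Pr s t a1 a2 Z S) {P u : Fin 4 → ℤ} (hP : P ∈ S)
    (hm : MinF (Dl q s t) (wZ Z) P u) :
    ((Rf (Dl q s t) (wZ Z) (nz (wZ Z) u)).card : ℝ) ≤ 9 ^ 4 * (8 * nz (wZ Z) u / (q : ℝ) ^ 3 + 1) ∧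
    (nz (wZ Z) u : ℝ) ^ 4 ≤ 256 * (8 * nz (wZ Z) u / (q : ℝ) ^ 3 + 1) * (q : ℝ) ^ 6 * (Z 0 * Z 1 * Z 2 * Z 3 : ℝ) ^ 2 := by
  have hZR : ∀ i, (0 : ℝ) < Z i := fun i => by exact_mod_cast (by linarith [cls.Z1 i] : 0 < Z i)
  have hpr : ∏ i, (wZ Z i : ℝ) = (Z 0 * Z 1 * Z 2 * Z 3 : ℝ) ^ 2 := by
    rw [Fin.prod_univ_four]; simp only [wZ, Matrix.cons_val]; push_cast; ring
  rw [← hpr]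
  refine min_count cls.q0 (wZ_pos cls.Z1) ?_ ?_ hm
  · intro v hv
    refine Dl_dvd hv ?_ ?_ (cls.ax P hP) (cls.ay P hP) (cls.L P hP)
    · exact cls.cop 2 fun p hp h => cls.n6 p hp (h.trans (by norm_num))
    · exact cls.cop t cls.ut
  · intro ρ v hv
    have hb : ∀ i, |(P i : ℝ)| ≤ 2 * Z i := by
      intro i
      have h1 := cls.lo P hP i
      have h2 := cls.hi P hP i
      have h3 := cls.Z1 i
      rw [abs_of_nonneg (by exact_mod_cast (by linarith : 0 ≤ P i))]
      exact_mod_cast h2.le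
    have g : ∀ (c : ℝ) (i l : Fin 4), |c| * (Z i * Z l) ≤ ρ → |c * P i * P l| ≤ 4 * ρ := by
      intro c i l hc
      rw [abs_mul, abs_mul]
      have z1 := hZR i; have z2 := hZR l
      calc |c| * |(P i : ℝ)| * |(P l : ℝ)| ≤ |c| * (2 * Z i) * (2 * Z l) := by
            have := hb i; have := hb l; gcongr
        _ = 4 * (|c| * (Z i * Z l)) := by ring
        _ ≤ 4 * ρ := by linarith
    have e : ((Ev v P : ℤ) : ℝ) = v 0 * P 0 * P 2 + v 1 * P 0 * P 3 + v 2 * P 1 * P 2 + v 3 * P 1 * P 3 := by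
      rw [Ev]; push_cast; ring
    have v0 := hv 0; have v1 := hv 1; have v2 := hv 2; have v3 := hv 3
    simp only [wZ, Matrix.cons_val] at v0 v1 v2 v3
    push_cast at v0 v1 v2 v3
    rw [e]
    have h0 := abs_le.mp (g _ 0 2 v0)
    have h1 := abs_le.mp (g _ 0 3 v1)
    have h2 := abs_le.mp (g _ 1 2 v2)
    have h3 := abs_le.mp (g _ 1 3 v3)
    rw [abs_le]
    constructor <;> linarith [h0.1, h0.2, h1.1, h1.2, h2.1, h2.2, h3.1, h3.2]

set_option linter.unusedVariables false

/-- All conditions B is large used in the class count. -/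
structure BigC (B : ℝ) : Prop where
  two : 2 ≤ B
  b1 : 2 * 24 ^ 5 * 108 ^ 3 + 1 ≤ B ^ (0.0085 : ℝ)
  qB : 2 * B ^ (0.20125 : ℝ) ≤ B
  om : ∀ q : ℕ, q ≠ 0 → (q : ℝ) ≤ B → (5 : ℝ) ^ q.primeFactors.card ≤ B ^ (0.00005 : ℝ)
  dv : ∀ D : ℕ, (D : ℝ) ≤ B ^ (3 : ℝ) → 2 * ((D.divisors.card : ℝ) + 1) ≤ B ^ (0.00005 : ℝ)
  lev : ∀ L : ℕ, (2 : ℝ) ^ L ≤ B → (L : ℝ) + 1 ≤ B ^ (0.0001 : ℝ)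
  c1 : 9 ^ 4 * 17 * 3 ≤ B ^ (0.0001 : ℝ)
  c2 : 324 ^ 3 * 2304 ^ 2 * 6 ^ 42 ≤ B ^ (0.2 : ℝ)
  c3 : 2304 * 64 ≤ B ^ (0.18 : ℝ)
  c4 : 2304 * 6 ^ 6 ≤ B ^ (0.16 : ℝ)

open Filter in
lemma bigC : ∀ᶠ B : ℝ in atTop, BigC B := by
  obtain ⟨C1, hC1, h1⟩ := omega_bound 5 0.00001 (by norm_num)
  obtain ⟨C2, hC2, h2⟩ := divisor_bound 0.00001 (by norm_num)
  filter_upwards [eventually_ge_atTop 2, ev_const (2 * 24 ^ 5 * 108 ^ 3 + 1) 0.0085 (by norm_num),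
    ev_const 2 0.79 (by norm_num), ev_const C1 0.00004 (by norm_num), ev_const (4 * C2) 0.00002 (by norm_num),
    ev_const (2 / 0.00005 + 1) 0.00005 (by norm_num),
    ev_const (9 ^ 4 * 17 * 3) 0.0001 (by norm_num), ev_const (324 ^ 3 * 2304 ^ 2 * 6 ^ 42) 0.2 (by norm_num),
    ev_const (2304 * 64) 0.18 (by norm_num), ev_const (2304 * 6 ^ 6) 0.16 (by norm_num)] with B hB g1 g2 g3 g4 g5 g6 g7 g8 g9
  have hB0 : 0 < B := by linarith
  have hB1 : 1 ≤ B := by linarith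
  refine ⟨hB, g1, ?_, ?_, ?_, ?_, g6, g7, g8, g9⟩
  · calc 2 * B ^ (0.20125 : ℝ) ≤ B ^ (0.79 : ℝ) * B ^ (0.20125 : ℝ) := by gcongr
      _ = B ^ (0.99125 : ℝ) := by rw [← Real.rpow_add hB0]; norm_num
      _ ≤ B ^ (1 : ℝ) := Real.rpow_le_rpow_of_exponent_le hB1 (by norm_num)
      _ = B := Real.rpow_one B
  · intro q hq hqB
    calc (5 : ℝ) ^ q.primeFactors.card ≤ C1 * (q : ℝ) ^ (0.00001 : ℝ) := by exact_mod_cast h1 q hq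
      _ ≤ B ^ (0.00004 : ℝ) * B ^ (0.00001 : ℝ) := by gcongr
      _ = B ^ (0.00005 : ℝ) := by rw [← Real.rpow_add hB0]; norm_num
  · intro D hD
    have hb1 : 1 ≤ B ^ (0.00003 : ℝ) := Real.one_le_rpow hB1 (by norm_num)
    have hd : (D.divisors.card : ℝ) ≤ C2 * B ^ (0.00003 : ℝ) := by
      by_cases h0 : D = 0
      · rw [h0]; simp; positivity
      · calc (D.divisors.card : ℝ) ≤ C2 * (D : ℝ) ^ (0.00001 : ℝ) := h2 D h0
          _ ≤ C2 * (B ^ (3 : ℝ)) ^ (0.00001 : ℝ) := by gcongr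
          _ = C2 * B ^ (0.00003 : ℝ) := by rw [← Real.rpow_mul hB0.le]; norm_num
    calc 2 * ((D.divisors.card : ℝ) + 1) ≤ (4 * C2) * B ^ (0.00003 : ℝ) := by nlinarith
      _ ≤ B ^ (0.00002 : ℝ) * B ^ (0.00003 : ℝ) := by gcongr
      _ = B ^ (0.00005 : ℝ) := by rw [← Real.rpow_add hB0]; norm_num
  · intro L hL
    have l1 := Real.log_le_log (by positivity) hL
    rw [Real.log_pow] at l1
    have l2 := Real.log_two_gt_d9
    have l3 := Real.log_le_rpow_div hB0.le (show (0 : ℝ) < 0.00005 by norm_num)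
    have hb1 : 1 ≤ B ^ (0.00005 : ℝ) := Real.one_le_rpow hB1 (by norm_num)
    have hL0 : (0 : ℝ) ≤ L := Nat.cast_nonneg _
    have l4 : (L : ℝ) ≤ 2 * (B ^ (0.00005 : ℝ) / 0.00005) := by nlinarith
    calc (L : ℝ) + 1 ≤ (2 / 0.00005 + 1) * B ^ (0.00005 : ℝ) := by
          have : 2 * (B ^ (0.00005 : ℝ) / 0.00005) = (2 / 0.00005) * B ^ (0.00005 : ℝ) := by ring
          linarith
      _ ≤ B ^ (0.00005 : ℝ) * B ^ (0.00005 : ℝ) := by gcongr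
      _ = B ^ (0.0001 : ℝ) := by rw [← Real.rpow_add hB0]; norm_num

lemma root12 {B W q y ν : ℝ} (hB : 0 < B) (hq : 0 < q) (hy : 0 ≤ y) (hν : 0 < ν) (hW0 : 0 < W) (hW : W ≤ B ^ (0.802 : ℝ))
    (hq1 : B ^ (0.1975 : ℝ) ≤ 6 * q) (c2 : 324 ^ 3 * 2304 ^ 2 * 6 ^ 42 ≤ B ^ (0.2 : ℝ)) 
    (hyv : y ^ 4 * ν ^ 2 * q ^ 10 = 324 * W ^ 3) (hνb : ν ^ 3 * q ^ 6 ≤ 2304 * W ^ 2) :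
    y * ν ≤ B ^ (0.1945 : ℝ) := by
  apply rp_root hB.le 12 (by norm_num)
  have h1 : (y * ν) ^ 12 * q ^ 42 ≤ 324 ^ 3 * 2304 ^ 2 * W ^ 13 := by
    have : (y * ν) ^ 12 * q ^ 42 = (y ^ 4 * ν ^ 2 * q ^ 10) ^ 3 * (ν ^ 3 * q ^ 6) ^ 2 := by ring
    rw [this, hyv]
    calc (324 * W ^ 3) ^ 3 * (ν ^ 3 * q ^ 6) ^ 2 ≤ (324 * W ^ 3) ^ 3 * (2304 * W ^ 2) ^ 2 := by gcongr
      _ = _ := by ring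
  have h2 : W ^ 13 ≤ B ^ ((0.802 : ℝ) * (13 : ℕ)) := rp_pow hB.le hW0.le hW 13
  have h3 : (B ^ (0.1975 : ℝ)) ^ 42 ≤ 6 ^ 42 * q ^ 42 := by
    rw [← mul_pow]; gcongr
  have h3' : (B ^ (0.1975 : ℝ)) ^ 42 = B ^ (8.295 : ℝ) := by
    rw [← Real.rpow_natCast, ← Real.rpow_mul hB.le]; norm_num
  rw [h3'] at h3
  have h4 : (y * ν) ^ 12 * B ^ (8.295 : ℝ) ≤ B ^ (2.334 : ℝ) * B ^ (8.295 : ℝ) := by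
    calc (y * ν) ^ 12 * B ^ (8.295 : ℝ) ≤ (y * ν) ^ 12 * (6 ^ 42 * q ^ 42) := by gcongr
      _ = 6 ^ 42 * ((y * ν) ^ 12 * q ^ 42) := by ring
      _ ≤ 6 ^ 42 * (324 ^ 3 * 2304 ^ 2 * B ^ ((0.802 : ℝ) * (13 : ℕ))) := by
        exact mul_le_mul_of_nonneg_left (h1.trans (mul_le_mul_of_nonneg_left h2 (by positivity))) (by positivity)
      _ = (324 ^ 3 * 2304 ^ 2 * 6 ^ 42) * B ^ ((0.802 : ℝ) * (13 : ℕ)) := by ring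
      _ ≤ B ^ (0.2 : ℝ) * B ^ ((0.802 : ℝ) * (13 : ℕ)) := by gcongr
      _ = B ^ (10.626 : ℝ) := by rw [← Real.rpow_add hB]; norm_num
      _ ≤ _ := by
        rw [← Real.rpow_add hB]
        apply le_of_eq_of_le (b := B ^ (10.626 : ℝ)) rfl
        apply Real.rpow_le_rpow_of_exponent_le _ (by norm_num)
        by_contra hlt
        push Not at hlt
        have := Real.rpow_le_one hB.le hlt.le (show (0 : ℝ) ≤ 0.2 by norm_num)
        norm_num at c2
        linarith
  have h5 := le_of_mul_le_mul_right h4 (by positivity)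
  refine h5.trans ?_
  apply Real.rpow_le_rpow_of_exponent_le _ (by norm_num)
  by_contra hlt
  push Not at hlt
  have := Real.rpow_le_one hB.le hlt.le (show (0 : ℝ) ≤ 0.2 by norm_num)
  norm_num at c2
  linarith

lemma root3 {B W q ν : ℝ} (hB : 1 ≤ B) (hq : 0 < q) (hν : 0 < ν) (hW0 : 0 < W) (hW : W ≤ B ^ (0.802 : ℝ))
    (hq1 : B ^ (0.1975 : ℝ) ≤ 6 * q) (c4 : 2304 * 6 ^ 6 ≤ B ^ (0.16 : ℝ)) 
    (hνb : ν ^ 3 * q ^ 6 ≤ 2304 * W ^ 2) : ν ≤ B ^ (0.1945 : ℝ) := by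
  have hB0 : 0 < B := by linarith
  apply rp_root hB0.le 3 (by norm_num)
  have h2 : W ^ 2 ≤ B ^ ((0.802 : ℝ) * (2 : ℕ)) := rp_pow hB0.le hW0.le hW 2
  have h3 : (B ^ (0.1975 : ℝ)) ^ 6 ≤ 6 ^ 6 * q ^ 6 := by
    rw [← mul_pow]; gcongr
  have h3' : (B ^ (0.1975 : ℝ)) ^ 6 = B ^ (1.185 : ℝ) := by
    rw [← Real.rpow_natCast, ← Real.rpow_mul hB0.le]; norm_num
  rw [h3'] at h3
  have h4 : ν ^ 3 * B ^ (1.185 : ℝ) ≤ B ^ (0.58 : ℝ) * B ^ (1.185 : ℝ) := by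
    calc ν ^ 3 * B ^ (1.185 : ℝ) ≤ ν ^ 3 * (6 ^ 6 * q ^ 6) := by gcongr
      _ = 6 ^ 6 * (ν ^ 3 * q ^ 6) := by ring
      _ ≤ 6 ^ 6 * (2304 * B ^ ((0.802 : ℝ) * (2 : ℕ))) := by
        exact mul_le_mul_of_nonneg_left (hνb.trans (mul_le_mul_of_nonneg_left h2 (by positivity))) (by positivity)
      _ = (2304 * 6 ^ 6) * B ^ ((0.802 : ℝ) * (2 : ℕ)) := by ring
      _ ≤ B ^ (0.16 : ℝ) * B ^ ((0.802 : ℝ) * (2 : ℕ)) := by gcongr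
      _ = B ^ (1.764 : ℝ) := by rw [← Real.rpow_add hB0]; norm_num
      _ ≤ _ := by
        rw [← Real.rpow_add hB0]
        exact Real.rpow_le_rpow_of_exponent_le hB (by norm_num)
  refine (le_of_mul_le_mul_right h4 (by positivity)).trans ?_
  exact Real.rpow_le_rpow_of_exponent_le hB (by norm_num)

set_option maxHeartbeats 800000 in
lemma class_count {B : ℝ} (big : BigC B) {q Pr s t a1 a2 Z S} (cls : Cls q Pr s t a1 a2 Z S)
    (sz : Szs q a1 a2 Z B) (hns : ∀ P ∈ S, NSk q Z B P) : (S.card : ℝ) ≤ B ^ (0.1949 : ℝ) := by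
  classical
  have hB1 : 1 ≤ B := by linarith [big.two]
  have hB0 : 0 < B := by linarith
  have hq := cls.q0
  have hqR : (0 : ℝ) < q := by exact_mod_cast hq
  have hq1R : (1 : ℝ) ≤ q := by exact_mod_cast hq
  have hZR : ∀ i, (0 : ℝ) < Z i := fun i => by exact_mod_cast (by linarith [cls.Z1 i] : 0 < Z i)
  have z0 := hZR 0; have z1 := hZR 1; have z2 := hZR 2; have z3 := hZR 3
  set W : ℝ := (Z 0 * Z 1 * Z 2 * Z 3 : ℝ) with hW
  have hW0 : 0 < W := by positivity
  have hWb : W ≤ B ^ (0.802 : ℝ) := sz.W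
  have hw := wZ_pos cls.Z1
  have hex : ∀ P, ∃ u, P ∈ S → MinF (Dl q s t) (wZ Z) P u := by
    intro P
    by_cases hP : P ∈ S
    · obtain ⟨u, hu⟩ := cls.minF hP; exact ⟨u, fun _ => hu⟩
    · exact ⟨0, fun h => absurd h hP⟩
  choose uf huf using hex
  set nn : (Fin 4 → ℤ) → ℕ := fun P => nz (wZ Z) (uf P) with hnn
  have hn1 : ∀ P ∈ S, 1 ≤ nn P := fun P hP => nz_pos hw (huf P hP).ne
  -- omega
  have hom : (5 : ℝ) ^ Pr.card ≤ B ^ (0.00005 : ℝ) := by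
    have h1 := big.om q hq.ne' (sz.q2.trans big.qB)
    have h2 : q.primeFactors = Pr := by
      rw [cls.qP]; exact Nat.primeFactors_prod cls.prime
    rwa [h2] at h1
  -- size of forms
  have hnB : ∀ P ∈ S, (nn P : ℝ) ≤ B := by
    intro P hP
    have h1 := (cls.mc hP (huf P hP)).2
    have hn := hn1 P hP
    have hnR : (1 : ℝ) ≤ nn P := by exact_mod_cast hn
    change (nn P : ℝ) ^ 4 ≤ 256 * (8 * nn P / (q : ℝ) ^ 3 + 1) * (q : ℝ) ^ 6 * W ^ 2 at h1
    set n : ℝ := (nn P : ℝ) with hnd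
    have h2 : 8 * n / (q : ℝ) ^ 3 + 1 ≤ 9 * n := by
      have : 8 * n / (q : ℝ) ^ 3 ≤ 8 * n := div_le_self (by positivity) (one_le_pow₀ hq1R)
      linarith
    have h3 : n ^ 3 * n ≤ (2304 * (q : ℝ) ^ 6 * W ^ 2) * n := by
      calc n ^ 3 * n = n ^ 4 := by ring
        _ ≤ _ := h1
        _ ≤ 256 * (9 * n) * (q : ℝ) ^ 6 * W ^ 2 := by gcongr
        _ = _ := by ring
    have h4 : n ^ 3 ≤ 2304 * (q : ℝ) ^ 6 * W ^ 2 := le_of_mul_le_mul_right h3 (by linarith)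
    have h5 : n ≤ B ^ (1 : ℝ) := by
      apply rp_root hB0.le 3 (by norm_num)
      refine h4.trans ?_
      calc 2304 * (q : ℝ) ^ 6 * W ^ 2 ≤ 2304 * (2 * B ^ (0.20125 : ℝ)) ^ 6 * (B ^ (0.802 : ℝ)) ^ 2 := by
            have := sz.q2; gcongr
        _ = (2304 * 64) * (B ^ (0.20125 * (6 : ℕ) : ℝ) * B ^ (0.802 * (2 : ℕ) : ℝ)) := by
            rw [Real.rpow_mul hB0.le, Real.rpow_mul hB0.le, Real.rpow_natCast, Real.rpow_natCast]; ring
        _ ≤ B ^ (0.18 : ℝ) * (B ^ (0.20125 * (6 : ℕ) : ℝ) * B ^ (0.802 * (2 : ℕ) : ℝ)) := by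
            have := big.c3; gcongr
        _ = B ^ (2.9915 : ℝ) := by rw [← Real.rpow_add hB0, ← Real.rpow_add hB0]; norm_num
        _ ≤ _ := Real.rpow_le_rpow_of_exponent_le hB1 (by norm_num)
    rwa [Real.rpow_one] at h5
  -- divisor factor
  have hdiv : ∀ P ∈ S, 2 * ((((uf P 0 * uf P 3 - uf P 1 * uf P 2).natAbs.divisors.card : ℕ) : ℝ) + 1) ≤ B ^ (0.00005 : ℝ) := by
    intro P hP
    apply big.dv
    have hn := hnB P hP
    have hub : ∀ i, |(uf P i : ℝ)| ≤ B := by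
      intro i
      have h1 := le_nz hw (u := uf P) i
      have h2 : (1 : ℝ) ≤ wZ Z i := by exact_mod_cast hw i
      have h3 := abs_nonneg (uf P i : ℝ)
      have h4 : (nz (wZ Z) (uf P) : ℝ) ≤ B := hn
      nlinarith
    rw [Nat.cast_natAbs]; push_cast
    have := hub 0; have := hub 1; have := hub 2; have := hub 3
    calc |(uf P 0 : ℝ) * uf P 3 - uf P 1 * uf P 2| ≤ |(uf P 0 : ℝ) * uf P 3| + |(uf P 1 : ℝ) * uf P 2| := abs_sub _ _
      _ ≤ B * B + B * B := by rw [abs_mul, abs_mul]; gcongr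
      _ ≤ B ^ 3 := by nlinarith [big.two, mul_pos hB0 hB0]
      _ = B ^ (3 : ℝ) := by rw [← Real.rpow_natCast]; norm_num
  -- count for fixed form
  have hperu : ∀ P0 ∈ S, ∀ y : ℝ, 0 ≤ y → (∀ x : ℝ, 0 ≤ x → x ≤ B ^ (0.1945 : ℝ) →
      ((nn P0 : ℝ) * q ^ 2 * x ^ 2) ^ 2 ≤ 81 * W ^ 3 → x ≤ y) →
      ((S.filter (fun P => uf P = uf P0)).card : ℝ) ≤ B ^ (0.0001 : ℝ) * (2 * y + 1) := by
    intro P0 hP0 y hy hxy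
    have h5 : (1 : ℝ) ≤ 5 ^ Pr.card := one_le_pow₀ (by norm_num)
    have h1 := fixed_u cls (huf P0 hP0).ne (T := S.filter (fun P => uf P = uf P0)) (Finset.filter_subset _ _) (by
      intro P hP
      obtain ⟨hP, he⟩ := Finset.mem_filter.mp hP
      rw [← he]; exact (huf P hP).ev) (5 ^ Pr.card * (2 * y + 1)) (by nlinarith) (by
      intro T' hT' G hG hL
      obtain ⟨x, hx0, hx1, hx2, hx3⟩ := fib_count cls hB1 big.b1 sz hns (hT'.trans (Finset.filter_subset _ _)) hG hL (by
        intro P hP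
        obtain ⟨hP, he⟩ := Finset.mem_filter.mp (hT' hP)
        rw [← he]; exact huf P hP)
      have := hxy x hx0 hx2 hx3
      refine hx1.trans ?_
      gcongr)
    refine h1.trans ?_
    calc 5 ^ Pr.card * (2 * y + 1) * (2 * ((((uf P0 0 * uf P0 3 - uf P0 1 * uf P0 2).natAbs.divisors.card : ℕ) : ℝ) + 1))
        ≤ B ^ (0.00005 : ℝ) * (2 * y + 1) * B ^ (0.00005 : ℝ) := by
          have := hdiv P0 hP0
          gcongr
      _ = (B ^ (0.00005 : ℝ) * B ^ (0.00005 : ℝ)) * (2 * y + 1) := by ring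
      _ = B ^ (0.0001 : ℝ) * (2 * y + 1) := by rw [← Real.rpow_add hB0]; norm_num
  -- levels
  set lev : (Fin 4 → ℤ) → ℕ := fun P => Nat.log 2 (nn P / q ^ 3) with hlev
  -- consequences of being at a level ≥ 1
  have hνb : ∀ P ∈ S, q ^ 3 ≤ nn P → ((nn P : ℝ) / q ^ 3) ^ 3 * q ^ 6 ≤ 2304 * W ^ 2 := by
    intro P hP hle
    have h1 := (cls.mc hP (huf P hP)).2
    change (nn P : ℝ) ^ 4 ≤ 256 * (8 * nn P / (q : ℝ) ^ 3 + 1) * (q : ℝ) ^ 6 * W ^ 2 at h1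
    have hleR : (q : ℝ) ^ 3 ≤ nn P := by exact_mod_cast hle
    have hnR : (1 : ℝ) ≤ nn P := by exact_mod_cast hn1 P hP
    set n : ℝ := (nn P : ℝ) with hnd
    set ν : ℝ := n / (q : ℝ) ^ 3 with hν
    have hnν : n = ν * (q : ℝ) ^ 3 := by rw [hν]; field_simp
    have hν1 : 1 ≤ ν := by rw [hν, le_div_iff₀ (by positivity)]; linarith
    have h2 : 8 * n / (q : ℝ) ^ 3 + 1 ≤ 9 * ν := by
      have : 8 * n / (q : ℝ) ^ 3 = 8 * ν := by rw [hν]; ring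
      linarith
    have h3 : (ν ^ 3 * (q : ℝ) ^ 6) * (ν * q ^ 6) ≤ (2304 * W ^ 2) * (ν * q ^ 6) := by
      calc (ν ^ 3 * (q : ℝ) ^ 6) * (ν * q ^ 6) = n ^ 4 := by rw [hnν]; ring
        _ ≤ _ := h1
        _ ≤ 256 * (9 * ν) * (q : ℝ) ^ 6 * W ^ 2 := by gcongr
        _ = _ := by ring
    exact le_of_mul_le_mul_right h3 (by positivity)
  have hlevpos : ∀ P ∈ S, lev P ≠ 0 → q ^ 3 ≤ nn P := by
    intro P hP h0
    by_contra hlt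
    push Not at hlt
    apply h0
    rw [hlev]; simp only
    rw [Nat.div_eq_of_lt hlt, Nat.log_zero_right]
  have hlevb : ∀ P ∈ S, lev P ≠ 0 → (2 : ℝ) ^ lev P ≤ nn P / q ^ 3 := by
    intro P hP h0
    have h1 := hlevpos P hP h0
    have h2 : nn P / q ^ 3 ≠ 0 := by
      have := Nat.div_pos h1 (by positivity); omega
    have h3 := Nat.pow_log_le_self 2 h2
    rw [le_div_iff₀ (by positivity)]
    have h4 : 2 ^ lev P * q ^ 3 ≤ nn P := (Nat.le_div_iff_mul_le (by positivity)).mp h3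
    exact_mod_cast h4
  have hlevu : ∀ P ∈ S, (nn P : ℝ) ≤ 2 * 2 ^ lev P * q ^ 3 := by
    intro P hP
    have h3 := Nat.lt_pow_succ_log_self (b := 2) (by norm_num) (nn P / q ^ 3)
    have h4 := (Nat.div_lt_iff_lt_mul (by positivity)).mp h3
    have h5 : nn P ≤ 2 * 2 ^ lev P * q ^ 3 := by
      refine h4.le.trans (le_of_eq ?_)
      rw [hlev]; simp only [Nat.succ_eq_add_one, pow_succ]; ring
    exact_mod_cast h5
  have hν1945 : ∀ P ∈ S, lev P ≠ 0 → (nn P : ℝ) / q ^ 3 ≤ B ^ (0.1945 : ℝ) := by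
    intro P hP h0
    have hnR : (1 : ℝ) ≤ nn P := by exact_mod_cast hn1 P hP
    exact root3 hB1 hqR (by positivity) hW0 hWb sz.q1 big.c4 (hνb P hP (hlevpos P hP h0))
  have hb1945 : 1 ≤ B ^ (0.1945 : ℝ) := Real.one_le_rpow hB1 (by norm_num)
  have hlevel : ∀ i : ℕ, ((S.filter (fun P => lev P = i)).card : ℝ) ≤ B ^ (0.1947 : ℝ) := by
    intro i
    rcases (S.filter (fun P => lev P = i)).eq_empty_or_nonempty with h0 | hne
    · rw [h0]; simp; positivity
    obtain ⟨Q, hQ, hQmax⟩ := Finset.exists_max_image _ nn hne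
    obtain ⟨hQS, hQi⟩ := Finset.mem_filter.mp hQ
    set n : ℝ := (nn Q : ℝ) with hn
    have hnR : (1 : ℝ) ≤ n := by rw [hn]; exact_mod_cast hn1 Q hQS
    have hRf := (cls.mc hQS (huf Q hQS)).1
    change ((Rf (Dl q s t) (wZ Z) n).card : ℝ) ≤ 9 ^ 4 * (8 * n / (q : ℝ) ^ 3 + 1) at hRf
    have hmap : ∀ P ∈ S.filter (fun P => lev P = i), uf P ∈ Rf (Dl q s t) (wZ Z) n := by
      intro P hP
      have hPS := (Finset.mem_filter.mp hP).1
      rw [mem_Rf hw]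
      refine ⟨fun l => (le_nz hw l).trans ?_, (huf P hPS).mem⟩
      rw [hn]; exact_mod_cast hQmax P hP
    -- the bound
    have main : ∀ y : ℝ, 0 ≤ y → (∀ P ∈ S.filter (fun P => lev P = i), ∀ x : ℝ, 0 ≤ x → x ≤ B ^ (0.1945 : ℝ) →
      ((nn P : ℝ) * q ^ 2 * x ^ 2) ^ 2 ≤ 81 * W ^ 3 → x ≤ y) →
      ((S.filter (fun P => lev P = i)).card : ℝ) ≤ B ^ (0.0001 : ℝ) * (2 * y + 1) * (9 ^ 4 * (8 * n / (q : ℝ) ^ 3 + 1)) := by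
      intro y hy hxy
      have := fiber_bound (S.filter (fun P => lev P = i)) uf (Rf (Dl q s t) (wZ Z) n) (B ^ (0.0001 : ℝ) * (2 * y + 1))
        (by positivity) hmap (by
          intro u hu
          rcases ((S.filter (fun P => lev P = i)).filter (fun P => uf P = u)).eq_empty_or_nonempty with h0 | ⟨P0, hP0⟩
          · rw [h0]; simp; positivity
          obtain ⟨hP0', rfl⟩ := Finset.mem_filter.mp hP0
          refine le_trans ?_ (hperu P0 (Finset.mem_filter.mp hP0').1 y hy (hxy P0 hP0'))
          exact_mod_cast Finset.card_le_card (Finset.filter_subset_filter _ (Finset.filter_subset _ _)))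
      exact this.trans (by gcongr)
    have fin : ∀ x : ℝ, x ≤ (9 ^ 4 * 17 * 3) * B ^ (0.0001 : ℝ) * B ^ (0.1945 : ℝ) → x ≤ B ^ (0.1947 : ℝ) := by
      intro x hx
      refine hx.trans ?_
      calc (9 ^ 4 * 17 * 3) * B ^ (0.0001 : ℝ) * B ^ (0.1945 : ℝ) ≤ B ^ (0.0001 : ℝ) * B ^ (0.0001 : ℝ) * B ^ (0.1945 : ℝ) := by
            have := big.c1; gcongr
        _ = B ^ (0.1947 : ℝ) := by rw [← Real.rpow_add hB0, ← Real.rpow_add hB0]; norm_num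
    apply fin
    have hb01 : 0 < B ^ (0.0001 : ℝ) := by positivity
    by_cases hi : i = 0
    · refine (main (B ^ (0.1945 : ℝ)) (by positivity) (fun P hP x _ h _ => h)).trans ?_
      have h1 := hlevu Q hQS
      rw [hQi, hi] at h1
      have h2 : 8 * n / (q : ℝ) ^ 3 + 1 ≤ 17 := by
        have : 8 * n / (q : ℝ) ^ 3 ≤ 16 := by rw [div_le_iff₀ (by positivity)]; linarith
        linarith
      calc B ^ (0.0001 : ℝ) * (2 * B ^ (0.1945 : ℝ) + 1) * (9 ^ 4 * (8 * n / (q : ℝ) ^ 3 + 1))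
          ≤ B ^ (0.0001 : ℝ) * (3 * B ^ (0.1945 : ℝ)) * (9 ^ 4 * 17) := by gcongr; linarith
        _ = _ := by ring
    · have hQ0 : lev Q ≠ 0 := by rw [hQi]; exact hi
      set ν : ℝ := n / (q : ℝ) ^ 3 with hν
      have hν0 : 0 < ν := by positivity
      have hν1 : 1 ≤ ν := le_trans (one_le_pow₀ (by norm_num)) (hlevb Q hQS hQ0)
      set y : ℝ := √(18 * √(W ^ 3) / (n * q ^ 2)) with hy
      have hy2 : y ^ 2 * (n * q ^ 2) = 18 * √(W ^ 3) := by
        rw [hy, Real.sq_sqrt (by positivity)]; field_simp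
      have hy4 : (y ^ 2 * (n * q ^ 2)) ^ 2 = 324 * W ^ 3 := by
        rw [hy2, mul_pow, Real.sq_sqrt (by positivity)]; norm_num
      have hy0 : 0 ≤ y := Real.sqrt_nonneg _
      have hm := main y hy0 (by
        intro P hP x hx0 hx1 hx2
        obtain ⟨hPS, hPi⟩ := Finset.mem_filter.mp hP
        have hPi0 : lev P ≠ 0 := by rw [hPi]; exact hi
        have h1 := hlevb P hPS hPi0
        have h2 := hlevu Q hQS
        rw [hPi] at h1; rw [hQi] at h2
        rw [le_div_iff₀ (by positivity)] at h1
        have h3 : n ≤ 2 * nn P := by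
          have : n ≤ 2 * 2 ^ i * (q : ℝ) ^ 3 := h2
          linarith
        have h4 : (x ^ 2 * (n * q ^ 2)) ^ 2 ≤ (y ^ 2 * (n * q ^ 2)) ^ 2 := by
          rw [hy4]
          calc (x ^ 2 * (n * q ^ 2)) ^ 2 ≤ (x ^ 2 * ((2 * nn P) * q ^ 2)) ^ 2 := by gcongr
            _ = 4 * ((nn P : ℝ) * q ^ 2 * x ^ 2) ^ 2 := by ring
            _ ≤ 4 * (81 * W ^ 3) := by gcongr
            _ = _ := by ring
        have h5 := le_of_sq_le_sq h4 (by positivity)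
        have h6 := le_of_mul_le_mul_right h5 (by positivity)
        exact le_of_sq_le_sq h6 hy0)
      have hyν : y * ν ≤ B ^ (0.1945 : ℝ) := by
        apply root12 hB0 hqR hy0 hν0 hW0 hWb sz.q1 big.c2
        · rw [← hy4]
          have : n = ν * (q : ℝ) ^ 3 := by rw [hν]; field_simp
          rw [this]; ring
        · exact hνb Q hQS (hlevpos Q hQS hQ0)
      have hνν : ν ≤ B ^ (0.1945 : ℝ) := hν1945 Q hQS hQ0
      refine hm.trans ?_
      have e8 : 8 * n / (q : ℝ) ^ 3 + 1 ≤ 9 * ν := by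
        have : 8 * n / (q : ℝ) ^ 3 = 8 * ν := by rw [hν]; ring
        linarith
      calc B ^ (0.0001 : ℝ) * (2 * y + 1) * (9 ^ 4 * (8 * n / (q : ℝ) ^ 3 + 1))
          ≤ B ^ (0.0001 : ℝ) * (2 * y + 1) * (9 ^ 4 * (9 * ν)) := by gcongr
        _ = B ^ (0.0001 : ℝ) * (9 ^ 4 * 9) * (2 * (y * ν) + ν) := by ring
        _ ≤ B ^ (0.0001 : ℝ) * (9 ^ 4 * 9) * (2 * B ^ (0.1945 : ℝ) + B ^ (0.1945 : ℝ)) := by gcongr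
        _ ≤ _ := by
          have : 0 < B ^ (0.0001 : ℝ) * B ^ (0.1945 : ℝ) := by positivity
          nlinarith
  -- sum over levels
  rcases S.eq_empty_or_nonempty with h0 | hne
  · rw [h0]; simp; positivity
  obtain ⟨Q, hQ, hQmax⟩ := Finset.exists_max_image S lev hne
  have hL : ((lev Q : ℕ) : ℝ) + 1 ≤ B ^ (0.0001 : ℝ) := by
    apply big.lev
    by_cases h0 : lev Q = 0
    · rw [h0]; simpa using hB1
    · refine (hlevb Q hQ h0).trans ((hν1945 Q hQ h0).trans ?_)
      calc B ^ (0.1945 : ℝ) ≤ B ^ (1 : ℝ) := Real.rpow_le_rpow_of_exponent_le hB1 (by norm_num)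
        _ = B := Real.rpow_one B
  have := fiber_bound S lev (Finset.range (lev Q + 1)) (B ^ (0.1947 : ℝ)) (by positivity) (by
    intro P hP
    have := hQmax P hP
    exact Finset.mem_range.mpr (by omega)) (fun i _ => hlevel i)
  refine this.trans ?_
  rw [Finset.card_range]; push_cast
  calc B ^ (0.1947 : ℝ) * ((lev Q : ℕ) + 1 : ℝ) ≤ B ^ (0.1947 : ℝ) * B ^ (0.0001 : ℝ) := by gcongr
    _ = B ^ (0.1948 : ℝ) := by rw [← Real.rpow_add hB0]; norm_num
    _ ≤ _ := Real.rpow_le_rpow_of_exponent_le hB1 (by norm_num)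

set_option linter.unusedVariables false

def emb (P : Pt) : Fin 4 → ℤ := ![P.1 1, P.1 2, P.2 1, P.2 2]

lemma det_zero_eq {a b c d : ℤ} (ha : 0 < a) (hb : 0 < b) (hc : 0 < c) (hd : 0 < d) (h1 : IsCoprime a b)
    (h2 : IsCoprime c d) (h : a * d - c * b = 0) : a = c ∧ b = d := by
  have e : a * d = c * b := by linarith
  have d1 : a ∣ c := h1.dvd_of_dvd_mul_right (Dvd.intro d e)
  have d2 : c ∣ a := h2.dvd_of_dvd_mul_right (Dvd.intro b e.symm)
  have h3 : a = c := le_antisymm (Int.le_of_dvd hc d1) (Int.le_of_dvd ha d2)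
  refine ⟨h3, ?_⟩
  subst h3
  have : a * (d - b) = 0 := by linarith
  rcases mul_eq_zero.mp this with h | h <;> linarith

lemma exists_ratio {M x z : ℤ} (h : IsCoprime M z) : ∃ s : ℤ, M ∣ x - s * z := by
  obtain ⟨u, v, huv⟩ := h
  exact ⟨x * v, x * u, by linear_combination -x * huv⟩

lemma cop_of_ratio {q s x z : ℤ} (hx : IsCoprime q x) (h : q ^ 3 ∣ x - s * z) : IsCoprime q s := by
  obtain ⟨k, hk⟩ := h
  obtain ⟨u, v, huv⟩ := hx
  exact ⟨u + v * q ^ 2 * k, v * z, by linear_combination huv - v * hk⟩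

lemma cop_add {q c d : ℤ} (hc : IsCoprime q c) (hd : q ∣ d) : IsCoprime q (c + d) := by
  obtain ⟨k, rfl⟩ := hd
  exact hc.add_mul_left_right k

/-- comparing two points of a class, modulo q -/
lemma class_pair {q a1 a2 x1 x2 y1 y2 x1' x2' y1' y2' : ℤ} (ha : IsCoprime q a1)
    (h1 : IsCoprime q x1) (h2 : IsCoprime q x2) (h3 : IsCoprime q y1) (h4 : IsCoprime q y2)
    (h1' : IsCoprime q x1') (h2' : IsCoprime q x2') (h3' : IsCoprime q y1') (h4' : IsCoprime q y2')
    (e : q ^ 3 ∣ a1 * x1 ^ 2 * y1 ^ 3 + a2 * x2 ^ 2 * y2 ^ 3)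
    (e' : q ^ 3 ∣ a1 * x1' ^ 2 * y1' ^ 3 + a2 * x2' ^ 2 * y2' ^ 3)
    (hv : q ∣ x1 * y1 * (x2' * y2') - x1' * y1' * (x2 * y2)) :
    q ∣ x1 * x2' - x1' * x2 ∧ q ∣ y1 * y2' - y1' * y2 ∧
    q ^ 3 ∣ x1 ^ 2 * y1 ^ 3 * (x2' ^ 2 * y2' ^ 3) - x1' ^ 2 * y1' ^ 3 * (x2 ^ 2 * y2 ^ 3) := by
  have k3 : q ^ 3 ∣ x1 ^ 2 * y1 ^ 3 * (x2' ^ 2 * y2' ^ 3) - x1' ^ 2 * y1' ^ 3 * (x2 ^ 2 * y2 ^ 3) := by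
    apply (ha.pow_left (m := 3)).dvd_of_dvd_mul_left
    exact dvdE (dvd_sub (e.mul_left (x2' ^ 2 * y2' ^ 3)) (e'.mul_left (x2 ^ 2 * y2 ^ 3))) (by ring)
  have k1 : q ∣ x1 ^ 2 * y1 ^ 3 * (x2' ^ 2 * y2' ^ 3) - x1' ^ 2 * y1' ^ 3 * (x2 ^ 2 * y2 ^ 3) :=
    (dvd_pow_self q (by norm_num)).trans k3
  have ky : q ∣ y1 * y2' - y1' * y2 := by
    have hc : IsCoprime q ((x1 * y1 * (x2' * y2')) ^ 2) :=
      ((h1.mul_right h3).mul_right (h2'.mul_right h4')).pow_right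
    apply hc.dvd_of_dvd_mul_left
    exact dvdE (dvd_sub k1 (hv.mul_right ((x1 * y1 * (x2' * y2') + x1' * y1' * (x2 * y2)) * (y1' * y2)))) (by ring)
  refine ⟨?_, ky, k3⟩
  apply (h3.mul_right h4').dvd_of_dvd_mul_left
  exact dvdE (dvd_sub hv (ky.mul_right (x1' * x2))) (by ring)

lemma mkCls {a X Y : Fin 3 → ℤ} {B : ℝ} {S : Finset Pt} (hb : Box a X Y B S) {y0 : ℤ} (hy : ∀ P ∈ S, P.2 0 = y0)
    {o : Pt} (ho : o ∈ S)
    (hv : ∀ P ∈ S, (q6 y0 : ℤ) ∣ P.1 1 * P.2 1 * (o.1 2 * o.2 2) - o.1 1 * o.2 1 * (P.1 2 * P.2 2))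
    (hX : 3 * (X 1 * X 2) < (q6 y0 : ℤ) ^ 3) (hY : 3 * (Y 1 * Y 2) < (q6 y0 : ℤ) ^ 3) :
    ∃ s t, Cls (q6 y0) (q6P y0) s t (a 1) (a 2) ![X 1, X 2, Y 1, Y 2] (S.image emb) := by
  set q : ℤ := (q6 y0 : ℤ) with hq
  have hqy : ∀ P ∈ S, q ∣ P.2 0 := fun P hP => by rw [hy P hP]; exact q6_dvd y0
  have cp : ∀ P ∈ S, ∀ i, i ≠ 0 → IsCoprime q (P.1 i) ∧ IsCoprime q (P.2 i) := by
    intro P hP i hi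
    have h := (hb.sol P hP).cop 0 i hi.symm
    have h' := (h.of_isCoprime_of_dvd_left ((hqy P hP).mul_left (P.1 0)))
    exact ⟨h'.of_mul_right_left, h'.of_mul_right_right⟩
  have ca : IsCoprime q (a 1) := by
    have h := ((hb.sol o ho).acop 1 0).symm
    exact h.of_isCoprime_of_dvd_left ((hqy o ho).mul_left (o.1 0))
  have hp_n6 : ∀ p ∈ q6P y0, ¬ (p : ℤ) ∣ 6 := by
    intro p hp h
    have h' : p ∣ 2 * 3 := by exact_mod_cast h
    rcases (q6P_prime hp).dvd_mul.mp h' with h | h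
    · exact q6P_ne2 hp ((Nat.prime_dvd_prime_iff_eq (q6P_prime hp) Nat.prime_two).mp h)
    · exact q6P_ne3 hp ((Nat.prime_dvd_prime_iff_eq (q6P_prime hp) Nat.prime_three).mp h)
  have h6 : IsCoprime q 6 := by
    rw [hq, q6]; push_cast
    apply IsCoprime.prod_left
    intro p hp
    exact (Prime.coprime_iff_not_dvd (Nat.prime_iff_prime_int.mp (q6P_prime hp))).mpr (hp_n6 p hp)
  have h2c : IsCoprime q 2 := h6.of_isCoprime_of_dvd_right ⟨3, by norm_num⟩
  have hpq : ∀ p ∈ q6P y0, (p : ℤ) ∣ q := by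
    intro p hp
    rw [hq, Int.natCast_dvd_natCast]
    exact Finset.dvd_prod_of_mem (fun p => p) hp
  have notp : ∀ c : ℤ, IsCoprime q c → ∀ p ∈ q6P y0, ¬ (p : ℤ) ∣ c := by
    intro c hc p hp h
    exact (Nat.prime_iff_prime_int.mp (q6P_prime hp)).not_isUnit (hc.isUnit_of_dvd' (hpq p hp) h)
  obtain ⟨ox1, oy1⟩ := cp o ho 1 (by decide)
  obtain ⟨ox2, oy2⟩ := cp o ho 2 (by decide)
  obtain ⟨s, hs⟩ := exists_ratio (x := o.1 1) (ox2.pow_left (m := 3))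
  obtain ⟨t, ht⟩ := exists_ratio (x := o.2 1) (oy2.pow_left (m := 3))
  have cs := cop_of_ratio ox1 hs
  have ct := cop_of_ratio oy1 ht
  have hs1 : q ∣ o.1 1 - s * o.1 2 := (dvd_pow_self q (by norm_num)).trans hs
  have ht1 : q ∣ o.2 1 - t * o.2 2 := (dvd_pow_self q (by norm_num)).trans ht
  have key : ∀ P ∈ S, q ∣ P.1 1 - s * P.1 2 ∧ q ∣ P.2 1 - t * P.2 2 ∧ q ^ 3 ∣ Lq s t (emb P) := by
    intro P hP
    obtain ⟨px1, py1⟩ := cp P hP 1 (by decide)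
    obtain ⟨px2, py2⟩ := cp P hP 2 (by decide)
    obtain ⟨k1, k2, k3⟩ := class_pair ca px1 px2 py1 py2 ox1 ox2 oy1 oy2
      ((hb.sol P hP).fe0 (hqy P hP)) ((hb.sol o ho).fe0 (hqy o ho)) (hv P hP)
    have g1 : q ∣ P.1 1 - s * P.1 2 := by
      apply ox2.dvd_of_dvd_mul_left
      exact dvdE (dvd_add k1 (hs1.mul_right (P.1 2))) (by ring)
    have g2 : q ∣ P.2 1 - t * P.2 2 := by
      apply oy2.dvd_of_dvd_mul_left
      exact dvdE (dvd_add k2 (ht1.mul_right (P.2 2))) (by ring)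
    refine ⟨g1, g2, ?_⟩
    have h := core_rel (S := s * P.1 2) (T := t * P.2 2) h6 g1 g2 (cs.mul_right px2) (ct.mul_right py2) (by
      have hc : IsCoprime (q ^ 3) (o.1 2 ^ 2 * o.2 2 ^ 3) := ((ox2.pow_right).mul_right (oy2.pow_right)).pow_left
      apply hc.dvd_of_dvd_mul_left
      obtain ⟨u, hu⟩ := hs
      obtain ⟨w, hw⟩ := ht
      obtain ⟨k, hk⟩ := k3
      have e1 : o.1 1 = s * o.1 2 + q ^ 3 * u := by linarith
      have e2 : o.2 1 = t * o.2 2 + q ^ 3 * w := by linarith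
      have m1 : q ^ 3 ∣ o.1 1 ^ 2 * o.2 1 ^ 3 - (s * o.1 2) ^ 2 * (t * o.2 2) ^ 3 := by
        have b1 : q ^ 3 ∣ o.1 1 ^ 2 - (s * o.1 2) ^ 2 := ⟨u * (o.1 1 + s * o.1 2), by linear_combination (o.1 1 + s * o.1 2) * hu⟩
        have b2 : q ^ 3 ∣ o.2 1 ^ 3 - (t * o.2 2) ^ 3 :=
          ⟨w * (o.2 1 ^ 2 + o.2 1 * (t * o.2 2) + (t * o.2 2) ^ 2),
            by linear_combination (o.2 1 ^ 2 + o.2 1 * (t * o.2 2) + (t * o.2 2) ^ 2) * hw⟩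
        exact dvdE (dvd_add (b1.mul_left (o.2 1 ^ 3)) (b2.mul_left ((s * o.1 2) ^ 2))) (by ring)
      exact dvdE (dvd_add (Dvd.intro k hk.symm) (m1.mul_left (P.1 2 ^ 2 * P.2 2 ^ 3))) (by ring))
    exact dvdE h (by simp [Lq, emb]; ring)
  have q3 : ∀ m : ℤ, q ^ 3 ∣ m → |m| < q ^ 3 → m = 0 := fun m h1 h2 => Int.eq_zero_of_abs_lt_dvd h1 h2
  refine ⟨s, t, ⟨rfl, fun p hp => q6P_prime hp, hp_n6, notp s cs, notp t ct, ?_, ?_, ?_, ?_, ?_, ?_, ?_, ?_, ?_, ?_, ?_, ?_⟩⟩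
  · intro i; fin_cases i
    · exact hb.X1 1
    · exact hb.X1 2
    · exact hb.Y1 1
    · exact hb.Y1 2
  · intro R hR i
    obtain ⟨P, hP, rfl⟩ := Finset.mem_image.mp hR
    fin_cases i
    · exact hb.xlo P hP 1
    · exact hb.xlo P hP 2
    · exact hb.ylo P hP 1
    · exact hb.ylo P hP 2
  · intro R hR i
    obtain ⟨P, hP, rfl⟩ := Finset.mem_image.mp hR
    fin_cases i
    · exact hb.xhi P hP 1
    · exact hb.xhi P hP 2
    · exact hb.yhi P hP 1
    · exact hb.yhi P hP 2
  · intro R hR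
    obtain ⟨P, hP, rfl⟩ := Finset.mem_image.mp hR
    exact (((hb.sol P hP).cop 1 2 (by decide)).of_mul_left_left).of_mul_right_left
  · intro R hR
    obtain ⟨P, hP, rfl⟩ := Finset.mem_image.mp hR
    exact (((hb.sol P hP).cop 1 2 (by decide)).of_mul_left_right).of_mul_right_right
  · intro R hR p hp i
    obtain ⟨P, hP, rfl⟩ := Finset.mem_image.mp hR
    fin_cases i
    · exact notp _ (cp P hP 1 (by decide)).1 p hp
    · exact notp _ (cp P hP 2 (by decide)).1 p hp
    · exact notp _ (cp P hP 1 (by decide)).2 p hp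
    · exact notp _ (cp P hP 2 (by decide)).2 p hp
  · intro R hR
    obtain ⟨P, hP, rfl⟩ := Finset.mem_image.mp hR
    exact (key P hP).1
  · intro R hR
    obtain ⟨P, hP, rfl⟩ := Finset.mem_image.mp hR
    exact (key P hP).2.1
  · intro R hR
    obtain ⟨P, hP, rfl⟩ := Finset.mem_image.mp hR
    exact (key P hP).2.2
  · intro R hR R' hR' hne
    obtain ⟨P, hP, rfl⟩ := Finset.mem_image.mp hR
    obtain ⟨P', hP', rfl⟩ := Finset.mem_image.mp hR'
    have sP := hb.sol P hP
    have sP' := hb.sol P' hP'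
    obtain ⟨g1, g2, L⟩ := key P hP
    obtain ⟨g1', g2', L'⟩ := key P' hP'
    have ex : mn (emb P) (emb P') 0 1 = P.1 1 * P'.1 2 - P'.1 1 * P.1 2 := by simp [mn, emb]
    have ey : mn (emb P) (emb P') 2 3 = P.2 1 * P'.2 2 - P'.2 1 * P.2 2 := by simp [mn, emb]
    have lx : |P.1 1 * P'.1 2 - P'.1 1 * P.1 2| < q ^ 3 := (bracket_abs (hb.xlo P hP 1) (hb.xhi P hP 1) (hb.xlo P hP 2)
      (hb.xhi P hP 2) (hb.xlo P' hP' 1) (hb.xhi P' hP' 1) (hb.xlo P' hP' 2) (hb.xhi P' hP' 2) (hb.X1 1) (hb.X1 2)).trans_lt hX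
    have ly : |P.2 1 * P'.2 2 - P'.2 1 * P.2 2| < q ^ 3 := (bracket_abs (hb.ylo P hP 1) (hb.yhi P hP 1) (hb.ylo P hP 2)
      (hb.yhi P hP 2) (hb.ylo P' hP' 1) (hb.yhi P' hP' 1) (hb.ylo P' hP' 2) (hb.yhi P' hP' 2) (hb.Y1 1) (hb.Y1 2)).trans_lt hY
    have Lx : Lq s t (emb P) = 4 * t * (P.1 1 - s * P.1 2) * P.2 2 + 6 * s * P.1 2 * (P.2 1 - t * P.2 2)
       + 5 * (P.1 1 - s * P.1 2) * (P.2 1 - t * P.2 2) := by simp [Lq, emb]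
    have Lx' : Lq s t (emb P') = 4 * t * (P'.1 1 - s * P'.1 2) * P'.2 2 + 6 * s * P'.1 2 * (P'.2 1 - t * P'.2 2)
       + 5 * (P'.1 1 - s * P'.1 2) * (P'.2 1 - t * P'.2 2) := by simp [Lq, emb]
    rw [Lx] at L
    rw [Lx'] at L'
    have fx : P.1 1 * P'.1 2 - P'.1 1 * P.1 2 = 0 → P.1 1 = P'.1 1 ∧ P.1 2 = P'.1 2 :=
      det_zero_eq (sP.xpos 1) (sP.xpos 2) (sP'.xpos 1) (sP'.xpos 2) 
        ((sP.cop 1 2 (by decide)).of_mul_left_left).of_mul_right_left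
        ((sP'.cop 1 2 (by decide)).of_mul_left_left).of_mul_right_left
    have fy : P.2 1 * P'.2 2 - P'.2 1 * P.2 2 = 0 → P.2 1 = P'.2 1 ∧ P.2 2 = P'.2 2 :=
      det_zero_eq (sP.ypos 1) (sP.ypos 2) (sP'.ypos 1) (sP'.ypos 2) 
        ((sP.cop 1 2 (by decide)).of_mul_left_right).of_mul_right_right
        ((sP'.cop 1 2 (by decide)).of_mul_left_right).of_mul_right_right
    have fin : P.1 1 * P'.1 2 - P'.1 1 * P.1 2 = 0 → P.2 1 * P'.2 2 - P'.2 1 * P.2 2 = 0 → False := by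
      intro h1 h2
      apply hne
      simp only [emb]
      rw [(fx h1).1, (fx h1).2, (fy h2).1, (fy h2).2]
    rw [ex, ey]
    constructor
    · intro h0
      refine fin h0 (q3 _ ?_ ly)
      obtain ⟨e1, e2⟩ := fx h0
      rw [← e1, ← e2] at L'
      have hc : IsCoprime (q ^ 3) (2 * 3 * s * P.1 2 + 5 * (P.1 1 - s * P.1 2)) := by
        apply IsCoprime.pow_left
        apply cop_add _ (g1.mul_left 5)
        exact ((h6.mul_right cs).mul_right (cp P hP 2 (by decide)).1)
      apply hc.dvd_of_dvd_mul_left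
      exact dvdE (dvd_sub (L.mul_right (P'.2 2)) (L'.mul_right (P.2 2))) (by ring)
    · intro h0
      refine fin (q3 _ ?_ lx) h0
      obtain ⟨e1, e2⟩ := fy h0
      rw [← e1, ← e2] at L'
      have hc : IsCoprime (q ^ 3) (2 * 2 * t * P.2 2 + 5 * (P.2 1 - t * P.2 2)) := by
        apply IsCoprime.pow_left
        apply cop_add _ (g2.mul_left 5)
        exact (((h2c.mul_right h2c).mul_right ct).mul_right (cp P hP 2 (by decide)).2)
      apply hc.dvd_of_dvd_mul_left
      exact dvdE (dvd_sub (L.mul_right (P'.1 2)) (L'.mul_right (P.1 2))) (by ring)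
  · intro R hR
    obtain ⟨P, hP, rfl⟩ := Finset.mem_image.mp hR
    exact (hb.sol P hP).fe0 (hqy P hP)
  · intro R hR
    obtain ⟨P, hP, rfl⟩ := Finset.mem_image.mp hR
    have sP := hb.sol P hP
    have e := sP.eq
    have hne : a 0 * P.1 0 ^ 2 * P.2 0 ^ 3 ≠ 0 :=
      mul_ne_zero (mul_ne_zero (sP.ane 0) (pow_pos (sP.xpos 0) 2).ne') (pow_pos (sP.ypos 0) 3).ne'
    intro h
    apply hne
    have : fq (a 1) (a 2) (emb P) = a 1 * P.1 1 ^ 2 * P.2 1 ^ 3 + a 2 * P.1 2 ^ 2 * P.2 2 ^ 3 := by simp [fq, emb]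
    rw [this] at h
    linarith

lemma emb_card {a X Y : Fin 3 → ℤ} {B : ℝ} {S : Finset Pt} (hb : Box a X Y B S) {y0 : ℤ} (hy : ∀ P ∈ S, P.2 0 = y0) :
    (S.image emb).card = S.card := by
  apply Finset.card_image_of_injOn
  intro P hP P' hP' h
  have h0 := congrFun h 0
  have h1 := congrFun h 1
  have h2 := congrFun h 2
  have h3 := congrFun h 3
  simp [emb] at h0 h1 h2 h3
  have := (hb.sol P hP).x0_unique (hb.sol P' hP') ((hy P hP).trans (hy P' hP').symm) h0 h1 h2 h3
  exact Prod.ext this.1 this.2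

set_option linter.unusedVariables false

structure Bal (Y : Fin 3 → ℤ) (B : ℝ) : Prop where
  y0lo : B ^ (0.1975 : ℝ) ≤ Y 0
  y0hi : (Y 0 : ℝ) ≤ B ^ (0.20125 : ℝ)
  y1lo : B ^ (0.1975 : ℝ) ≤ Y 1
  y2lo : B ^ (0.1975 : ℝ) ≤ Y 2
  slo : B ^ (0.39625 : ℝ) ≤ (Y 1 * Y 2 : ℝ)
  shi : (Y 1 * Y 2 : ℝ) ≤ B ^ (0.4025 : ℝ)

lemma Box.XY {a X Y : Fin 3 → ℤ} {B : ℝ} {S : Finset Pt} (h : Box a X Y B S) {P : Pt} (hP : P ∈ S) (i : Fin 3) :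
    |(a i : ℝ)| * (X i : ℝ) ^ 2 * (Y i : ℝ) ^ 3 ≤ B := by
  have h1 := h.bd P hP i
  push_cast at h1
  refine le_trans ?_ h1
  have hx : (X i : ℝ) ≤ P.1 i := by exact_mod_cast h.xlo P hP i
  have hy : (Y i : ℝ) ≤ P.2 i := by exact_mod_cast h.ylo P hP i
  have hx0 : (0 : ℝ) ≤ X i := by exact_mod_cast (by linarith [h.X1 i] : 0 ≤ X i)
  have hy0 : (0 : ℝ) ≤ Y i := by exact_mod_cast (by linarith [h.Y1 i] : 0 ≤ Y i)
  gcongr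

lemma Box.XY' {a X Y : Fin 3 → ℤ} {B : ℝ} {S : Finset Pt} (h : Box a X Y B S) {P : Pt} (hP : P ∈ S) (i : Fin 3) :
    (X i : ℝ) ^ 2 * (Y i : ℝ) ^ 3 ≤ B := by
  refine le_trans ?_ (h.XY hP i)
  have h1 : (1 : ℝ) ≤ |(a i : ℝ)| := by exact_mod_cast (h.sol P hP).one_le_abs_a i
  have hy0 : (0 : ℝ) ≤ Y i := by exact_mod_cast (by linarith [h.Y1 i] : 0 ≤ Y i)
  rw [mul_assoc]
  exact le_mul_of_one_le_left (by positivity) h1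

lemma Box.sizes {a X Y : Fin 3 → ℤ} {B : ℝ} {S : Finset Pt} (h : Box a X Y B S) {P : Pt} (hP : P ∈ S) (hB : 1 ≤ B)
    (bal : Bal Y B) : (X 1 * X 2 : ℝ) ≤ B ^ (0.405625 : ℝ) ∧ (X 1 * X 2 * Y 1 * Y 2 : ℝ) ≤ B ^ (0.802 : ℝ) := by
  have hB0 : 0 < B := by linarith
  have h1 := h.XY' hP 1
  have h2 := h.XY' hP 2
  have y1 : (0 : ℝ) < Y 1 := by exact_mod_cast (by linarith [h.Y1 1] : 0 < Y 1)
  have y2 : (0 : ℝ) < Y 2 := by exact_mod_cast (by linarith [h.Y1 2] : 0 < Y 2)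
  have x1 : (0 : ℝ) < X 1 := by exact_mod_cast (by linarith [h.X1 1] : 0 < X 1)
  have x2 : (0 : ℝ) < X 2 := by exact_mod_cast (by linarith [h.X1 2] : 0 < X 2)
  have hm : (X 1 * X 2 : ℝ) ^ 2 * (Y 1 * Y 2 : ℝ) ^ 3 ≤ B ^ (2 : ℝ) := by
    calc (X 1 * X 2 : ℝ) ^ 2 * (Y 1 * Y 2 : ℝ) ^ 3 = ((X 1 : ℝ) ^ 2 * (Y 1 : ℝ) ^ 3) * ((X 2 : ℝ) ^ 2 * (Y 2 : ℝ) ^ 3) := by ring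
      _ ≤ B * B := by gcongr
      _ = B ^ (2 : ℝ) := by rw [Real.rpow_two]; ring
  have hs := bal.slo
  constructor
  · apply rp_root hB0.le 2 (by norm_num)
    have h3 : (X 1 * X 2 : ℝ) ^ 2 * B ^ (1.18875 : ℝ) ≤ B ^ (0.81125 : ℝ) * B ^ (1.18875 : ℝ) := by
      calc (X 1 * X 2 : ℝ) ^ 2 * B ^ (1.18875 : ℝ) = (X 1 * X 2 : ℝ) ^ 2 * (B ^ (0.39625 : ℝ)) ^ 3 := by
            rw [← Real.rpow_natCast (B ^ (0.39625 : ℝ)), ← Real.rpow_mul hB0.le]; norm_num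
        _ ≤ (X 1 * X 2 : ℝ) ^ 2 * (Y 1 * Y 2 : ℝ) ^ 3 := by gcongr
        _ ≤ _ := hm
        _ = _ := by rw [← Real.rpow_add hB0]; norm_num
    refine (le_of_mul_le_mul_right h3 (by positivity)).trans (le_of_eq ?_)
    norm_num
  · apply rp_root hB0.le 2 (by norm_num)
    have h3 : (X 1 * X 2 * Y 1 * Y 2 : ℝ) ^ 2 * B ^ (0.39625 : ℝ) ≤ B ^ (1.60375 : ℝ) * B ^ (0.39625 : ℝ) := by
      calc (X 1 * X 2 * Y 1 * Y 2 : ℝ) ^ 2 * B ^ (0.39625 : ℝ) ≤ (X 1 * X 2 * Y 1 * Y 2 : ℝ) ^ 2 * (Y 1 * Y 2) := by gcongr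
        _ = (X 1 * X 2 : ℝ) ^ 2 * (Y 1 * Y 2 : ℝ) ^ 3 := by ring
        _ ≤ _ := hm
        _ = _ := by rw [← Real.rpow_add hB0]; norm_num
    refine (le_of_mul_le_mul_right h3 (by positivity)).trans ?_
    exact Real.rpow_le_rpow_of_exponent_le hB (by norm_num)

/-- the nonskew part -/
lemma nonskew {a X Y : Fin 3 → ℤ} {B : ℝ} {S : Finset Pt} (h : Box a X Y B S) (big : BigC B) (hc : 648 < B ^ (0.18 : ℝ))
    (bal : Bal Y B) (hns : ∀ P ∈ S, NSk (q6 (P.2 0)) ![X 1, X 2, Y 1, Y 2] B (emb P)) :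
    (S.card : ℝ) ≤ 2 * B ^ (0.5974 : ℝ) := by
  classical
  have hB1 : 1 ≤ B := by linarith [big.two]
  have hB0 : 0 < B := by linarith
  have Y0p : (0 : ℝ) < Y 0 := by exact_mod_cast (by linarith [h.Y1 0] : 0 < Y 0)
  have := fiber_bound S (fun P => P.2 0) (Finset.Ico (Y 0) (2 * Y 0)) (B ^ (0.1949 : ℝ) * (2 * B ^ (0.20125 : ℝ))) (by positivity)
    (fun P hP => Finset.mem_Ico.mpr ⟨h.ylo P hP 0, h.yhi P hP 0⟩) ?_
  · rw [card_Ico_two _ (h.Y1 0)] at this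
    refine this.trans ?_
    calc B ^ (0.1949 : ℝ) * (2 * B ^ (0.20125 : ℝ)) * Y 0 ≤ B ^ (0.1949 : ℝ) * (2 * B ^ (0.20125 : ℝ)) * B ^ (0.20125 : ℝ) := by
          have := bal.y0hi; gcongr
      _ = 2 * (B ^ (0.1949 : ℝ) * B ^ (0.20125 : ℝ) * B ^ (0.20125 : ℝ)) := by ring
      _ = 2 * B ^ (0.5974 : ℝ) := by rw [← Real.rpow_add hB0, ← Real.rpow_add hB0]; norm_num
  intro y0 _
  set F := S.filter (fun P => P.2 0 = y0) with hF
  rcases F.eq_empty_or_nonempty with h0 | ⟨P0, hP0⟩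
  · rw [h0]; simp; positivity
  have hFb : Box a X Y B F := h.mono (Finset.filter_subset _ _)
  have hy : ∀ P ∈ F, P.2 0 = y0 := fun P hP => (Finset.mem_filter.mp hP).2
  have hq0 := q6_pos y0
  have : NeZero (q6 y0) := ⟨hq0.ne'⟩
  have hy0p : 0 < y0 := by rw [← hy P0 hP0]; exact (hFb.sol P0 hP0).ypos 0
  have hqR : (0 : ℝ) < q6 y0 := by exact_mod_cast hq0
  have q1 : B ^ (0.1975 : ℝ) ≤ 6 * q6 y0 := by
    refine bal.y0lo.trans ?_
    have h1 := q6_le (by rw [← hy P0 hP0]; exact (hFb.sol P0 hP0).sqf 0 : Squarefree y0)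
    have h2 := hFb.ylo P0 hP0 0
    rw [hy P0 hP0] at h2
    have : Y 0 ≤ 6 * (q6 y0 : ℤ) := by omega
    exact_mod_cast this
  have q2 : (q6 y0 : ℝ) ≤ 2 * B ^ (0.20125 : ℝ) := by
    have h1 : (q6 y0 : ℤ) ≤ y0 := Int.le_of_dvd hy0p (q6_dvd y0)
    have h2 := hFb.yhi P0 hP0 0
    rw [hy P0 hP0] at h2
    have h3 : (q6 y0 : ℤ) ≤ 2 * Y 0 := by omega
    have h4 : (q6 y0 : ℝ) ≤ 2 * Y 0 := by exact_mod_cast h3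
    linarith [bal.y0hi]
  obtain ⟨sX, sW⟩ := hFb.sizes hP0 hB1 bal
  have cube : ∀ x : ℝ, x ≤ B ^ (0.4065 : ℝ) → 3 * x < (q6 y0 : ℝ) ^ 3 := by
    intro x hx
    have h1 : (B ^ (0.1975 : ℝ)) ^ 3 ≤ (6 * q6 y0 : ℝ) ^ 3 := by gcongr
    rw [← Real.rpow_natCast, ← Real.rpow_mul hB0.le] at h1
    have h2 : B ^ ((0.1975 : ℝ) * (3 : ℕ)) = B ^ (0.186 : ℝ) * B ^ (0.4065 : ℝ) := by
      rw [← Real.rpow_add hB0]; norm_num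
    rw [h2] at h1
    have h3 : B ^ (0.18 : ℝ) ≤ B ^ (0.186 : ℝ) := Real.rpow_le_rpow_of_exponent_le hB1 (by norm_num)
    have h4 : 0 < B ^ (0.4065 : ℝ) := by positivity
    have h5 : 648 * B ^ (0.4065 : ℝ) < B ^ (0.186 : ℝ) * B ^ (0.4065 : ℝ) := by
      apply mul_lt_mul_of_pos_right _ h4; linarith
    have : (6 * q6 y0 : ℝ) ^ 3 = 216 * (q6 y0 : ℝ) ^ 3 := by ring
    linarith
  have hX : 3 * (X 1 * X 2) < (q6 y0 : ℤ) ^ 3 := by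
    have := cube _ (sX.trans (Real.rpow_le_rpow_of_exponent_le hB1 (by norm_num)))
    exact_mod_cast this
  have hY : 3 * (Y 1 * Y 2) < (q6 y0 : ℤ) ^ 3 := by
    have := cube _ (bal.shi.trans (Real.rpow_le_rpow_of_exponent_le hB1 (by norm_num)))
    exact_mod_cast this
  have hfb := fiber_bound F (fun P => ((P.1 1 * P.2 1 : ℤ) : ZMod (q6 y0)) * ((P.1 2 * P.2 2 : ℤ) : ZMod (q6 y0))⁻¹)
    Finset.univ (B ^ (0.1949 : ℝ)) (by positivity) (fun _ _ => Finset.mem_univ _) ?_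
  · rw [Finset.card_univ, ZMod.card] at hfb
    refine hfb.trans ?_
    gcongr
  intro v _
  set G := F.filter (fun P => ((P.1 1 * P.2 1 : ℤ) : ZMod (q6 y0)) * ((P.1 2 * P.2 2 : ℤ) : ZMod (q6 y0))⁻¹ = v) with hG
  rcases G.eq_empty_or_nonempty with h0 | ⟨o, ho⟩
  · rw [h0]; simp; positivity
  have hGF : G ⊆ F := Finset.filter_subset _ _
  have hGb := hFb.mono hGF
  have hyG : ∀ P ∈ G, P.2 0 = y0 := fun P hP => hy P (hGF hP)
  have hunit : ∀ P ∈ G, ((P.1 2 * P.2 2 : ℤ) : ZMod (q6 y0)) * ((P.1 2 * P.2 2 : ℤ) : ZMod (q6 y0))⁻¹ = 1 := by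
    intro P hP
    apply ZMod.mul_inv_of_unit
    have hc := ((hGb.sol P hP).cop 2 0 (by decide)).of_isCoprime_of_dvd_right
      ((by rw [hyG P hP]; exact q6_dvd y0 : (q6 y0 : ℤ) ∣ P.2 0).mul_left (P.1 0))
    obtain ⟨u, w, huw⟩ := hc
    apply IsUnit.of_mul_eq_one (u : ZMod (q6 y0))
    have := congrArg (fun z : ℤ => (z : ZMod (q6 y0))) huw
    push_cast at this
    rw [ZMod.natCast_self, mul_zero, add_zero] at this
    push_cast
    rw [mul_comm]; exact this
  have hv : ∀ P ∈ G, (q6 y0 : ℤ) ∣ P.1 1 * P.2 1 * (o.1 2 * o.2 2) - o.1 1 * o.2 1 * (P.1 2 * P.2 2) := by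
    intro P hP
    rw [← ZMod.intCast_zmod_eq_zero_iff_dvd]
    have e1 := (Finset.mem_filter.mp hP).2
    have e2 := (Finset.mem_filter.mp ho).2
    have u1 := hunit P hP
    have u2 := hunit o ho
    rw [Int.cast_sub, Int.cast_mul (P.1 1 * P.2 1), Int.cast_mul (o.1 1 * o.2 1)]
    linear_combination (((P.1 2 * P.2 2 : ℤ) : ZMod (q6 y0)) * ((o.1 2 * o.2 2 : ℤ) : ZMod (q6 y0))) * (e1 - e2)
      - ((P.1 1 * P.2 1 : ℤ) : ZMod (q6 y0)) * ((o.1 2 * o.2 2 : ℤ) : ZMod (q6 y0)) * u1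
      + ((o.1 1 * o.2 1 : ℤ) : ZMod (q6 y0)) * ((P.1 2 * P.2 2 : ℤ) : ZMod (q6 y0)) * u2
  obtain ⟨s, t, cls⟩ := mkCls hGb hyG ho hv hX hY
  rw [← emb_card hGb hyG]
  refine class_count big cls ⟨q1, q2, ?_, ?_, ?_, ?_⟩ ?_
  · simpa using sW
  · simpa using bal.shi
  · simpa using hGb.XY ho 1
  · simpa using hGb.XY ho 2
  · intro R hR
    obtain ⟨P, hP, rfl⟩ := Finset.mem_image.mp hR
    have := hns P (Finset.filter_subset _ _ (hGF hP))
    rwa [hyG P hP] at this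

/-- few x for given y -/
lemma fix_y {a X Y : Fin 3 → ℤ} {B : ℝ} {S : Finset Pt} (h : Box a X Y B S) (big : BigC B) (bal : Bal Y B)
    {y : Fin 3 → ℤ} (hy : ∀ P ∈ S, P.2 = y) : (S.card : ℝ) ≤ 7 * B ^ (0.00005 : ℝ) := by
  classical
  have hB1 : 1 ≤ B := by linarith [big.two]
  have hB0 : 0 < B := by linarith
  rcases S.eq_empty_or_nonempty with h0 | ⟨P0, hP0⟩
  · rw [h0]; simp; positivity
  have hc : S.card = (S.image Prod.fst).card := by
    rw [Finset.card_image_of_injOn]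
    intro P hP P' hP' he
    exact Prod.ext he ((hy P hP).trans (hy P' hP').symm)
  have hmem : ∀ x ∈ S.image Prod.fst, (x, y) ∈ S := by
    intro x hx
    obtain ⟨P, hP, rfl⟩ := Finset.mem_image.mp hx
    rw [← hy P hP]; exact hP
  rw [hc]
  refine (T1y B hB0 _ (fun x hx => h.sol _ (hmem x hx)) (fun x hx => h.bd _ (hmem x hx))).trans ?_
  have s := h.sol P0 hP0
  have hyP := hy P0 hP0
  have pY := h.prodY hP0
  rw [hyP] at s pY
  have hY0 : 0 < y 0 * y 1 * y 2 := mul_pos (mul_pos (s.ypos 0) (s.ypos 1)) (s.ypos 2)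
  have hn : ((y 0 * y 1 * y 2).natAbs : ℝ) = ((y 0 * y 1 * y 2 : ℤ) : ℝ) := by
    rw [Nat.cast_natAbs, abs_of_pos hY0]
  have hω := big.om (y 0 * y 1 * y 2).natAbs (by omega) (by rw [hn]; exact pY)
  have hyl : ∀ i, (Y i : ℝ) ≤ y i := fun i => by rw [← hyP]; exact_mod_cast h.ylo P0 hP0 i
  have hlow : B ^ (0.5925 : ℝ) ≤ ((y 0 * y 1 * y 2 : ℤ) : ℝ) := by
    push_cast
    calc B ^ (0.5925 : ℝ) = B ^ (0.1975 : ℝ) * B ^ (0.1975 : ℝ) * B ^ (0.1975 : ℝ) := by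
          rw [← Real.rpow_add hB0, ← Real.rpow_add hB0]; norm_num
      _ ≤ y 0 * y 1 * y 2 := by
        have h0 := bal.y0lo.trans (hyl 0)
        have h1 := bal.y1lo.trans (hyl 1)
        have h2 := bal.y2lo.trans (hyl 2)
        have p0 : (0 : ℝ) < y 0 := by exact_mod_cast s.ypos 0
        have p1 : (0 : ℝ) < y 1 := by exact_mod_cast s.ypos 1
        gcongr
  have hsq : √(B / ((y 0 * y 1 * y 2 : ℤ) : ℝ) ^ 3) ≤ 1 := by
    refine Real.sqrt_le_iff.mpr ⟨zero_le_one, ?_⟩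
    have hyp : (0 : ℝ) < ((y 0 * y 1 * y 2 : ℤ) : ℝ) := by exact_mod_cast hY0
    rw [one_pow, div_le_one (pow_pos hyp 3)]
    calc B = B ^ (1 : ℝ) := (Real.rpow_one B).symm
      _ ≤ B ^ ((0.5925 : ℝ) * (3 : ℕ)) := Real.rpow_le_rpow_of_exponent_le hB1 (by norm_num)
      _ = (B ^ (0.5925 : ℝ)) ^ 3 := by rw [Real.rpow_mul hB0.le, Real.rpow_natCast]
      _ ≤ _ := by gcongr
  calc (2 : ℝ) ^ (y 0 * y 1 * y 2).natAbs.primeFactors.card * (6 * √(B / ((y 0 * y 1 * y 2 : ℤ) : ℝ) ^ 3) + 1)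
      ≤ 5 ^ (y 0 * y 1 * y 2).natAbs.primeFactors.card * (6 * 1 + 1) := by gcongr; norm_num
    _ ≤ B ^ (0.00005 : ℝ) * (6 * 1 + 1) := by gcongr
    _ = _ := by ring

lemma dvd_six {y n : ℤ} (hy : Squarefree y) (h : (q6 y : ℤ) ∣ n) : y ∣ 6 * n := by
  have hYn : Squarefree y.natAbs := Int.squarefree_natAbs.mpr hy
  rw [← Int.natAbs_dvd]
  conv_lhs => rw [← Nat.prod_primeFactors_of_squarefree hYn]
  have := prod_pow_dvd_of_primes y.natAbs.primeFactors (fun p hp => Nat.prime_of_mem_primeFactors hp) 1 (6 * n) (fun p hp => by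
    rw [pow_one]
    by_cases h2 : p = 2
    · subst h2; exact Dvd.dvd.mul_right (by norm_num) _
    by_cases h3 : p = 3
    · subst h3; exact Dvd.dvd.mul_right (by norm_num) _
    have hm : p ∈ q6P y := Finset.mem_erase.mpr ⟨h3, Finset.mem_erase.mpr ⟨h2, hp⟩⟩
    refine Dvd.dvd.mul_left (dvd_trans ?_ h) _
    rw [Int.natCast_dvd_natCast]
    exact Finset.dvd_prod_of_mem (fun p => p) hm)
  simpa using this

/-- the skew part -/
lemma skew {a X Y : Fin 3 → ℤ} {B : ℝ} {S : Finset Pt} (h : Box a X Y B S) (big : BigC B) (hc : 648 < B ^ (0.18 : ℝ))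
    (bal : Bal Y B) (hns : ∀ P ∈ S, ¬ NSk (q6 (P.2 0)) ![X 1, X 2, Y 1, Y 2] B (emb P)) :
    (S.card : ℝ) ≤ B ^ (0.5974 : ℝ) := by
  classical
  have hB1 : 1 ≤ B := by linarith [big.two]
  have hB0 : 0 < B := by linarith
  have y1 : (0 : ℝ) < Y 1 := by exact_mod_cast (by linarith [h.Y1 1] : 0 < Y 1)
  have y2 : (0 : ℝ) < Y 2 := by exact_mod_cast (by linarith [h.Y1 2] : 0 < Y 2)
  have hex : ∀ P ∈ S, ∃ z : ℤ × ℤ, (z.1 ≠ 0 ∨ z.2 ≠ 0) ∧ |(z.1 : ℝ)| ≤ B ^ (-0.105 : ℝ) * Y 1 ∧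
      |(z.2 : ℝ)| ≤ B ^ (-0.105 : ℝ) * Y 2 ∧ (q6 (P.2 0) : ℤ) ∣ P.2 1 * z.2 - z.1 * P.2 2 := by
    intro P hP
    have := hns P hP
    unfold NSk at this
    push Not at this
    obtain ⟨z1, z2, h1, h2, h3, h4⟩ := this
    exact ⟨(z1, z2), h1, by simpa using h2, by simpa using h3, by simpa [emb] using h4⟩
  choose! z hz0 hz1 hz2 hzd using hex
  have hτ1 : B ^ (-0.105 : ℝ) < 1 := Real.rpow_lt_one_of_one_lt_of_neg (by linarith [big.two]) (by norm_num)
  have hτ0 : 0 < B ^ (-0.105 : ℝ) := by positivity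
  set τ := B ^ (-0.105 : ℝ) with hτ
  have hone : ∀ x : ℝ, B ^ (0.1975 : ℝ) ≤ x → 1 ≤ τ * x := by
    intro x hx
    calc (1 : ℝ) ≤ B ^ (0.0925 : ℝ) := Real.one_le_rpow hB1 (by norm_num)
      _ = τ * B ^ (0.1975 : ℝ) := by rw [hτ, ← Real.rpow_add hB0]; norm_num
      _ ≤ τ * x := by gcongr
  have icc : ∀ x : ℝ, 1 ≤ x → ((Finset.Icc (-⌊x⌋) ⌊x⌋).card : ℝ) ≤ 3 * x := by
    intro x hx
    have h0 : 0 ≤ ⌊x⌋ := Int.floor_nonneg.mpr (by linarith)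
    have : ((Finset.Icc (-⌊x⌋) ⌊x⌋).card : ℤ) = 2 * ⌊x⌋ + 1 := by
      rw [Int.card_Icc, Int.toNat_of_nonneg (by omega)]; ring
    have h2 : ((Finset.Icc (-⌊x⌋) ⌊x⌋).card : ℝ) = 2 * (⌊x⌋ : ℝ) + 1 := by exact_mod_cast this
    have := Int.floor_le x
    linarith
  have micc : ∀ (x : ℝ) (m : ℤ), |(m : ℝ)| ≤ x → m ∈ Finset.Icc (-⌊x⌋) ⌊x⌋ := by
    intro x m hm
    rw [abs_le] at hm
    rw [Finset.mem_Icc]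
    constructor
    · rw [neg_le]; apply Int.le_floor.mpr; push_cast; linarith
    · apply Int.le_floor.mpr; linarith
  have hne : ∀ P ∈ S, P.2 1 * (z P).2 - (z P).1 * P.2 2 ≠ 0 := by
    intro P hP he
    have s := h.sol P hP
    have cop : IsCoprime (P.2 1) (P.2 2) := ((s.cop 1 2 (by decide)).of_mul_left_right).of_mul_right_right
    have d : P.2 1 ∣ (z P).1 := cop.dvd_of_dvd_mul_right ⟨(z P).2, by linarith⟩
    have l : |(z P).1| < P.2 1 := by
      have h1 := hz1 P hP
      have h2 : (Y 1 : ℝ) ≤ P.2 1 := by exact_mod_cast h.ylo P hP 1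
      have : |((z P).1 : ℝ)| < P.2 1 := by
        calc _ ≤ τ * Y 1 := h1
          _ < 1 * Y 1 := by gcongr
          _ ≤ _ := by linarith
      exact_mod_cast this
    have z1 := Int.eq_zero_of_abs_lt_dvd d l
    rw [z1, zero_mul, sub_zero] at he
    have z2 := (mul_eq_zero.mp he).resolve_left (s.ypos 1).ne'
    exact (hz0 P hP).elim (fun h => h z1) (fun h => h z2)
  have hfb := fiber_bound S (fun P => (P.2 1, P.2 2, (z P).1, (z P).2))
    (Finset.Ico (Y 1) (2 * Y 1) ×ˢ Finset.Ico (Y 2) (2 * Y 2) ×ˢ (Finset.Icc (-⌊τ * Y 1⌋) ⌊τ * Y 1⌋) ×ˢ (Finset.Icc (-⌊τ * Y 2⌋) ⌊τ * Y 2⌋))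
    (7 * B ^ (0.00005 : ℝ) * B ^ (0.00005 : ℝ)) (by positivity) (by
      intro P hP
      simp only [Finset.mem_product]
      exact ⟨Finset.mem_Ico.mpr ⟨h.ylo P hP 1, h.yhi P hP 1⟩, Finset.mem_Ico.mpr ⟨h.ylo P hP 2, h.yhi P hP 2⟩,
        micc _ _ (hz1 P hP), micc _ _ (hz2 P hP)⟩) ?_
  · refine hfb.trans ?_
    rw [Finset.card_product, Finset.card_product, Finset.card_product]
    push_cast
    rw [card_Ico_two _ (h.Y1 1), card_Ico_two _ (h.Y1 2)]
    have i1 := icc _ (hone _ bal.y1lo)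
    have i2 := icc _ (hone _ bal.y2lo)
    have hs := bal.shi
    calc _ ≤ 7 * B ^ (0.00005 : ℝ) * B ^ (0.00005 : ℝ) * (Y 1 * (Y 2 * ((3 * (τ * Y 1)) * (3 * (τ * Y 2))))) := by gcongr
      _ = 63 * (B ^ (0.00005 : ℝ) * B ^ (0.00005 : ℝ)) * (τ * τ) * ((Y 1 * Y 2 : ℝ) * (Y 1 * Y 2)) := by ring
      _ ≤ B ^ (0.0001 : ℝ) * (B ^ (0.00005 : ℝ) * B ^ (0.00005 : ℝ)) * (τ * τ) * (B ^ (0.4025 : ℝ) * B ^ (0.4025 : ℝ)) := by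
        have := big.c1
        gcongr
        norm_num at this ⊢; linarith
      _ = B ^ (0.5952 : ℝ) := by
        rw [hτ, ← Real.rpow_add hB0, ← Real.rpow_add hB0, ← Real.rpow_add hB0, ← Real.rpow_add hB0, ← Real.rpow_add hB0, ← Real.rpow_add hB0]
        norm_num
      _ ≤ _ := Real.rpow_le_rpow_of_exponent_le hB1 (by norm_num)
  rintro ⟨v1, v2, w1, w2⟩ _
  set F := S.filter (fun P => (P.2 1, P.2 2, (z P).1, (z P).2) = (v1, v2, w1, w2)) with hF
  rcases F.eq_empty_or_nonempty with h0 | ⟨P0, hP0⟩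
  · rw [h0]; simp; positivity
  have hFS : F ⊆ S := Finset.filter_subset _ _
  have hf : ∀ P ∈ F, P.2 1 = v1 ∧ P.2 2 = v2 ∧ (z P).1 = w1 ∧ (z P).2 = w2 := fun P hP => by
    have := (Finset.mem_filter.mp hP).2
    simp only [Prod.mk.injEq] at this
    exact this
  set n := v1 * w2 - w1 * v2 with hn
  have hn0 : n ≠ 0 := by
    have := hne P0 (hFS hP0)
    obtain ⟨e1, e2, e3, e4⟩ := hf P0 hP0
    rwa [e1, e2, e3, e4] at this
  have hnb : ((6 * n).natAbs : ℝ) ≤ B ^ (3 : ℝ) := by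
    rw [Nat.cast_natAbs, Int.cast_abs]
    push_cast
    rw [hn]; push_cast
    obtain ⟨e1, e2, e3, e4⟩ := hf P0 hP0
    have hz1' := hz1 P0 (hFS hP0)
    have hz2' := hz2 P0 (hFS hP0)
    rw [e3] at hz1'
    rw [e4] at hz2'
    have b1 := h.yhi P0 (hFS hP0) 1
    have b2 := h.yhi P0 (hFS hP0) 2
    have p1 := (h.sol P0 (hFS hP0)).ypos 1
    have p2 := (h.sol P0 (hFS hP0)).ypos 2
    rw [e1] at b1 p1
    rw [e2] at b2 p2
    have b1' : |(v1 : ℝ)| ≤ 2 * Y 1 := by rw [abs_of_pos (by exact_mod_cast p1)]; exact_mod_cast b1.le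
    have b2' : |(v2 : ℝ)| ≤ 2 * Y 2 := by rw [abs_of_pos (by exact_mod_cast p2)]; exact_mod_cast b2.le
    have c1 : |(w1 : ℝ)| ≤ Y 1 := hz1'.trans (by nlinarith)
    have c2 : |(w2 : ℝ)| ≤ Y 2 := hz2'.trans (by nlinarith)
    have hs := bal.shi
    have d1 : |(v1 : ℝ) * w2| ≤ 2 * Y 1 * Y 2 := by rw [abs_mul]; gcongr
    have d2 : |(w1 : ℝ) * v2| ≤ Y 1 * (2 * Y 2) := by rw [abs_mul]; gcongr
    have d3 := abs_sub (v1 * w2 : ℝ) (w1 * v2)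
    rw [abs_mul]
    have : |(6 : ℝ)| = 6 := by norm_num
    rw [this]
    calc 6 * |(v1 : ℝ) * w2 - w1 * v2| ≤ 24 * (Y 1 * Y 2) := by nlinarith
      _ ≤ B ^ (0.18 : ℝ) * B ^ (0.4025 : ℝ) := by gcongr; linarith
      _ = B ^ (0.5825 : ℝ) := by rw [← Real.rpow_add hB0]; norm_num
      _ ≤ _ := Real.rpow_le_rpow_of_exponent_le hB1 (by norm_num)
  have hdv := big.dv _ hnb
  have hFb := h.mono hFS
  have hfb2 := fiber_bound F (fun P => P.2 0) ((6 * n).natAbs.divisors.image (fun d : ℕ => (d : ℤ))) (7 * B ^ (0.00005 : ℝ)) (by positivity) (by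
    intro P hP
    obtain ⟨e1, e2, e3, e4⟩ := hf P hP
    have hd := hzd P (hFS hP)
    rw [e1, e2, e3, e4] at hd
    have := dvd_six ((hFb.sol P hP).sqf 0) hd
    rw [Finset.mem_image]
    refine ⟨(P.2 0).natAbs, ?_, ?_⟩
    · rw [Nat.mem_divisors]
      refine ⟨Int.natAbs_dvd_natAbs.mpr this, ?_⟩
      omega
    · have := (hFb.sol P hP).ypos 0
      omega) (by
    intro y0 _
    have hsub : F.filter (fun P => P.2 0 = y0) ⊆ F := Finset.filter_subset _ _
    refine fix_y (y := ![y0, v1, v2]) (hFb.mono hsub) big bal ?_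
    intro P hP
    obtain ⟨e1, e2, e3, e4⟩ := hf P (hsub hP)
    have e0 := (Finset.mem_filter.mp hP).2
    funext i; fin_cases i
    · exact e0
    · exact e1
    · exact e2)
  refine hfb2.trans ?_
  have : (((6 * n).natAbs.divisors.image (fun d : ℕ => (d : ℤ))).card : ℝ) ≤ (6 * n).natAbs.divisors.card := by
    exact_mod_cast Finset.card_image_le
  have h3 : (0 : ℝ) ≤ (6 * n).natAbs.divisors.card := by positivity
  gcongr
  linarith

lemma main_box {a X Y : Fin 3 → ℤ} {B : ℝ} {S : Finset Pt} (h : Box a X Y B S) (big : BigC B) (hc : 648 < B ^ (0.18 : ℝ))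
    (bal : Bal Y B) : (S.card : ℝ) ≤ 3 * B ^ (0.5974 : ℝ) := by
  classical
  set p : Pt → Prop := fun P => NSk (q6 (P.2 0)) ![X 1, X 2, Y 1, Y 2] B (emb P) with hp
  have h1 := nonskew (h.mono (Finset.filter_subset p S)) big hc bal (fun P hP => (Finset.mem_filter.mp hP).2)
  have h2 := skew (h.mono (Finset.filter_subset (fun P => ¬ p P) S)) big hc bal (fun P hP => (Finset.mem_filter.mp hP).2)
  have h3 : ((S.filter p).card : ℝ) + (S.filter (fun P => ¬ p P)).card = S.card := by
    exact_mod_cast Finset.card_filter_add_card_filter_not (s := S) p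
  linarith

set_option linter.unusedVariables false

lemma sorted_box : ∃ K : ℝ, 1 ≤ K ∧ ∀ (a X Y : Fin 3 → ℤ) (B : ℝ) (S : Finset Pt), 2 ≤ B → Box a X Y B S →
    Y 0 ≤ Y 1 → Y 1 ≤ Y 2 → (S.card : ℝ) ≤ K * B ^ (0.5976 : ℝ) := by
  obtain ⟨C1, hC1, hT1⟩ := T1 0.0001 (by norm_num)
  obtain ⟨C3, hC3, hT3⟩ := T3 0.0001 (by norm_num)
  obtain ⟨CL, hCL, hLS⟩ := LS 0.0001 (by norm_num)
  obtain ⟨B0, hB0'⟩ := Filter.eventually_atTop.mp (bigC.and (ev_const 649 0.18 (by norm_num)))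
  have hK : (1 : ℝ) ≤ 2 * C1 + 2 * C3 + 2 * CL + 3 + 2 * C1 * |B0| ^ 3 := by
    have : 0 ≤ |B0| ^ 3 := by positivity
    nlinarith
  refine ⟨_, hK, ?_⟩
  intro a X Y B S hB hbox h01 h12
  have hB1 : 1 ≤ B := by linarith
  have hBp : 0 < B := by linarith
  have hb3 : (0 : ℝ) ≤ 2 * C1 * |B0| ^ 3 := by positivity
  have hE : 0 < B ^ (0.5976 : ℝ) := by positivity
  have comb : ∀ c x : ℝ, 1 ≤ c → x ≤ c * B ^ (0.0001 : ℝ) * (2 * B ^ (0.5975 : ℝ)) → x ≤ 2 * c * B ^ (0.5976 : ℝ) := by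
    intro c x hc hx
    refine hx.trans (le_of_eq ?_)
    calc c * B ^ (0.0001 : ℝ) * (2 * B ^ (0.5975 : ℝ)) = 2 * c * (B ^ (0.0001 : ℝ) * B ^ (0.5975 : ℝ)) := by ring
      _ = _ := by rw [← Real.rpow_add hBp]; norm_num
  have wk : ∀ c : ℝ, c ≤ 2 * C1 + 2 * C3 + 2 * CL + 3 + 2 * C1 * |B0| ^ 3 → (S.card : ℝ) ≤ c * B ^ (0.5976 : ℝ) →
      (S.card : ℝ) ≤ (2 * C1 + 2 * C3 + 2 * CL + 3 + 2 * C1 * |B0| ^ 3) * B ^ (0.5976 : ℝ) := by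
    intro c hc h
    exact h.trans (by gcongr)
  rcases S.eq_empty_or_nonempty with h0 | ⟨P, hP⟩
  · rw [h0]; simp; positivity
  have Yp : ∀ i, (0 : ℝ) < Y i := fun i => by exact_mod_cast (by linarith [hbox.Y1 i] : 0 < Y i)
  have Xp : ∀ i, (0 : ℝ) < X i := fun i => by exact_mod_cast (by linarith [hbox.X1 i] : 0 < X i)
  have y0 := Yp 0; have y1 := Yp 1; have y2 := Yp 2; have x1 := Xp 1; have x2 := Xp 2
  have t1 := hT1 a X Y B S hB1 hbox
  have hsq : √B ≤ B ^ (0.5975 : ℝ) := by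
    rw [Real.sqrt_eq_rpow]; exact Real.rpow_le_rpow_of_exponent_le hB1 (by norm_num)
  by_cases hsmall : B < B0
  · apply wk (2 * C1 * |B0| ^ 3) (by linarith)
    have p1 : (Y 0 * Y 1 * Y 2 : ℝ) ≤ B := by
      have h1 := hbox.prodY hP
      push_cast at h1
      refine le_trans ?_ h1
      have : ∀ i, (Y i : ℝ) ≤ P.2 i := fun i => by exact_mod_cast hbox.ylo P hP i
      have e0 := this 0; have e1 := this 1; have e2 := this 2
      have := y0.trans_le e0; have := y1.trans_le e1
      gcongr
    have p2 : √B ≤ B := by rw [Real.sqrt_le_left (by linarith)]; nlinarith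
    have p3 : B ^ (0.0001 : ℝ) ≤ B := by
      calc B ^ (0.0001 : ℝ) ≤ B ^ (1 : ℝ) := Real.rpow_le_rpow_of_exponent_le hB1 (by norm_num)
        _ = B := Real.rpow_one B
    have p4 : B ≤ |B0| := hsmall.le.trans (le_abs_self _)
    have p5 : 1 ≤ B ^ (0.5976 : ℝ) := Real.one_le_rpow hB1 (by norm_num)
    calc (S.card : ℝ) ≤ _ := t1
      _ ≤ C1 * B * (B + B) := by gcongr
      _ = 2 * C1 * (B ^ 2 * 1) := by ring
      _ ≤ 2 * C1 * (|B0| ^ 2 * |B0|) := by gcongr; linarith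
      _ = 2 * C1 * |B0| ^ 3 := by ring
      _ ≤ _ := le_mul_of_one_le_right hb3 p5
  push Not at hsmall
  obtain ⟨big, hc⟩ := hB0' B hsmall
  have lB : 0 < Real.log B := Real.log_pos (by linarith)
  set l := Real.log B with hl
  have lg : ∀ (x e : ℝ), 0 < x → (Real.log x ≤ e * l) → x ≤ B ^ e := fun x e hx h =>
    (Real.le_rpow_iff_log_le hx hBp).mpr h
  have lg' : ∀ (x e : ℝ), 0 < x → (e * l ≤ Real.log x) → B ^ e ≤ x := fun x e hx h =>
    (Real.rpow_le_iff_le_log hBp hx).mpr h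
  have xy : ∀ i, 2 * Real.log (X i) + 3 * Real.log (Y i) ≤ l := by
    intro i
    have h1 := Real.log_le_log (by have := Xp i; have := Yp i; positivity) (hbox.XY' hP i)
    rw [Real.log_mul (pow_pos (Xp i) 2).ne' (pow_pos (Yp i) 3).ne', Real.log_pow, Real.log_pow] at h1
    push_cast at h1
    exact h1
  have xy1 := xy 1
  have xy2 := xy 2
  have o1 : Real.log (Y 0) ≤ Real.log (Y 1) := Real.log_le_log y0 (by exact_mod_cast h01)
  have o2 : Real.log (Y 1) ≤ Real.log (Y 2) := Real.log_le_log y1 (by exact_mod_cast h12)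
  have o0 : 0 ≤ Real.log (Y 0) := Real.log_nonneg (by exact_mod_cast hbox.Y1 0)
  have m1 : Real.log (Y 0 * Y 1 * Y 2) = Real.log (Y 0) + Real.log (Y 1) + Real.log (Y 2) := by
    rw [Real.log_mul (by positivity) (by positivity), Real.log_mul (by positivity) (by positivity)]
  by_cases c1 : Real.log (Y 0) + Real.log (Y 1) + Real.log (Y 2) ≤ 0.5975 * l
  · apply wk (2 * C1) (by linarith)
    apply comb _ _ hC1 (t1.trans _)
    have := lg (Y 0 * Y 1 * Y 2) 0.5975 (by positivity) (by rw [m1]; exact c1)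
    gcongr
    linarith
  push Not at c1
  have m2 : Real.log (X 1 * X 2 * Y 0) = Real.log (X 1) + Real.log (X 2) + Real.log (Y 0) := by
    rw [Real.log_mul (by positivity) (by positivity), Real.log_mul (by positivity) (by positivity)]
  have m3 : Real.log (X 1 * X 2 * Y 0 * (Y 1 * Y 2 / (Y 0 : ℝ) ^ 3)) = Real.log (X 1) + Real.log (X 2) + Real.log (Y 0)
      + (Real.log (Y 1) + Real.log (Y 2) - 3 * Real.log (Y 0)) := by
    rw [Real.log_mul (by positivity) (by positivity), m2, Real.log_div (by positivity) (by positivity),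
      Real.log_mul (by positivity) (by positivity), Real.log_pow]
    push_cast; ring
  by_cases c2 : 0.5975 * l < l - 0.5 * (Real.log (Y 1) + Real.log (Y 2)) - 2 * Real.log (Y 0)
  · apply wk (2 * CL) (by linarith)
    apply comb _ _ hCL ((hLS a X Y B S hB1 hbox).trans _)
    have m4 : Real.log (X 1 * X 2 * Y 0 * Y 1) = Real.log (X 1) + Real.log (X 2) + Real.log (Y 0) + Real.log (Y 1) := by
      rw [Real.log_mul (by positivity) (by positivity), m2]
    set r := (Y 2 : ℝ) / (Y 0 : ℝ) ^ 3 with hr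
    have r0 : 0 < r := by positivity
    have lr : Real.log r = Real.log (Y 2) - 3 * Real.log (Y 0) := by
      rw [hr, Real.log_div (by positivity) (by positivity), Real.log_pow]; push_cast; ring
    have h2 : (2 : ℝ) ^ (0.64 : ℝ) ≤ 2 := by
      calc (2 : ℝ) ^ (0.64 : ℝ) ≤ 2 ^ (1 : ℝ) := Real.rpow_le_rpow_of_exponent_le (by norm_num) (by norm_num)
        _ = 2 := Real.rpow_one 2
    apply mul_le_mul_of_nonneg_left _ (by positivity)
    rcases le_total r 1 with hr1 | hr1
    · have k1 : (1 + r) ^ (0.64 : ℝ) ≤ 2 := le_trans (by gcongr; linarith) h2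
      have k2 := lg (X 1 * X 2 * Y 0 * Y 1) 0.5975 (by positivity) (by rw [m4]; linarith)
      calc (X 1 * X 2 * Y 0 * Y 1 : ℝ) * (1 + r) ^ (0.64 : ℝ) ≤ B ^ (0.5975 : ℝ) * 2 := by gcongr
        _ = _ := by ring
    · have k1 : (1 + r) ^ (0.64 : ℝ) ≤ 2 * r ^ (0.64 : ℝ) := by
        calc (1 + r) ^ (0.64 : ℝ) ≤ (2 * r) ^ (0.64 : ℝ) := by gcongr; linarith
          _ = 2 ^ (0.64 : ℝ) * r ^ (0.64 : ℝ) := Real.mul_rpow (by norm_num) r0.le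
          _ ≤ _ := by gcongr
      have k2 := lg (X 1 * X 2 * Y 0 * Y 1 * r ^ (0.64 : ℝ)) 0.5975 (by positivity) (by
        rw [Real.log_mul (by positivity) (by positivity), m4, Real.log_rpow r0, lr]; linarith)
      calc (X 1 * X 2 * Y 0 * Y 1 : ℝ) * (1 + r) ^ (0.64 : ℝ) ≤ (X 1 * X 2 * Y 0 * Y 1 : ℝ) * (2 * r ^ (0.64 : ℝ)) := by gcongr
        _ = 2 * (X 1 * X 2 * Y 0 * Y 1 * r ^ (0.64 : ℝ)) := by ring
        _ ≤ _ := by gcongr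
  push Not at c2
  by_cases c3 : l - 1.5 * (Real.log (Y 1) + Real.log (Y 2)) + Real.log (Y 0) ≤ 0.5975 * l
  · apply wk (2 * C3) (by linarith)
    apply comb _ _ hC3 ((hT3 a X Y B S hB1 hbox).trans _)
    have k1 := lg (X 1 * X 2 * Y 0) 0.5975 (by positivity) (by rw [m2]; linarith)
    have k2 := lg (X 1 * X 2 * Y 0 * (Y 1 * Y 2 / (Y 0 : ℝ) ^ 3)) 0.5975 (by positivity) (by rw [m3]; linarith)
    apply mul_le_mul_of_nonneg_left _ (by positivity)
    linarith
  push Not at c3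
  apply wk 3 (by linarith)
  have m5 : Real.log (Y 1 * Y 2) = Real.log (Y 1) + Real.log (Y 2) := Real.log_mul (by positivity) (by positivity)
  refine (main_box hbox big (by linarith) ⟨lg' _ _ y0 ?_, lg _ _ y0 ?_, lg' _ _ y1 ?_, lg' _ _ y2 ?_,
    lg' _ _ (by positivity) ?_, lg _ _ (by positivity) ?_⟩).trans ?_
  · linarith
  · linarith
  · linarith
  · linarith
  · rw [m5]; linarith
  · rw [m5]; linarith
  · gcongr
    norm_num

lemma Sol.perm {a x y : Fin 3 → ℤ} (s : Sol a x y) (σ : Equiv.Perm (Fin 3)) : Sol (a ∘ σ) (x ∘ σ) (y ∘ σ) where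
  xpos i := s.xpos _
  ypos i := s.ypos _
  eq := by
    have h := Equiv.sum_comp σ (fun i => a i * x i ^ 2 * y i ^ 3)
    rw [Fin.sum_univ_three, Fin.sum_univ_three] at h
    simpa using h.trans s.eq
  sqf i := s.sqf _
  cop i j hij := s.cop _ _ (fun h => hij (σ.injective h))
  acop i j := s.acop _ _
  ane i := s.ane _

lemma any_box : ∃ K : ℝ, 1 ≤ K ∧ ∀ (a X Y : Fin 3 → ℤ) (B : ℝ) (S : Finset Pt), 2 ≤ B → Box a X Y B S →
    (S.card : ℝ) ≤ K * B ^ (0.5976 : ℝ) := by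
  classical
  obtain ⟨K, hK, h⟩ := sorted_box
  refine ⟨K, hK, ?_⟩
  intro a X Y B S hB hb
  set σ := Tuple.sort Y with hσ
  have hm : Monotone (Y ∘ σ) := Tuple.monotone_sort Y
  set g : Pt → Pt := fun P => (P.1 ∘ σ, P.2 ∘ σ) with hg
  have hinj : Function.Injective g := by
    intro P P' h
    simp only [hg, Prod.mk.injEq] at h
    exact Prod.ext (σ.surjective.injective_comp_right h.1) (σ.surjective.injective_comp_right h.2)
  rw [← Finset.card_image_of_injective S hinj]
  apply h (a ∘ σ) (X ∘ σ) (Y ∘ σ) B _ hB _ (hm (by decide)) (hm (by decide))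
  refine ⟨?_, ?_, ?_, ?_, ?_, fun i => hb.X1 _, fun i => hb.Y1 _, ?_⟩
  · intro R hR
    obtain ⟨P, hP, rfl⟩ := Finset.mem_image.mp hR
    exact (hb.sol P hP).perm σ
  · intro R hR i
    obtain ⟨P, hP, rfl⟩ := Finset.mem_image.mp hR
    exact hb.xlo P hP _
  · intro R hR i
    obtain ⟨P, hP, rfl⟩ := Finset.mem_image.mp hR
    exact hb.xhi P hP _
  · intro R hR i
    obtain ⟨P, hP, rfl⟩ := Finset.mem_image.mp hR
    exact hb.ylo P hP _
  · intro R hR i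
    obtain ⟨P, hP, rfl⟩ := Finset.mem_image.mp hR
    exact hb.yhi P hP _
  · intro R hR i
    obtain ⟨P, hP, rfl⟩ := Finset.mem_image.mp hR
    exact hb.bd P hP _

lemma all_sols : ∃ K : ℝ, 1 ≤ K ∧ ∀ (a : Fin 3 → ℤ) (B : ℝ) (S : Finset Pt), 2 ≤ B → (∀ P ∈ S, Sol a P.1 P.2) →
    (∀ P ∈ S, ∀ i, ((|a i| * P.1 i ^ 2 * P.2 i ^ 3 : ℤ) : ℝ) ≤ B) → (S.card : ℝ) ≤ K * B ^ (0.598 : ℝ) := by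
  classical
  obtain ⟨K, hK, h⟩ := any_box
  refine ⟨K * (2 / 0.00005 + 1) ^ 6, ?_, ?_⟩
  · have : (1 : ℝ) ≤ (2 / 0.00005 + 1) ^ 6 := by norm_num
    nlinarith
  intro a B S hB hs hbd
  have hB1 : 1 ≤ B := by linarith
  have hB0 : 0 < B := by linarith
  set L := Nat.log 2 ⌊B⌋₊ with hL
  have hfl : ⌊B⌋₊ ≠ 0 := by
    have : 1 ≤ ⌊B⌋₊ := Nat.le_floor (by exact_mod_cast hB1)
    omega
  have hL2 : (2 : ℝ) ^ L ≤ B := by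
    have h1 : 2 ^ L ≤ ⌊B⌋₊ := Nat.pow_log_le_self 2 hfl
    calc (2 : ℝ) ^ L ≤ (⌊B⌋₊ : ℝ) := by exact_mod_cast h1
      _ ≤ B := Nat.floor_le hB0.le
  have hLB : (L : ℝ) + 1 ≤ (2 / 0.00005 + 1) * B ^ (0.00005 : ℝ) := by
    have l1 := Real.log_le_log (by positivity) hL2
    rw [Real.log_pow] at l1
    have l2 := Real.log_two_gt_d9
    have l3 := Real.log_le_rpow_div hB0.le (show (0 : ℝ) < 0.00005 by norm_num)
    have hb1 : 1 ≤ B ^ (0.00005 : ℝ) := Real.one_le_rpow hB1 (by norm_num)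
    have hL0 : (0 : ℝ) ≤ L := Nat.cast_nonneg _
    have l4 : (L : ℝ) ≤ 2 * (B ^ (0.00005 : ℝ) / 0.00005) := by nlinarith
    have : 2 * (B ^ (0.00005 : ℝ) / 0.00005) = (2 / 0.00005) * B ^ (0.00005 : ℝ) := by ring
    linarith
  have one_le : ∀ P ∈ S, ∀ i, 1 ≤ P.1 i ∧ 1 ≤ P.2 i := fun P hP i => ⟨(hs P hP).xpos i, (hs P hP).ypos i⟩
  have leB : ∀ P ∈ S, ∀ i, (P.1 i : ℝ) ≤ B ∧ (P.2 i : ℝ) ≤ B := by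
    intro P hP i
    have h1 := (hs P hP).one_le_abs_a i
    obtain ⟨hx, hy⟩ := one_le P hP i
    have e1 : P.1 i ≤ P.1 i ^ 2 := le_self_pow₀ hx (by norm_num)
    have e2 : P.2 i ≤ P.2 i ^ 3 := le_self_pow₀ hy (by norm_num)
    have e3 : 1 ≤ P.1 i ^ 2 := one_le_pow₀ hx
    have e4 : 1 ≤ P.2 i ^ 3 := one_le_pow₀ hy
    have hb := hbd P hP i
    have f0 : P.1 i ^ 2 ≤ |a i| * P.1 i ^ 2 := le_mul_of_one_le_left (by linarith) h1
    have f1 : P.1 i ≤ |a i| * P.1 i ^ 2 * P.2 i ^ 3 := by nlinarith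
    have f2 : P.2 i ≤ |a i| * P.1 i ^ 2 * P.2 i ^ 3 := by nlinarith
    exact ⟨le_trans (by exact_mod_cast f1) hb, le_trans (by exact_mod_cast f2) hb⟩
  have inr : ∀ m : ℤ, (m : ℝ) ≤ B → Nat.log 2 m.toNat ∈ Finset.range (L + 1) := by
    intro m hm
    rw [Finset.mem_range, Nat.lt_succ_iff]
    apply Nat.log_mono_right
    apply Nat.le_floor
    rcases le_total 0 m with h0 | h0
    · have : ((m.toNat : ℤ) : ℝ) = m := by rw [Int.toNat_of_nonneg h0]
      have h2 : (m.toNat : ℝ) = m := by exact_mod_cast this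
      linarith
    · rw [Int.toNat_of_nonpos h0]; simp; linarith
  have hfb := fiber_bound S (fun P => ((fun i => Nat.log 2 (P.1 i).toNat : Fin 3 → ℕ), (fun i => Nat.log 2 (P.2 i).toNat : Fin 3 → ℕ)))
    (Fintype.piFinset (fun _ => Finset.range (L + 1)) ×ˢ Fintype.piFinset (fun _ => Finset.range (L + 1)))
    (K * B ^ (0.5976 : ℝ)) (by positivity) (by
      intro P hP
      simp only [Finset.mem_product, Fintype.mem_piFinset]
      exact ⟨fun i => inr _ (leB P hP i).1, fun i => inr _ (leB P hP i).2⟩) (by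
      rintro ⟨u, v⟩ _
      set F := S.filter (fun P : Pt => ((fun i => Nat.log 2 (P.1 i).toNat : Fin 3 → ℕ), (fun i => Nat.log 2 (P.2 i).toNat : Fin 3 → ℕ)) = (u, v)) with hF
      have hFS : F ⊆ S := Finset.filter_subset _ _
      have dy : ∀ (m : ℤ) (k : ℕ), 1 ≤ m → Nat.log 2 m.toNat = k → (2 : ℤ) ^ k ≤ m ∧ m < 2 * 2 ^ k := by
        intro m k hm hk
        have h1 : m.toNat ≠ 0 := by omega
        have h2 := Nat.pow_log_le_self 2 h1
        have h3 := Nat.lt_pow_succ_log_self (b := 2) (by norm_num) m.toNat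
        rw [hk] at h2 h3
        have e : ((m.toNat : ℕ) : ℤ) = m := Int.toNat_of_nonneg (by linarith)
        rw [← e, ← pow_succ']
        exact ⟨by exact_mod_cast h2, by exact_mod_cast h3⟩
      have hu : ∀ P ∈ F, ∀ i, Nat.log 2 (P.1 i).toNat = u i := fun P hP i => by
        have h1 := (Finset.mem_filter.mp hP).2
        rw [Prod.mk.injEq] at h1
        exact congrFun h1.1 i
      have hv : ∀ P ∈ F, ∀ i, Nat.log 2 (P.2 i).toNat = v i := fun P hP i => by
        have h1 := (Finset.mem_filter.mp hP).2
        rw [Prod.mk.injEq] at h1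
        exact congrFun h1.2 i
      apply h a (fun i => 2 ^ u i) (fun i => 2 ^ v i) B F hB
      refine ⟨fun P hP => hs P (hFS hP), fun P hP i => (dy _ _ (one_le P (hFS hP) i).1 (hu P hP i)).1,
        fun P hP i => (dy _ _ (one_le P (hFS hP) i).1 (hu P hP i)).2,
        fun P hP i => (dy _ _ (one_le P (hFS hP) i).2 (hv P hP i)).1,
        fun P hP i => (dy _ _ (one_le P (hFS hP) i).2 (hv P hP i)).2, ?_, ?_, fun P hP => hbd P (hFS hP)⟩
      · intro i; exact one_le_pow₀ (by norm_num)
      · intro i; exact one_le_pow₀ (by norm_num))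
  refine hfb.trans ?_
  rw [Finset.card_product, Fintype.card_piFinset]
  simp only [Finset.card_range, Finset.prod_const, Finset.card_univ, Fintype.card_fin]
  push_cast
  calc K * B ^ (0.5976 : ℝ) * (((L : ℝ) + 1) ^ 3 * ((L : ℝ) + 1) ^ 3)
      = K * B ^ (0.5976 : ℝ) * ((L : ℝ) + 1) ^ 6 := by ring
    _ ≤ K * B ^ (0.5976 : ℝ) * ((2 / 0.00005 + 1) * B ^ (0.00005 : ℝ)) ^ 6 := by gcongr
    _ = K * (2 / 0.00005 + 1) ^ 6 * (B ^ (0.5976 : ℝ) * (B ^ (0.00005 : ℝ)) ^ 6) := by ring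
    _ = K * (2 / 0.00005 + 1) ^ 6 * B ^ (0.5979 : ℝ) := by
      rw [← Real.rpow_natCast (B ^ (0.00005 : ℝ)), ← Real.rpow_mul hB0.le, ← Real.rpow_add hB0]; norm_num
    _ ≤ _ := by
      gcongr
      norm_num

lemma nSet_cop {a₁ a₂ a₃ x y z x' y' z' : ℤ} (hxy : x ≠ 0)
    (heq : a₁ * x ^ 2 * x' ^ 3 + a₂ * y ^ 2 * y' ^ 3 + a₃ * z ^ 2 * z' ^ 3 = 0)
    (hc : IsCoprime a₃ (x * x')) (hx' : x' ≠ 0)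
    (hg : ∀ p : ℤ, Prime p → p ∣ x * x' → p ∣ y * y' → p ∣ z * z' → False) :
    IsCoprime (x * x') (y * y') := by
  apply isCoprime_of_prime_dvd
  · rintro ⟨h1, h2⟩
    exact mul_ne_zero hxy hx' h1
  intro p hp h1 h2
  have d1 : p ∣ a₁ * x ^ 2 * x' ^ 3 :=
    h1.trans ⟨a₁ * x * x' ^ 2, by ring⟩
  have d2 : p ∣ a₂ * y ^ 2 * y' ^ 3 :=
    h2.trans ⟨a₂ * y * y' ^ 2, by ring⟩
  have d3 : p ∣ a₃ * z ^ 2 * z' ^ 3 := by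
    have e : a₃ * z ^ 2 * z' ^ 3 = -(a₁ * x ^ 2 * x' ^ 3 + a₂ * y ^ 2 * y' ^ 3) := by linarith
    rw [e]
    exact (dvd_add d1 d2).neg_right
  apply hg p hp h1 h2
  rcases hp.dvd_or_dvd d3 with h | h
  · rcases hp.dvd_or_dvd h with h | h
    · exact absurd (hc.isUnit_of_dvd' h h1) hp.not_unit
    · exact Dvd.dvd.mul_right (hp.dvd_of_dvd_pow h) _
  · exact Dvd.dvd.mul_left (hp.dvd_of_dvd_pow h) _

lemma nSet_sol {a₁ a₂ a₃ x₁ x₂ x₃ y₁ y₂ y₃ : ℤ} (n₁ : a₁ ≠ 0) (n₂ : a₂ ≠ 0) (n₃ : a₃ ≠ 0)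
    (px₁ : 0 < x₁) (px₂ : 0 < x₂) (px₃ : 0 < x₃) (py₁ : 0 < y₁) (py₂ : 0 < y₂) (py₃ : 0 < y₃)
    (heq : a₁ * x₁ ^ 2 * y₁ ^ 3 + a₂ * x₂ ^ 2 * y₂ ^ 3 + a₃ * x₃ ^ 2 * y₃ ^ 3 = 0)
    (q₁ : Squarefree (a₁ * y₁)) (q₂ : Squarefree (a₂ * y₂)) (q₃ : Squarefree (a₃ * y₃))
    (hg : Int.gcd (x₁ * y₁) (Int.gcd (x₂ * y₂) (x₃ * y₃)) = 1)
    (hag : Int.gcd (a₁ * a₂ * a₃) (x₁ * x₂ * x₃ * y₁ * y₂ * y₃) = 1) :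
    Sol ![a₁, a₂, a₃] ![x₁, x₂, x₃] ![y₁, y₂, y₃] := by
  have hA := Int.isCoprime_iff_gcd_eq_one.mpr hag
  have cc : ∀ a m : ℤ, a ∣ a₁ * a₂ * a₃ → m ∣ x₁ * x₂ * x₃ * y₁ * y₂ * y₃ → IsCoprime a m :=
    fun a m h1 h2 => (hA.of_isCoprime_of_dvd_left h1).of_isCoprime_of_dvd_right h2
  have A₁ : a₁ ∣ a₁ * a₂ * a₃ := ⟨a₂ * a₃, by ring⟩
  have A₂ : a₂ ∣ a₁ * a₂ * a₃ := ⟨a₁ * a₃, by ring⟩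
  have A₃ : a₃ ∣ a₁ * a₂ * a₃ := ⟨a₁ * a₂, by ring⟩
  have M₁ : x₁ * y₁ ∣ x₁ * x₂ * x₃ * y₁ * y₂ * y₃ := ⟨x₂ * x₃ * y₂ * y₃, by ring⟩
  have M₂ : x₂ * y₂ ∣ x₁ * x₂ * x₃ * y₁ * y₂ * y₃ := ⟨x₁ * x₃ * y₁ * y₃, by ring⟩
  have M₃ : x₃ * y₃ ∣ x₁ * x₂ * x₃ * y₁ * y₂ * y₃ := ⟨x₁ * x₂ * y₁ * y₂, by ring⟩
  have hp : ∀ p : ℤ, Prime p → p ∣ x₁ * y₁ → p ∣ x₂ * y₂ → p ∣ x₃ * y₃ → False := by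
    intro p hp h1 h2 h3
    have h4 : p ∣ (Int.gcd (x₂ * y₂) (x₃ * y₃) : ℤ) := Int.dvd_coe_gcd h2 h3
    have h5 := Int.dvd_coe_gcd h1 h4
    rw [hg] at h5
    exact hp.not_unit (isUnit_of_dvd_one (by simpa using h5))
  have C₁₂ : IsCoprime (x₁ * y₁) (x₂ * y₂) :=
    nSet_cop px₁.ne' heq (cc _ _ A₃ M₁) py₁.ne' hp
  have C₁₃ : IsCoprime (x₁ * y₁) (x₃ * y₃) :=
    nSet_cop (a₁ := a₁) (a₂ := a₃) (a₃ := a₂) (z := x₂) (z' := y₂) px₁.ne' (by linarith) (cc _ _ A₂ M₁) py₁.ne'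
      (fun p h h1 h2 h3 => hp p h h1 h3 h2)
  have C₂₃ : IsCoprime (x₂ * y₂) (x₃ * y₃) :=
    nSet_cop (a₁ := a₂) (a₂ := a₃) (a₃ := a₁) (z := x₁) (z' := y₁) px₂.ne' (by linarith) (cc _ _ A₁ M₂) py₂.ne'
      (fun p h h1 h2 h3 => hp p h h3 h1 h2)
  constructor
  · intro i; fin_cases i <;> simpa
  · intro i; fin_cases i <;> simpa
  · simpa using heq
  · intro i
    fin_cases i
    · exact q₁.squarefree_of_dvd (dvd_mul_left _ _)
    · exact q₂.squarefree_of_dvd (dvd_mul_left _ _)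
    · exact q₃.squarefree_of_dvd (dvd_mul_left _ _)
  · intro i j hij
    fin_cases i <;> fin_cases j
    · exact absurd rfl hij
    · exact C₁₂
    · exact C₁₃
    · exact C₁₂.symm
    · exact absurd rfl hij
    · exact C₂₃
    · exact C₁₃.symm
    · exact C₂₃.symm
    · exact absurd rfl hij
  · intro i j
    fin_cases i <;> fin_cases j
    · exact cc _ _ A₁ M₁
    · exact cc _ _ A₁ M₂
    · exact cc _ _ A₁ M₃
    · exact cc _ _ A₂ M₁
    · exact cc _ _ A₂ M₂
    · exact cc _ _ A₂ M₃
    · exact cc _ _ A₃ M₁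
    · exact cc _ _ A₃ M₂
    · exact cc _ _ A₃ M₃
  · intro i; fin_cases i <;> simpa

/-- For every `ε > 0` there is a constant `C(ε)` such that for all nonzero squarefree
pairwise coprime integers `a₁, a₂, a₃` and all real `B ≥ 2`,
`n(B; a₁, a₂, a₃) ≤ C(ε) * B ^ (3/5 - 3/1555 + ε)`. -/
theorem count_nSet (ε : ℝ) (hε : 0 < ε) :
    ∃ C : ℝ, 0 < C ∧ ∀ a₁ a₂ a₃ : ℤ, a₁ ≠ 0 → a₂ ≠ 0 → a₃ ≠ 0 →
      Squarefree a₁ → Squarefree a₂ → Squarefree a₃ →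
      IsCoprime a₁ a₂ → IsCoprime a₁ a₃ → IsCoprime a₂ a₃ →
      ∀ B : ℝ, 2 ≤ B →
        ((nSet B a₁ a₂ a₃).ncard : ℝ) ≤ C * B ^ (3 / 5 - 3 / 1555 + ε : ℝ) := by
  obtain ⟨K, hK, h⟩ := all_sols
  refine ⟨K, by linarith, ?_⟩
  intro a₁ a₂ a₃ n₁ n₂ n₃ s₁ s₂ s₃ c₁₂ c₁₃ c₂₃ B hB
  have hE : B ^ (0.598 : ℝ) ≤ B ^ (3 / 5 - 3 / 1555 + ε : ℝ) :=
    Real.rpow_le_rpow_of_exponent_le (by linarith) (by norm_num; linarith)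
  have hE0 : 0 ≤ B ^ (3 / 5 - 3 / 1555 + ε : ℝ) := by positivity
  by_cases hfin : (nSet B a₁ a₂ a₃).Finite
  swap
  · rw [Set.Infinite.ncard hfin]
    push_cast
    positivity
  classical
  let f : ℤ × ℤ × ℤ × ℤ × ℤ × ℤ → Pt :=
    fun t => (![t.1, t.2.1, t.2.2.1], ![t.2.2.2.1, t.2.2.2.2.1, t.2.2.2.2.2])
  have hf : Function.Injective f := by
    rintro ⟨p1, p2, p3, p4, p5, p6⟩ ⟨q1, q2, q3, q4, q5, q6⟩ hpq
    simp only [f, Prod.mk.injEq] at hpq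
    obtain ⟨e1, e2⟩ := hpq
    have a0 := congrFun e1 0
    have a1 := congrFun e1 1
    have a2 := congrFun e1 2
    have b0 := congrFun e2 0
    have b1 := congrFun e2 1
    have b2 := congrFun e2 2
    simp at a0 a1 a2 b0 b1 b2
    simp [a0, a1, a2, b0, b1, b2]
  have key := h ![a₁, a₂, a₃] B (hfin.toFinset.image f) hB ?_ ?_
  · rw [Finset.card_image_of_injective _ hf, ← Set.ncard_eq_toFinset_card _ hfin] at key
    exact key.trans (by gcongr)
  · intro P hP
    obtain ⟨t, ht, rfl⟩ := Finset.mem_image.mp hP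
    rw [Set.Finite.mem_toFinset] at ht
    obtain ⟨x₁, x₂, x₃, y₁, y₂, y₃, rfl, px₁, px₂, px₃, py₁, py₂, py₃, heq, q₁, q₂, q₃, b₁, b₂, b₃, hg, hag⟩ := ht
    exact nSet_sol n₁ n₂ n₃ px₁ px₂ px₃ py₁ py₂ py₃ heq q₁ q₂ q₃ hg hag
  · intro P hP
    obtain ⟨t, ht, rfl⟩ := Finset.mem_image.mp hP
    rw [Set.Finite.mem_toFinset] at ht
    obtain ⟨x₁, x₂, x₃, y₁, y₂, y₃, rfl, px₁, px₂, px₃, py₁, py₂, py₃, heq, q₁, q₂, q₃, b₁, b₂, b₃, hg, hag⟩ := ht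
    intro i
    fin_cases i
    · exact b₁
    · exact b₂
    · exact b₃
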